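/- Let X be a geodesic metric space homeomorphic to D̄ whose boundary circle ∂X has finite length. If there exists L > 0 such that H²(B(x,r)) ≤ L·r² for all x ∈ X and r > 0, and if X is linearly locally connected, then there exists a quasisymmetric homeomorphism u : D̄ → X. -/

import Mathlib

noncomputable section

/-- The Euclidean plane `ℝ²`. -/
abbrev E2 : Type := EuclideanSpace ℝ (Fin 2)

/-- The open unit disc `D ⊆ ℝ²`. -/
def unitDisc : Set E2 := Metric.ball 0 1

/-- The closed unit disc `D̄ ⊆ ℝ²`. -/
def unitClosedDisc : Set E2 := Metric.closedBall 0 1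

/-- The unit circle `S¹ ⊆ ℝ²`. -/
def unitCircle : Set E2 := Metric.sphere 0 1

/-- A curve in a metric space: a function which is continuous on a compact interval `[a,b]`. -/
structure MCurve (X : Type*) [PseudoEMetricSpace X] where
  a : ℝ
  b : ℝ
  hab : a ≤ b
  toFun : ℝ → X
  cont : ContinuousOn toFun (Set.Icc a b)

/-- The length of a curve, i.e. its total variation. -/
def MCurve.length {X : Type*} [PseudoEMetricSpace X] (γ : MCurve X) : ENNReal :=
  eVariationOn γ.toFun (Set.Icc γ.a γ.b)

/-- A metric space is geodesic if any two points are joined by a curve whose length equals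
their distance. -/
def IsGeodesicSpace (X : Type*) [MetricSpace X] : Prop :=
  ∀ x y : X, ∃ γ : MCurve X, γ.toFun γ.a = x ∧ γ.toFun γ.b = y ∧ γ.length = edist x y

/-- A metric space is locally geodesic if every point has a neighborhood `U` such that any two
points of `U` are joined by a geodesic in `X`. -/
def IsLocallyGeodesicSpace (X : Type*) [MetricSpace X] : Prop :=
  ∀ x : X, ∃ U ∈ nhds x, ∀ y ∈ U, ∀ z ∈ U,
    ∃ γ : MCurve X, γ.toFun γ.a = y ∧ γ.toFun γ.b = z ∧ γ.length = edist y z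

/-- The vertices of the standard equilateral Euclidean simplex of side length `r`. -/
def simplexVertex (r : ℝ) (i : Fin 3) : EuclideanSpace ℝ (Fin 3) :=
  (r / Real.sqrt 2) • EuclideanSpace.single i (1:ℝ)

/-- The standard equilateral Euclidean `k`-simplex of side length `r` (for `k ≤ 2`). -/
def euclideanSimplex (r : ℝ) (k : Fin 3) : Set (EuclideanSpace ℝ (Fin 3)) :=
  convexHull ℝ (simplexVertex r '' {i : Fin 3 | i ≤ k})

/-- A finite metric simplicial complex of dimension at most `2`, equipped with a geodesic
metric in which every simplex is a Euclidean simplex of side length `r`. -/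
structure EuclideanComplex2 (r : ℝ) where
  space : Type
  [metricSpace : MetricSpace space]
  [measurableSpace : MeasurableSpace space]
  [borelSpace : BorelSpace space]
  ι : Type
  [finite : Finite ι]
  dim : ι → Fin 3
  face : ι → Set space
  face_isom : ∀ i, Nonempty (↥(face i) ≃ᵢ ↥(euclideanSimplex r (dim i)))
  covers : ⋃ i, face i = Set.univ
  geodesic : IsGeodesicSpace space

attribute [instance] EuclideanComplex2.metricSpace EuclideanComplex2.measurableSpace
  EuclideanComplex2.borelSpace EuclideanComplex2.finite

/-- The `1`-skeleton of such a complex. -/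
def EuclideanComplex2.oneSkeleton {r : ℝ} (K : EuclideanComplex2 r) : Set K.space :=
  ⋃ i ∈ {i | K.dim i ≤ 1}, K.face i

open Metric MeasureTheory Set Filter Topology ENNReal NNReal



/-- The metric speed `|f'|(t)` of a map `f : ℝ → X`. -/
def metricSpeed {X : Type*} [PseudoEMetricSpace X] (f : ℝ → X) (t : ℝ) : ℝ≥0∞ :=
  Filter.limsup (fun s : ℝ => edist (f s) (f t) / ENNReal.ofReal |s - t|) (𝓝[≠] t)

/-- The path integral `∫_γ ρ` of a Borel density `ρ` along a curve `γ`. -/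
def MCurve.pathIntegral {X : Type*} [PseudoEMetricSpace X] (γ : MCurve X) (ρ : X → ℝ≥0∞) : ℝ≥0∞ :=
  ∫⁻ t in Set.Icc γ.a γ.b, ρ (γ.toFun t) * metricSpeed γ.toFun t

/-- The family of curves whose image is contained in `S`. -/
def CurvesIn {X : Type*} [PseudoEMetricSpace X] (S : Set X) : Set (MCurve X) :=
  {γ | ∀ t ∈ Set.Icc γ.a γ.b, γ.toFun t ∈ S}

/-- The family `u ∘ Γ` of all compositions `u ∘ γ`, `γ ∈ Γ`. -/
def mapFamily {X Y : Type*} [PseudoEMetricSpace X] [PseudoEMetricSpace Y]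
    (u : X → Y) (Γ : Set (MCurve X)) : Set (MCurve Y) :=
  {δ | ∃ γ ∈ Γ, δ.a = γ.a ∧ δ.b = γ.b ∧ δ.toFun = u ∘ γ.toFun}

section Modulus

variable {X : Type*} [EMetricSpace X] [MeasurableSpace X] [BorelSpace X]

/-- A Borel function `ρ` is admissible for the curve family `Γ` if `∫_γ ρ ≥ 1` for every
(locally) rectifiable curve in `Γ`. -/
def Admissible (Γ : Set (MCurve X)) (ρ : X → ℝ≥0∞) : Prop :=
  Measurable ρ ∧ ∀ γ ∈ Γ, γ.length ≠ ⊤ → 1 ≤ γ.pathIntegral ρ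

/-- The conformal modulus of a family of curves, with respect to Hausdorff `2`-measure. -/
def MOD (Γ : Set (MCurve X)) : ℝ≥0∞ :=
  ⨅ (ρ : X → ℝ≥0∞) (_ : Admissible Γ ρ), ∫⁻ x, ρ x ^ 2 ∂(μH[2] : Measure X)

/-- The family of curves joining `E` and `F` within `G`. -/
def joiningCurves (E F G : Set X) : Set (MCurve X) :=
  {γ | (∀ t ∈ Set.Icc γ.a γ.b, γ.toFun t ∈ G) ∧ γ.toFun γ.a ∈ E ∧ γ.toFun γ.b ∈ F}

/-- `MOD(E, F; G)`, the modulus of the family of curves joining `E` and `F` within `G`. -/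
def MODJoin (E F G : Set X) : ℝ≥0∞ := MOD (joiningCurves E F G)

end Modulus


/-- A Jordan curve: a subset homeomorphic to the unit circle. -/
def IsJordanCurve {X : Type*} [TopologicalSpace X] (Γ : Set X) : Prop :=
  Nonempty (↥Γ ≃ₜ ↥unitCircle)

/-- A Jordan domain: a domain whose boundary is a Jordan curve. -/
def IsJordanDomain {X : Type*} [TopologicalSpace X] (Ω : Set X) : Prop :=
  IsOpen Ω ∧ IsConnected Ω ∧ IsJordanCurve (frontier Ω)

/-- A subset has finite length if it is the image of a rectifiable curve. -/
def HasFiniteLength {X : Type*} [MetricSpace X] (Γ : Set X) : Prop :=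
  ∃ γ : MCurve X, γ.toFun '' Set.Icc γ.a γ.b = Γ ∧ γ.length ≠ ⊤

/-- `u` restricted to `S` is a homeomorphism onto `T`. -/
def RestrictsToHomeo {A X : Type*} [TopologicalSpace A] [TopologicalSpace X]
    (u : A → X) (S : Set A) (T : Set X) : Prop :=
  ∃ e : ↥S ≃ₜ ↥T, ∀ z : ↥S, (e z : X) = u (z : A)

/-- Condition (⋆): points have vanishing modulus. -/
def PointsZeroModulus (X : Type*) [MetricSpace X] [MeasurableSpace X] [BorelSpace X] : Prop :=
  ∀ (x : X) (R : ℝ), 0 < R → ((Metric.ball x R)ᶜ).Nonempty →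
    Filter.Tendsto
      (fun r : ℝ => MODJoin (Metric.ball x r) (Metric.ball x R)ᶜ (Metric.closedBall x R))
      (𝓝[>] (0:ℝ)) (𝓝 0)

/-- Condition (⋆⋆): for every closed topological square `Q ⊆ X` with boundary edges
`ζ₁, ζ₂, ζ₃, ζ₄` in cyclic order, `MOD(ζ₁,ζ₃;Q) ⬝ MOD(ζ₂,ζ₄;Q) ≤ κ`. -/
def SquareCondition (X : Type*) [MetricSpace X] [MeasurableSpace X] [BorelSpace X]
    (κ : ℝ≥0∞) : Prop :=
  ∀ (φ : ℝ × ℝ → X) (Q : Set X),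
    RestrictsToHomeo φ (Set.Icc (0:ℝ) 1 ×ˢ Set.Icc (0:ℝ) 1) Q →
    MODJoin (φ '' (Set.Icc (0:ℝ) 1 ×ˢ {(0:ℝ)})) (φ '' (Set.Icc (0:ℝ) 1 ×ˢ {(1:ℝ)})) Q *
      MODJoin (φ '' ({(0:ℝ)} ×ˢ Set.Icc (0:ℝ) 1)) (φ '' ({(1:ℝ)} ×ˢ Set.Icc (0:ℝ) 1)) Q ≤ κ

section Sobolev

variable {X : Type*} [MetricSpace X]

/-- `g` is a weak upper gradient of `u` on `U`: the upper gradient inequality holds along all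
rectifiable curves in `U` outside an exceptional family of modulus zero. -/
def IsWeakUpperGradientOn (u : E2 → X) (U : Set E2) (g : E2 → ℝ≥0∞) : Prop :=
  ∃ Γ₀ : Set (MCurve E2), MOD Γ₀ = 0 ∧
    ∀ γ : MCurve E2, γ ∈ CurvesIn U → γ.length ≠ ⊤ → γ ∉ Γ₀ →
      edist (u (γ.toFun γ.a)) (u (γ.toFun γ.b)) ≤ γ.pathIntegral g

/-- Membership in the Newton–Sobolev space `N^{1,2}(U, X)`. -/
def MemN12 (U : Set E2) (u : E2 → X) : Prop :=
  AEStronglyMeasurable u (volume.restrict U) ∧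
  (∃ x₀ : X, (∫⁻ z in U, edist (u z) x₀ ^ 2) ≠ ⊤) ∧
  ∃ g : E2 → ℝ≥0∞, Measurable g ∧ IsWeakUpperGradientOn u U g ∧ (∫⁻ z in U, g z ^ 2) ≠ ⊤

/-- The Reshetnyak energy `E²₊(u)` of `u` on the unit disc: the infimum of `∫_D g²` over all
weak upper gradients `g` of `u` (attained by the minimal weak upper gradient). -/
def energy (u : E2 → X) : ℝ≥0∞ :=
  ⨅ (g : E2 → ℝ≥0∞) (_ : Measurable g ∧ IsWeakUpperGradientOn u unitDisc g),
    ∫⁻ z in unitDisc, g z ^ 2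

/-- `g` is the minimal weak upper gradient of `u` on the unit disc. -/
def IsMinimalWUG (u : E2 → X) (g : E2 → ℝ≥0∞) : Prop :=
  Measurable g ∧ IsWeakUpperGradientOn u unitDisc g ∧ (∫⁻ z in unitDisc, g z ^ 2) ≠ ⊤ ∧
    ∀ h : E2 → ℝ≥0∞, Measurable h → IsWeakUpperGradientOn u unitDisc h →
      (∫⁻ z in unitDisc, h z ^ 2) ≠ ⊤ → ∀ᵐ z ∂(volume.restrict unitDisc), g z ≤ h z

/-- `c` is a representative of the trace of `u`: for a.e. `v ∈ S¹` the radial limit of `u`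
at `v` is `c v`. -/
def IsTraceRep (u c : E2 → X) : Prop :=
  ∀ᵐ v ∂((μH[1] : Measure E2).restrict unitCircle),
    Filter.Tendsto (fun t : ℝ => u (t • v)) (𝓝[<] (1:ℝ)) (𝓝 (c v))

/-- `c` (restricted to `S¹`) is a weakly monotone parametrization of the Jordan curve `Γ`:
a uniform limit of homeomorphisms `S¹ → Γ`. -/
def IsWeaklyMonotoneParam {Y : Type*} [MetricSpace Y] (c : E2 → Y) (Γ : Set Y) : Prop :=
  ContinuousOn c unitCircle ∧ (∀ v ∈ unitCircle, c v ∈ Γ) ∧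
    ∀ ε : ℝ, 0 < ε → ∃ h : ↥unitCircle ≃ₜ ↥Γ,
      ∀ v : ↥unitCircle, dist (c (v : E2)) ((h v : ↥Γ) : Y) < ε

/-- The family `Λ(Γ, X)` of Sobolev discs spanning the Jordan curve `Γ`. -/
def Lambda (Γ : Set X) : Set (E2 → X) :=
  {u | MemN12 unitDisc u ∧ ∃ c : E2 → X, IsWeaklyMonotoneParam c Γ ∧ IsTraceRep u c}

/-- The seminorm `s` is the approximate metric derivative of `u` at `z`:
`ap lim_{y → z} (d(u y, u z) - s(y-z)) / |y-z| = 0`. -/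
def HasApproxMetricDeriv (u : E2 → X) (z : E2) (s : Seminorm ℝ E2) : Prop :=
  ∀ ε : ℝ, 0 < ε →
    Filter.Tendsto
      (fun r : ℝ =>
        volume {y : E2 | y ∈ Metric.ball z r ∧
            ε * ‖y - z‖ ≤ |dist (u y) (u z) - s (y - z)|} / volume (Metric.ball z r))
      (𝓝[>] (0:ℝ)) (𝓝 0)

end Sobolev

open Classical in
/-- The Jacobian `J(s)` of a seminorm `s` on `ℝ²`: the Hausdorff 2-measure of the unit square
in `(ℝ², s)` when `s` is a norm (which equals `π / |{s ≤ 1}|`), and `0` otherwise. -/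
def seminormJacobian (s : Seminorm ℝ E2) : ℝ≥0∞ :=
  if ∃ v : E2, v ≠ 0 ∧ s v = 0 then 0
  else ENNReal.ofReal Real.pi / volume {v : E2 | s v ≤ 1}

/-- `u` is infinitesimally `K`-quasiconformal: `g_u(z)² ≤ K ⬝ J(md u_z)` for a.e. `z ∈ D`. -/
def InfinitesimallyQC {X : Type*} [MetricSpace X] (u : E2 → X) (K : ℝ≥0∞) : Prop :=
  ∃ g : E2 → ℝ≥0∞, IsMinimalWUG u g ∧
    ∀ᵐ z ∂(volume.restrict unitDisc),
      ∃ s : Seminorm ℝ E2, HasApproxMetricDeriv u z s ∧ g z ^ 2 ≤ K * seminormJacobian s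

/-- The parametrized (Hausdorff) area `Area(u) = ∫_D J(md u_z) dz`. -/
def parametrizedArea {X : Type*} [MetricSpace X] (u : E2 → X) : ℝ≥0∞ :=
  ∫⁻ z in unitDisc, ⨆ (s : Seminorm ℝ E2) (_ : HasApproxMetricDeriv u z s), seminormJacobian s

/-- The essential oscillation of `u` in the `δ`-ball around `z` (within the unit disc). -/
def essOsc {X : Type*} [MetricSpace X] (u : E2 → X) (z : E2) (δ : ℝ) : ℝ≥0∞ :=
  ⨅ (A : Set E2)
    (_ : A ⊆ unitDisc ∩ Metric.ball z δ ∧ volume ((unitDisc ∩ Metric.ball z δ) \ A) = 0),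
    EMetric.diam (u '' A)

/-- A quasisymmetric map between metric spaces. -/
def IsQuasisymmetric {M X : Type*} [MetricSpace M] [MetricSpace X] (u : M → X) : Prop :=
  ∃ η : ℝ≥0 ≃ₜ ℝ≥0, ∀ z a b : M, ∀ t : ℝ≥0,
    dist z a ≤ (t : ℝ) * dist z b → dist (u z) (u a) ≤ (η t : ℝ) * dist (u z) (u b)

/-- A map `u` is quasisymmetric on a subset `S` of its domain. -/
def IsQuasisymmetricOn {M X : Type*} [MetricSpace M] [MetricSpace X] (u : M → X)
    (S : Set M) : Prop :=
  ∃ η : ℝ≥0 ≃ₜ ℝ≥0, ∀ z ∈ S, ∀ a ∈ S, ∀ b ∈ S, ∀ t : ℝ≥0,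
    dist z a ≤ (t : ℝ) * dist z b → dist (u z) (u a) ≤ (η t : ℝ) * dist (u z) (u b)

/-- A metric space is linearly locally connected. -/
def LinearlyLocallyConnected (X : Type*) [MetricSpace X] : Prop :=
  ∃ lam : ℝ, 1 ≤ lam ∧ ∀ (x : X) (r : ℝ), 0 < r →
    (∀ y ∈ Metric.ball x r, ∀ z ∈ Metric.ball x r, ∃ C : Set X, IsCompact C ∧ IsConnected C ∧
      y ∈ C ∧ z ∈ C ∧ C ⊆ Metric.ball x (lam * r)) ∧
    (∀ y ∉ Metric.ball x r, ∀ z ∉ Metric.ball x r, ∃ C : Set X, IsCompact C ∧ IsConnected C ∧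
      y ∈ C ∧ z ∈ C ∧ C ⊆ (Metric.ball x (r / lam))ᶜ)

/-- A subset `S` is `2`-rectifiable: up to an `H²`-null set, `S` is covered by countably many
Lipschitz images of subsets of `ℝ²`. -/
def Is2Rectifiable {X : Type*} [MetricSpace X] [MeasurableSpace X] [BorelSpace X]
    (S : Set X) : Prop :=
  ∃ (A : ℕ → Set E2) (f : ℕ → E2 → X), (∀ n, ∃ K : ℝ≥0, LipschitzOnWith K (f n) (A n)) ∧
    μH[2] (S \ ⋃ n, f n '' A n) = 0

/-- The boundary circle `∂X` of a space homeomorphic to the closed disc. -/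
def discBoundary {X : Type*} [TopologicalSpace X] (φ : ↥unitClosedDisc ≃ₜ X) : Set X :=
  {x : X | ((φ.symm x : ↥unitClosedDisc) : E2) ∈ unitCircle}

/-- `f` is biLipschitz on `S`. -/
def BiLipschitzOn {A X : Type*} [PseudoMetricSpace A] [PseudoMetricSpace X]
    (f : A → X) (S : Set A) : Prop :=
  ∃ K : ℝ≥0, 0 < K ∧ ∀ v ∈ S, ∀ w ∈ S,
    (K : ℝ)⁻¹ * dist v w ≤ dist (f v) (f w) ∧ dist (f v) (f w) ≤ (K : ℝ) * dist v w

/-- A biLipschitz curve: the image of a biLipschitz embedding of `S¹` or of an interval. -/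
def IsBiLipschitzCurve {X : Type*} [MetricSpace X] (T : Set X) : Prop :=
  (∃ f : E2 → X, BiLipschitzOn f unitCircle ∧ f '' unitCircle = T) ∨
  (∃ f : ℝ → X, BiLipschitzOn f (Set.Icc 0 1) ∧ f '' Set.Icc 0 1 = T)

/-- `T` is a Jordan arc intersecting the set `B` exactly at its two endpoints. -/
def IsJordanArcMeetingBoundaryAtEndpoints {X : Type*} [TopologicalSpace X] (T B : Set X) : Prop :=
  ∃ h : ↥(Set.Icc (0:ℝ) 1) ≃ₜ ↥T,
    T ∩ B = {((h ⟨0, Set.mem_Icc.mpr (by norm_num)⟩ : ↥T) : X),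
             ((h ⟨1, Set.mem_Icc.mpr (by norm_num)⟩ : ↥T) : X)}

/-- `c` is a continuous-representative-of-trace of `u` on the convex domain `W`, with respect to
radial approach from an interior point `p`. -/
def IsTraceRepOn {X : Type*} [MetricSpace X] (u c : E2 → X) (W : Set E2) (p : E2) : Prop :=
  ∀ᵐ w ∂((μH[1] : Measure E2).restrict (frontier W)),
    Filter.Tendsto (fun t : ℝ => u ((1 - t) • p + t • w)) (𝓝[<] (1:ℝ)) (𝓝 (c w))

/-- The induced length (inner) distance of a metric space. -/
def lengthDist {X : Type*} [MetricSpace X] (x y : X) : ℝ≥0∞ :=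
  ⨅ (γ : MCurve X) (_ : γ.toFun γ.a = x ∧ γ.toFun γ.b = y), γ.length

/-- An injective metric space: `1`-Lipschitz maps into it extend from subsets. -/
def IsInjectiveMetricSpace (E : Type*) [MetricSpace E] : Prop :=
  ∀ (Z : Type) [MetricSpace Z], ∀ (Y : Set Z) (f : ↥Y → E), LipschitzWith 1 f →
    ∃ F : Z → E, LipschitzWith 1 F ∧ ∀ y : ↥Y, F (y : Z) = f y



namespace DiscUniformization

/-! ### Connectivity in graphs and the Hex lemma -/

/-- `C` is connected with respect to the relation `adj`: it contains no proper nonempty subset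
closed under `adj`. -/
def AdjConn {α : Type*} (adj : α → α → Prop) (C : Set α) : Prop :=
  ∀ D : Set α, (∃ i ∈ C, i ∈ D) → (∀ i ∈ C, i ∈ D → ∀ j ∈ C, adj i j → j ∈ D) → C ⊆ D

section AdjConn

variable {α : Type*} {adj : α → α → Prop}

lemma adjConn_singleton (i : α) : AdjConn adj {i} := by
  rintro D ⟨j, rfl, hj⟩ _ k rfl
  exact hj

lemma AdjConn.union_of_adj (hsymm : ∀ i j, adj i j → adj j i) {C C' : Set α}
    (hC : AdjConn adj C) (hC' : AdjConn adj C') {i j : α} (hi : i ∈ C) (hj : j ∈ C')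
    (hij : adj i j) : AdjConn adj (C ∪ C') := by
  rintro D ⟨k, hk, hkD⟩ hD
  have h1 : (∃ k ∈ C, k ∈ D) → C ⊆ D := fun h =>
    hC D h fun a ha haD b hb hab => hD a (Or.inl ha) haD b (Or.inl hb) hab
  have h2 : (∃ k ∈ C', k ∈ D) → C' ⊆ D := fun h =>
    hC' D h fun a ha haD b hb hab => hD a (Or.inr ha) haD b (Or.inr hb) hab
  rcases hk with hk | hk
  · have h := h1 ⟨k, hk, hkD⟩
    exact union_subset h (h2 ⟨j, hj, hD i (Or.inl hi) (h hi) j (Or.inr hj) hij⟩)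
  · have h := h2 ⟨k, hk, hkD⟩
    exact union_subset (h1 ⟨i, hi, hD j (Or.inr hj) (h hj) i (Or.inl hi) (hsymm _ _ hij)⟩) h

lemma AdjConn.exists_path (hrefl : ∀ i, adj i i) {C : Set α} (hC : AdjConn adj C) {i j : α}
    (hi : i ∈ C) (hj : j ∈ C) :
    ∃ (P : ℕ → α) (m : ℕ), P 0 = i ∧ P m = j ∧ (∀ k, P k ∈ C) ∧ ∀ k, adj (P k) (P (k + 1)) := by
  refine hC {j | ∃ (P : ℕ → α) (m : ℕ), P 0 = i ∧ P m = j ∧ (∀ k, P k ∈ C) ∧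
    ∀ k, adj (P k) (P (k + 1))} ⟨i, hi, fun _ => i, 0, rfl, rfl, fun _ => hi, fun _ => hrefl i⟩
    ?_ hj
  rintro a _ ⟨P, m, h0, hm, hP, hadj⟩ b hb hab
  refine ⟨fun k => if k ≤ m then P k else b, m + 1, by simp [h0], by simp, fun k => ?_,
    fun k => ?_⟩
  · dsimp only
    split_ifs
    exacts [hP k, hb]
  · rcases lt_trichotomy k m with h | h | h
    · simpa [h.le, Nat.succ_le_of_lt h] using hadj k
    · subst h
      simpa [hm] using hab
    · simpa [h.not_ge, (Nat.lt_succ_of_lt h).not_ge] using hrefl b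

end AdjConn

/-- Adjacency (or equality) in the triangular lattice with vertex set `ℤ × ℤ`. -/
def hexAdj (v w : ℤ × ℤ) : Prop :=
  (-1 ≤ w.1 - v.1 ∧ w.1 - v.1 ≤ 1) ∧ (-1 ≤ w.2 - v.2 ∧ w.2 - v.2 ≤ 1) ∧
    -1 ≤ w.1 + w.2 - (v.1 + v.2) ∧ w.1 + w.2 - (v.1 + v.2) ≤ 1

lemma hexAdj_refl (v : ℤ × ℤ) : hexAdj v v := by
  simp [hexAdj]

lemma hexAdj_symm (v w : ℤ × ℤ) (h : hexAdj v w) : hexAdj w v := by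
  unfold hexAdj at *
  omega

/-- The lattice points of the square `[0, n] × [0, n]`. -/
def gridBox (n : ℕ) : Set (ℤ × ℤ) := {v | (0 ≤ v.1 ∧ v.1 ≤ n) ∧ 0 ≤ v.2 ∧ v.2 ≤ n}

/-- The signed crossing number of the lattice segment from `d` to `d'` with a horizontal ray
slightly above the positive axis. -/
def rayCross (d d' : ℤ × ℤ) : ℤ :=
  (if d.2 = 0 ∧ d'.2 = 1 ∧ 0 < d.1 then 1 else 0) -
    (if d'.2 = 0 ∧ d.2 = 1 ∧ 0 < d'.1 then 1 else 0)

set_option maxHeartbeats 2000000 in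
lemma rayCross_cell {p p' q q' : ℤ × ℤ} (hp : hexAdj p p') (hq : hexAdj q q')
    (h1 : p ≠ q) (h2 : p' ≠ q) (h3 : p ≠ q') (h4 : p' ≠ q') :
    rayCross (p - q) (p' - q) + rayCross (p' - q) (p' - q') =
      rayCross (p - q) (p - q') + rayCross (p - q') (p' - q') := by
  obtain ⟨a, b⟩ := p
  obtain ⟨a', b'⟩ := p'
  obtain ⟨c, d⟩ := q
  obtain ⟨c', d'⟩ := q'
  simp only [hexAdj, ne_eq, Prod.mk.injEq, not_and_or, rayCross, Prod.mk_sub_mk] at *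
  split_ifs <;> omega

/-- Two lattice paths, one crossing a box horizontally and one crossing it vertically, meet. -/
lemma exists_common_vertex {P Q : ℕ → ℤ × ℤ} {m m' : ℕ}
    (hP : ∀ k, hexAdj (P k) (P (k + 1))) (hQ : ∀ k, hexAdj (Q k) (Q (k + 1)))
    (hl : ∀ t, (P 0).1 ≤ (Q t).1) (hr : ∀ t, (Q t).1 ≤ (P m).1)
    (hb : ∀ s, (Q 0).2 < (P s).2) (ht : ∀ s, (P s).2 ≤ (Q m').2) : ∃ s t, P s = Q t := by
  by_contra! hne
  have key : ∀ s t : ℕ,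
      ∑ k ∈ Finset.range s, rayCross (P k - Q 0) (P (k + 1) - Q 0) +
        ∑ l ∈ Finset.range t, rayCross (P s - Q l) (P s - Q (l + 1)) =
      ∑ l ∈ Finset.range t, rayCross (P 0 - Q l) (P 0 - Q (l + 1)) +
        ∑ k ∈ Finset.range s, rayCross (P k - Q t) (P (k + 1) - Q t) := by
    intro s t
    induction s with
    | zero => simp
    | succ s ih =>
      have hstep : ∀ t : ℕ, rayCross (P s - Q 0) (P (s + 1) - Q 0) +
          ∑ l ∈ Finset.range t, rayCross (P (s + 1) - Q l) (P (s + 1) - Q (l + 1)) =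
          ∑ l ∈ Finset.range t, rayCross (P s - Q l) (P s - Q (l + 1)) +
          rayCross (P s - Q t) (P (s + 1) - Q t) := by
        intro t
        induction t with
        | zero => simp
        | succ t ih =>
          rw [Finset.sum_range_succ, Finset.sum_range_succ]
          have := rayCross_cell (hP s) (hQ t) (hne _ _) (hne _ _) (hne _ _) (hne _ _)
          linarith
      have := hstep t
      rw [Finset.sum_range_succ, Finset.sum_range_succ]
      linarith
  have h := key m m'
  have z1 : ∑ k ∈ Finset.range m, rayCross (P k - Q 0) (P (k + 1) - Q 0) = 0 := by
    refine Finset.sum_eq_zero fun k _ => ?_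
    have h1 := hb k
    have h2 := hb (k + 1)
    simp only [rayCross, Prod.snd_sub, Prod.fst_sub]
    split_ifs <;> omega
  have z2 : ∑ k ∈ Finset.range m, rayCross (P k - Q m') (P (k + 1) - Q m') = 0 := by
    refine Finset.sum_eq_zero fun k _ => ?_
    have h1 := ht k
    have h2 := ht (k + 1)
    simp only [rayCross, Prod.snd_sub, Prod.fst_sub]
    split_ifs <;> omega
  have z3 : ∑ l ∈ Finset.range m', rayCross (P 0 - Q l) (P 0 - Q (l + 1)) = 0 := by
    refine Finset.sum_eq_zero fun k _ => ?_
    have h1 := hl k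
    have h2 := hl (k + 1)
    simp only [rayCross, Prod.snd_sub, Prod.fst_sub]
    split_ifs <;> omega
  rw [z1, z2, z3] at h
  have htel : ∀ t : ℕ, ∑ l ∈ Finset.range t, rayCross (P m - Q l) (P m - Q (l + 1)) =
      (if 1 ≤ (P m - Q t).2 then 1 else 0) - 1 := by
    intro t
    induction t with
    | zero =>
      have := hb m
      simp only [Finset.range_zero, Finset.sum_empty, Prod.snd_sub]
      rw [if_pos (by omega)]
      rfl
    | succ t ih =>
      rw [Finset.sum_range_succ, ih]
      have h1 := hr t
      have h2 := hr (t + 1)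
      have h3 := hne m t
      have h4 := hne m (t + 1)
      have h5 := hQ t
      simp only [rayCross, Prod.snd_sub, Prod.fst_sub, hexAdj, ne_eq, Prod.ext_iff,
        not_and_or] at *
      split_ifs <;> omega
  rw [htel] at h
  have := ht m
  simp only [Prod.snd_sub] at h
  rw [if_neg (by omega)] at h
  omega

/-- A left-right connected set and a bottom-top connected set in a box intersect. -/
lemma hex_cross {n : ℕ} {C C' : Set (ℤ × ℤ)} (hC : AdjConn hexAdj C) (hC' : AdjConn hexAdj C')
    (hCb : C ⊆ gridBox n) (hCb' : C' ⊆ gridBox n)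
    (hl : ∃ v ∈ C, v.1 = 0) (hr : ∃ v ∈ C, v.1 = n)
    (hb : ∃ v ∈ C', v.2 = 0) (ht : ∃ v ∈ C', v.2 = n) : (C ∩ C').Nonempty := by
  obtain ⟨l, hl, hl0⟩ := hl
  obtain ⟨r, hr, hrn⟩ := hr
  obtain ⟨b, hb, hb0⟩ := hb
  obtain ⟨t, ht, htn⟩ := ht
  obtain ⟨P, m, hP0, hPm, hPC, hP⟩ := hC.exists_path hexAdj_refl hl hr
  obtain ⟨Q, m', hQ0, hQm, hQC, hQ⟩ := hC'.exists_path hexAdj_refl hb ht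
  have hPb := fun s => hCb (hPC s)
  have hQb := fun s => hCb' (hQC s)
  simp only [gridBox, mem_ofPred_eq] at hPb hQb
  let Q' : ℕ → ℤ × ℤ := fun k => Nat.casesOn k (b.1, -1) Q
  have hQ0' : Q' 0 = (b.1, -1) := rfl
  have hQs' : ∀ k, Q' (k + 1) = Q k := fun _ => rfl
  clear_value Q'
  obtain ⟨s, t', hst⟩ := exists_common_vertex (P := P) (Q := Q') (m := m) (m' := m' + 1) hP
    (by
      rintro (_ | k)
      · rw [hQ0', hQs', hQ0]
        simp only [hexAdj]
        omega
      · rw [hQs', hQs']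
        exact hQ k)
    (by
      rintro (_ | k)
      · have := hQb 0
        rw [hQ0] at this
        simp only [hQ0', hP0]
        omega
      · have := hQb k
        rw [hQs', hP0]
        omega)
    (by
      rintro (_ | k)
      · have := hQb 0
        rw [hQ0] at this
        simp only [hQ0', hPm]
        omega
      · have := hQb k
        rw [hQs', hPm]
        omega)
    (by
      intro s
      have := hPb s
      simp only [hQ0']
      omega)
    (by
      intro s
      have := hPb s
      rw [hQs', hQm]
      omega)
  rcases t' with _ | k
  · have := hPb s
    rw [hst, hQ0'] at this
    simp only at this
    omega
  · exact ⟨P s, hPC s, by rw [hst, hQs']; exact hQC k⟩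

/-- The vertices of `S` which are joined within `S` to `E`. -/
def linkedTo {α : Type*} (adj : α → α → Prop) (S E : Set α) : Set α :=
  {v | ∃ C ⊆ S, AdjConn adj C ∧ v ∈ C ∧ (C ∩ E).Nonempty}

section linkedTo

variable {α : Type*} {adj : α → α → Prop} {S E : Set α}

lemma linkedTo_subset : linkedTo adj S E ⊆ S := fun _ ⟨_, hCS, _, hv, _⟩ => hCS hv

lemma mem_linkedTo_of_mem {v : α} (hv : v ∈ S) (hE : v ∈ E) : v ∈ linkedTo adj S E :=
  ⟨{v}, singleton_subset_iff.2 hv, adjConn_singleton v, rfl, v, rfl, hE⟩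

lemma mem_linkedTo_of_adj (hsymm : ∀ i j, adj i j → adj j i) {v w : α}
    (hv : v ∈ linkedTo adj S E) (hw : w ∈ S) (h : adj v w) : w ∈ linkedTo adj S E := by
  obtain ⟨C, hCS, hC, hvC, e, he, heE⟩ := hv
  exact ⟨C ∪ {w}, union_subset hCS (singleton_subset_iff.2 hw),
    hC.union_of_adj hsymm (adjConn_singleton w) hvC rfl h, Or.inr rfl, e, Or.inl he, heE⟩

end linkedTo

/-- The Hex lemma: any set of lattice points of a box contains a bottom-top connected set, or its
complement contains a left-right connected set. -/
lemma hex_exists (n : ℕ) (W : Set (ℤ × ℤ)) :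
    (∃ C ⊆ W ∩ gridBox n, AdjConn hexAdj C ∧ (∃ v ∈ C, v.2 = 0) ∧ ∃ v ∈ C, v.2 = n) ∨
    ∃ C ⊆ gridBox n \ W, AdjConn hexAdj C ∧ (∃ v ∈ C, v.1 = 0) ∧ ∃ v ∈ C, v.1 = n := by
  classical
  by_contra! hcon
  obtain ⟨hW, hW'⟩ := hcon
  set A := linkedTo hexAdj (W ∩ gridBox n) {v | v.2 = 0}
  set B := linkedTo hexAdj (gridBox n \ W) {v | v.1 = 0}
  have hAW : ∀ {v}, v ∈ A → v ∈ W := fun h => (linkedTo_subset h).1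
  have hBW : ∀ {v}, v ∈ B → v ∉ W := fun h => (linkedTo_subset h).2
  have hAtop : ∀ v ∈ A, v.2 ≠ n := by
    rintro v ⟨C, hC, hconn, hv, w, hw, hw0⟩
    exact hW C hC hconn ⟨w, hw, hw0⟩ v hv
  have hBright : ∀ v ∈ B, v.1 ≠ n := by
    rintro v ⟨C, hC, hconn, hv, w, hw, hw0⟩
    exact hW' C hC hconn ⟨w, hw, hw0⟩ v hv
  have hA : ∀ {v w}, hexAdj v w → v ∈ gridBox n → w ∈ gridBox n → v ∈ W → w ∈ W →
      (v ∈ A ↔ w ∈ A) := fun h hv hw hvW hwW =>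
    ⟨fun hvA => mem_linkedTo_of_adj hexAdj_symm hvA ⟨hwW, hw⟩ h,
      fun hwA => mem_linkedTo_of_adj hexAdj_symm hwA ⟨hvW, hv⟩ (hexAdj_symm _ _ h)⟩
  have hB : ∀ {v w}, hexAdj v w → v ∈ gridBox n → w ∈ gridBox n → v ∉ W → w ∉ W →
      (v ∈ B ↔ w ∈ B) := fun h hv hw hvW hwW =>
    ⟨fun hvA => mem_linkedTo_of_adj hexAdj_symm hvA ⟨hw, hwW⟩ h,
      fun hwA => mem_linkedTo_of_adj hexAdj_symm hwA ⟨hv, hvW⟩ (hexAdj_symm _ _ h)⟩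
  let α : ℤ × ℤ → ZMod 2 := fun v => if v ∈ A then 1 else 0
  let β : ℤ × ℤ → ZMod 2 := fun v => if v ∈ B then 1 else 0
  have same : ∀ {v w}, hexAdj v w → v ∈ gridBox n → w ∈ gridBox n → (v ∈ W ↔ w ∈ W) →
      α v = α w ∧ β v = β w := by
    intro v w h hv hw hvw
    by_cases hvW : v ∈ W
    · have hwW := hvw.1 hvW
      have e1 : v ∉ B := fun h => hBW h hvW
      have e2 : w ∉ B := fun h => hBW h hwW
      simp [α, β, hA h hv hw hvW hwW, e1, e2]
    · have hwW := fun h => hvW (hvw.2 h)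
      have e1 : v ∉ A := fun h => hvW (hAW h)
      have e2 : w ∉ A := fun h => hwW (hAW h)
      simp [α, β, hB h hv hw hvW hwW, e1, e2]
  let e : ℤ × ℤ → ℤ × ℤ → ZMod 2 := fun v w => α v * β w + β v * α w
  have h2 : (2 : ZMod 2) = 0 := by decide
  have tri : ∀ {u v w}, hexAdj u v → hexAdj v w → hexAdj u w → u ∈ gridBox n → v ∈ gridBox n →
      w ∈ gridBox n → e u v + e v w + e u w = 0 := by
    intro u v w huv hvw huw hu hv hw
    simp only [e]
    have : (u ∈ W ↔ v ∈ W) ∨ (v ∈ W ↔ w ∈ W) ∨ (u ∈ W ↔ w ∈ W) := by tauto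
    rcases this with h | h | h
    · obtain ⟨h3, h4⟩ := same huv hu hv h
      rw [h3, h4]
      linear_combination (α v * β v + α v * β w + β v * α w) * h2
    · obtain ⟨h3, h4⟩ := same hvw hv hw h
      rw [h3, h4]
      linear_combination (α w * β w + α u * β w + β u * α w) * h2
    · obtain ⟨h3, h4⟩ := same huw hu hw h
      rw [h3, h4]
      linear_combination (α w * β w + α v * β w + β v * α w) * h2
  have mem : ∀ {i j : ℕ}, i ≤ n → j ≤ n → ((i : ℤ), (j : ℤ)) ∈ gridBox n := by
    intro i j hi hj
    simp only [gridBox, mem_ofPred_eq]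
    omega
  have cell : ∀ {i j : ℕ}, i < n → j < n →
      e (i, j) (i + 1, j) + e (i + 1, j) (i + 1, j + 1) + e (i, j + 1) (i + 1, j + 1) +
        e (i, j) (i, j + 1) = 0 := by
    intro i j hi hj
    have m1 := mem hi.le hj.le
    have m2 := mem (Nat.succ_le_of_lt hi) hj.le
    have m3 := mem hi.le (Nat.succ_le_of_lt hj)
    have m4 := mem (Nat.succ_le_of_lt hi) (Nat.succ_le_of_lt hj)
    push_cast at m2 m3 m4
    have t1 := tri (u := (i, j)) (v := (i + 1, j)) (w := (i, j + 1))
      (by simp only [hexAdj]; omega) (by simp only [hexAdj]; omega)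
      (by simp only [hexAdj]; omega) m1 m2 m3
    have t2 := tri (u := (i + 1, j)) (v := (i, j + 1)) (w := (i + 1, j + 1))
      (by simp only [hexAdj]; omega) (by simp only [hexAdj]; omega)
      (by simp only [hexAdj]; omega) m2 m3 m4
    linear_combination t1 + t2 - e (i + 1, j) (i, j + 1) * h2
  have row : ∀ {j : ℕ}, j < n → ∀ k ≤ n,
      ∑ i ∈ Finset.range k, e (i, j) (i + 1, j) + e (k, j) (k, j + 1) +
        ∑ i ∈ Finset.range k, e (i, j + 1) (i + 1, j + 1) + e (0, j) (0, j + 1) = 0 := by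
    intro j hj k hk
    induction k with
    | zero =>
      simp only [Finset.range_zero, Finset.sum_empty, Nat.cast_zero]
      linear_combination e (0, j) (0, j + 1) * h2
    | succ k ih =>
      rw [Finset.sum_range_succ, Finset.sum_range_succ]
      push_cast
      linear_combination ih (by omega) + cell (Nat.lt_of_succ_le hk) hj -
        e (k, j) (k, j + 1) * h2
  have right : ∀ {j : ℕ}, β (n, j) = 0 := by
    intro j
    simp only [β]
    rw [if_neg fun h => hBright _ h rfl]
  have top : ∀ {i : ℕ}, α (i, n) = 0 := by
    intro j
    simp only [α]
    rw [if_neg fun h => hAtop _ h rfl]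
  -- potentials on the bottom and left sides
  let χ : ℤ × ℤ → ZMod 2 := fun v => if v ∈ W then (if v ∈ A then 0 else 1) else
    (if v ∈ B then 1 else 0)
  have crossing : ∀ {v w}, hexAdj v w → v ∈ gridBox n → w ∈ gridBox n →
      (v.2 = 0 ∧ w.2 = 0) ∨ (v.1 = 0 ∧ w.1 = 0) → e v w = χ v + χ w := by
    intro v w h hv hw hvw
    have bot : ∀ {v}, v ∈ gridBox n → v ∈ W → v.2 = 0 → v ∈ A :=
      fun hv hvW h0 => mem_linkedTo_of_mem ⟨hvW, hv⟩ h0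
    have left : ∀ {v}, v ∈ gridBox n → v ∉ W → v.1 = 0 → v ∈ B :=
      fun hv hvW h0 => mem_linkedTo_of_mem ⟨hv, hvW⟩ h0
    by_cases hvW : v ∈ W <;> by_cases hwW : w ∈ W
    · have e1 : v ∉ B := fun h => hBW h hvW
      have e2 : w ∉ B := fun h => hBW h hwW
      have e3 := hA h hv hw hvW hwW
      by_cases e4 : v ∈ A
      · simp [e, α, β, χ, hvW, hwW, e1, e2, ← e3, e4]
      · simp [e, α, β, χ, hvW, hwW, e2, ← e3, e4]
        decide
    · have e1 : v ∉ B := fun h => hBW h hvW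
      have e2 : w ∉ A := fun h => hwW (hAW h)
      rcases hvw with ⟨h0, h0'⟩ | ⟨h0, h0'⟩
      · have e3 := bot hv hvW h0
        simp [e, α, β, χ, hvW, hwW, e2, e3]
      · have e3 := left hw hwW h0'
        by_cases e4 : v ∈ A
        · simp [e, α, β, χ, hvW, hwW, e2, e3, e4]
        · simp [e, α, β, χ, hvW, hwW, e2, e3, e4]
          decide
    · have e1 : w ∉ B := fun h => hBW h hwW
      have e2 : v ∉ A := fun h => hvW (hAW h)
      rcases hvw with ⟨h0, h0'⟩ | ⟨h0, h0'⟩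
      · have e3 := bot hw hwW h0'
        simp [e, α, β, χ, hvW, hwW, e1, e3]
      · have e3 := left hv hvW h0
        by_cases e4 : w ∈ A
        · simp [e, α, β, χ, hvW, hwW, e1, e3, e4]
        · simp [e, α, β, χ, hvW, hwW, e1, e3, e4]
          decide
    · have e1 : w ∉ A := fun h => hwW (hAW h)
      have e2 : v ∉ A := fun h => hvW (hAW h)
      have e3 := hB h hv hw hvW hwW
      by_cases e4 : v ∈ B
      · simp [e, α, β, χ, hvW, hwW, e1, e2, ← e3, e4]
        decide
      · simp [e, α, β, χ, hvW, hwW, e1, ← e3, e4]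
  have bottom : ∀ k ≤ n, ∑ i ∈ Finset.range k, e (i, (0 : ℕ)) (i + 1, (0 : ℕ)) =
      χ (0, (0 : ℕ)) + χ (k, (0 : ℕ)) := by
    intro k hk
    induction k with
    | zero =>
      simp only [Finset.range_zero, Finset.sum_empty, Nat.cast_zero]
      linear_combination -χ (0, 0) * h2
    | succ k ih =>
      rw [Finset.sum_range_succ, ih (by omega)]
      have m1 := mem hk (Nat.zero_le n)
      push_cast at m1 ⊢
      have m0 := mem (Nat.le_of_succ_le hk) (Nat.zero_le n)
      push_cast at m0
      rw [crossing (by simp [hexAdj]) m0 m1 (Or.inl ⟨rfl, rfl⟩)]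
      linear_combination χ (k, 0) * h2
  have up : ∀ j ≤ n, ∑ i ∈ Finset.range n, e (i, j) (i + 1, j) = χ (0, j) + χ (n, (0 : ℕ)) := by
    intro j hj
    induction j with
    | zero => exact bottom n le_rfl
    | succ j ih =>
      have h3 := row (Nat.lt_of_succ_le hj) n le_rfl
      have h4 : e (n, j) (n, j + 1) = 0 := by
        have := @right (j + 1)
        push_cast at this
        simp [e, right, this]
      have m0 := mem (Nat.zero_le n) (Nat.le_of_succ_le hj)
      have m1 := mem (Nat.zero_le n) hj
      push_cast at m0 m1 ⊢
      rw [ih (by omega), h4,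
        crossing (by simp [hexAdj]) m0 m1 (Or.inr ⟨rfl, rfl⟩)] at h3
      linear_combination h3 - (χ (0, j) + χ (n, (0 : ℕ)) + χ (0, j + 1)) * h2
  have h3 := up n le_rfl
  rw [Finset.sum_eq_zero] at h3
  · have m0 := mem (Nat.zero_le n) (le_refl n)
    have m1 := mem (le_refl n) (Nat.zero_le n)
    have e1 : χ (0, n) = 1 := by
      by_cases hW0 : ((0 : ℤ), (n : ℤ)) ∈ W
      · have : ((0 : ℤ), (n : ℤ)) ∉ A := fun h => hAtop _ h rfl
        simp [χ, hW0, this]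
      · have : ((0 : ℤ), (n : ℤ)) ∈ B := mem_linkedTo_of_mem ⟨by simpa using m0, hW0⟩ rfl
        simp [χ, hW0, this]
    have e2 : χ (n, (0 : ℕ)) = 0 := by
      by_cases hW0 : ((n : ℤ), ((0 : ℕ) : ℤ)) ∈ W
      · have : ((n : ℤ), ((0 : ℕ) : ℤ)) ∈ A := mem_linkedTo_of_mem ⟨hW0, m1⟩ rfl
        simp only [χ]
        rw [if_pos hW0, if_pos this]
      · have : ((n : ℤ), ((0 : ℕ) : ℤ)) ∉ B := fun h => hBright _ h rfl
        simp only [χ]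
        rw [if_neg hW0, if_neg this]
    rw [e1, e2] at h3
    exact absurd h3 (by decide)
  · intro i _
    have := @top (i + 1)
    push_cast at this
    simp [e, top, this]

section

/-! ### Square tilings -/

/-- A graph with four distinguished sets of vertices for which the Hex lemma holds. -/
structure HexGraph (ι : Type*) where
  adj : ι → ι → Prop
  symm : ∀ i j, adj i j → adj j i
  Lf : Set ι
  Rt : Set ι
  Bt : Set ι
  Tp : Set ι
  hex : ∀ W : Set ι, (∃ C ⊆ W, AdjConn adj C ∧ (C ∩ Bt).Nonempty ∧ (C ∩ Tp).Nonempty) ∨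
    ∃ C ⊆ Wᶜ, AdjConn adj C ∧ (C ∩ Lf).Nonempty ∧ (C ∩ Rt).Nonempty
  cross : ∀ C C' : Set ι, AdjConn adj C → AdjConn adj C' → (C ∩ Lf).Nonempty →
    (C ∩ Rt).Nonempty → (C' ∩ Bt).Nonempty → (C' ∩ Tp).Nonempty → (C ∩ C').Nonempty

/-- Exchange the roles of the two pairs of opposite sides. -/
def HexGraph.swap {ι : Type*} (G : HexGraph ι) : HexGraph ι where
  adj := G.adj
  symm := G.symm
  Lf := G.Bt
  Rt := G.Tp
  Bt := G.Lf
  Tp := G.Rt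
  hex W := by
    rcases G.hex Wᶜ with h | h
    · exact Or.inr h
    · rw [compl_compl] at h
      exact Or.inl h
  cross C C' hC hC' h1 h2 h3 h4 := by
    rw [inter_comm]
    exact G.cross C' C hC' hC h3 h4 h1 h2

variable {ι : Type*}

section Weight

variable [Fintype ι]

/-- The total weight of a set of vertices. -/
def wt (σ : ι → ℝ) (C : Set ι) : ℝ := ∑ i, C.indicator σ i

lemma wt_mono {σ : ι → ℝ} (hσ : ∀ i, 0 ≤ σ i) {C C' : Set ι} (h : C ⊆ C') : wt σ C ≤ wt σ C' :=
  Finset.sum_le_sum fun i _ => indicator_le_indicator_of_subset h hσ i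

lemma wt_nonneg {σ : ι → ℝ} (hσ : ∀ i, 0 ≤ σ i) (C : Set ι) : 0 ≤ wt σ C :=
  Finset.sum_nonneg fun i _ => indicator_nonneg (fun i _ => hσ i) i

lemma wt_singleton (σ : ι → ℝ) (i : ι) : wt σ {i} = σ i := by
  classical
  simp [wt, indicator_apply]

lemma le_wt {σ : ι → ℝ} (hσ : ∀ i, 0 ≤ σ i) {C : Set ι} {i : ι} (hi : i ∈ C) : σ i ≤ wt σ C := by
  rw [← wt_singleton σ i]
  exact wt_mono hσ (singleton_subset_iff.2 hi)

lemma wt_union_le {σ : ι → ℝ} (hσ : ∀ i, 0 ≤ σ i) (C C' : Set ι) :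
    wt σ (C ∪ C') ≤ wt σ C + wt σ C' := by
  classical
  rw [wt, wt, wt, ← Finset.sum_add_distrib]
  refine Finset.sum_le_sum fun i _ => ?_
  have := hσ i
  simp only [indicator_apply, mem_union]
  split_ifs <;> simp_all

open Classical in
/-- The distance from the set `E` for the weight `σ`, truncated at level `a`. -/
def pot (adj : ι → ι → Prop) (E : Set ι) (a : ℝ) (σ : ι → ℝ) (i : ι) : ℝ :=
  ⨅ C : Set ι, if AdjConn adj C ∧ i ∈ C ∧ (C ∩ E).Nonempty then min a (wt σ C) else a

/-- The properties of a potential `x` for the weight `ρ`, rising from `E` to level `a` on `F`. -/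
structure IsPot (adj : ι → ι → Prop) (E F : Set ι) (a : ℝ) (ρ x : ι → ℝ) : Prop where
  nonneg : ∀ i, 0 ≤ x i
  le : ∀ i, x i ≤ a
  min_le : ∀ i, min (ρ i) a ≤ x i
  start : ∀ i ∈ E, x i ≤ ρ i
  step : ∀ i j, adj i j → x j ≤ x i + ρ j
  finish : ∀ i ∈ F, x i = a

lemma isPot_pot {adj : ι → ι → Prop} (hsymm : ∀ i j, adj i j → adj j i) {E F : Set ι} {a : ℝ}
    (ha : 0 ≤ a) {ρ : ι → ℝ} (hρ : ∀ i, 0 ≤ ρ i)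
    (hadm : ∀ C, AdjConn adj C → (C ∩ E).Nonempty → (C ∩ F).Nonempty → a ≤ wt ρ C) :
    IsPot adj E F a ρ (pot adj E a ρ) := by
  classical
  have hle : ∀ i (C : Set ι), AdjConn adj C → i ∈ C → (C ∩ E).Nonempty →
      pot adj E a ρ i ≤ min a (wt ρ C) := fun i C h1 h2 h3 => by
    have := ciInf_le (Finite.bddBelow_range fun C : Set ι =>
      if AdjConn adj C ∧ i ∈ C ∧ (C ∩ E).Nonempty then min a (wt ρ C) else a) C
    rwa [if_pos ⟨h1, h2, h3⟩] at this
  have hatt : ∀ i, pot adj E a ρ i = a ∨ ∃ C : Set ι, AdjConn adj C ∧ i ∈ C ∧ (C ∩ E).Nonempty ∧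
      pot adj E a ρ i = wt ρ C := by
    intro i
    obtain ⟨C, hC⟩ := exists_eq_ciInf_of_finite (f := fun C : Set ι =>
      if AdjConn adj C ∧ i ∈ C ∧ (C ∩ E).Nonempty then min a (wt ρ C) else a)
    change _ = pot adj E a ρ i at hC
    split_ifs at hC with h
    · rcases min_choice a (wt ρ C) with h' | h'
      · exact Or.inl (by rw [← hC, h'])
      · exact Or.inr ⟨C, h.1, h.2.1, h.2.2, by rw [← hC, h']⟩
    · exact Or.inl hC.symm
  have hlea : ∀ i, pot adj E a ρ i ≤ a := fun i => by
    refine (ciInf_le (Finite.bddBelow_range _) ∅).trans ?_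
    rw [if_neg (by simp)]
  refine ⟨fun i => ?_, hlea, fun i => ?_, fun i hi => ?_, fun i j hij => ?_, fun i hi => ?_⟩
  · rcases hatt i with h | ⟨C, h1, h2, h3, h⟩
    · rwa [h]
    · rw [h]
      exact wt_nonneg hρ C
  · rcases hatt i with h | ⟨C, h1, h2, h3, h⟩
    · rw [h]
      exact min_le_right _ _
    · rw [h]
      exact (min_le_left _ _).trans (le_wt hρ h2)
  · refine (hle i {i} (adjConn_singleton i) rfl ⟨i, rfl, hi⟩).trans ((min_le_right _ _).trans ?_)
    rw [wt_singleton]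
  · rcases hatt i with h | ⟨C, h1, h2, ⟨e, he, heE⟩, h⟩
    · rw [h]
      exact (hlea j).trans (le_add_of_nonneg_right (hρ j))
    · rw [h]
      refine (hle j (C ∪ {j}) (h1.union_of_adj hsymm (adjConn_singleton j) h2 rfl hij)
        (Or.inr rfl) ⟨e, Or.inl he, heE⟩).trans ((min_le_right _ _).trans ?_)
      rw [← wt_singleton ρ j]
      exact wt_union_le hρ _ _
  · rcases hatt i with h | ⟨C, h1, h2, h3, h⟩
    · exact h
    · exact le_antisymm (hlea i) (by rw [h]; exact hadm C h1 h3 ⟨i, h2, hi⟩)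

end Weight

/-- The levels between which a potential jumps contain a crossing set. -/
lemma HexGraph.exists_strip (G : HexGraph ι) {a : ℝ} {ρ x : ι → ℝ}
    (hx : IsPot G.adj G.Lf G.Rt a ρ x) {s : ℝ} (h0 : 0 ≤ s) (hs : s ≤ a) :
    ∃ C ⊆ {i | x i - ρ i ≤ s ∧ s ≤ x i}, AdjConn G.adj C ∧ (C ∩ G.Bt).Nonempty ∧
      (C ∩ G.Tp).Nonempty := by
  refine (G.hex _).resolve_right ?_
  rintro ⟨C, hC, hconn, ⟨l, hl, hlL⟩, r, hr, hrR⟩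
  have key := hconn {i | x i < s} ⟨l, hl, ?_⟩ ?_ hr
  · have := hx.finish r hrR
    simp only [mem_ofPred_eq] at key
    linarith
  · have h1 := hC hl
    have h2 := hx.start l hlL
    simp only [mem_compl_iff, mem_ofPred_eq, not_and, not_le] at h1 ⊢
    exact h1 (by linarith)
  · intro i hi hiD j hj hij
    have h1 := hC hj
    have h2 := hx.step i j hij
    simp only [mem_compl_iff, mem_ofPred_eq, not_and, not_le] at h1 hiD ⊢
    exact h1 (by linarith)

/-- A connected set rising from `E` to `F` attains every level of a potential. -/
lemma IsPot.exists_level {adj : ι → ι → Prop} {E F : Set ι} {b : ℝ} {σ y : ι → ℝ}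
    (hy : IsPot adj E F b σ y) {C : Set ι} (hC : AdjConn adj C)
    (hE : (C ∩ E).Nonempty) (hF : (C ∩ F).Nonempty) {t : ℝ} (h0 : 0 ≤ t) (ht : t ≤ b) :
    ∃ i ∈ C, y i - σ i ≤ t ∧ t ≤ y i := by
  by_contra! hcon
  obtain ⟨l, hl, hlL⟩ := hE
  obtain ⟨r, hr, hrR⟩ := hF
  have key := hC {i | y i < t} ⟨l, hl, ?_⟩ ?_ hr
  · have := hy.finish r hrR
    simp only [mem_ofPred_eq] at key
    linarith
  · have h2 := hy.start l hlL
    exact hcon l hl (by linarith)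
  · intro i hi hiD j hj hij
    have h2 := hy.step i j hij
    simp only [mem_ofPred_eq] at hiD
    exact hcon j hj (by linarith)

lemma HexGraph.exists_rect (G : HexGraph ι) {a b : ℝ} {ρ x σ y : ι → ℝ}
    (hx : IsPot G.adj G.Lf G.Rt a ρ x) (hy : IsPot G.adj G.Bt G.Tp b σ y) {s t : ℝ}
    (h0 : 0 ≤ s) (hs : s ≤ a) (h0' : 0 ≤ t) (ht : t ≤ b) :
    ∃ i, (x i - ρ i ≤ s ∧ s ≤ x i) ∧ y i - σ i ≤ t ∧ t ≤ y i := by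
  obtain ⟨C, hC, hconn, hB, hT⟩ := G.exists_strip hx h0 hs
  obtain ⟨i, hi, h⟩ := hy.exists_level hconn hB hT h0' ht
  exact ⟨i, hC hi, h⟩

variable [Fintype ι]

lemma HexGraph.mul_le_sum (G : HexGraph ι) {a b : ℝ} {ρ x σ y : ι → ℝ} (ha : 0 ≤ a)
    (hρ : ∀ i, 0 ≤ ρ i) (hσ : ∀ i, 0 ≤ σ i)
    (hx : IsPot G.adj G.Lf G.Rt a ρ x) (hy : IsPot G.adj G.Bt G.Tp b σ y) :
    a * b ≤ ∑ i, ρ i * σ i := by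
  have hsub : Icc 0 a ×ˢ Icc 0 b ⊆
      ⋃ i, Icc (x i - ρ i) (x i) ×ˢ Icc (y i - σ i) (y i) := by
    rintro ⟨s, t⟩ ⟨⟨h1, h2⟩, h3, h4⟩
    obtain ⟨i, hi⟩ := G.exists_rect hx hy h1 h2 h3 h4
    exact mem_iUnion.2 ⟨i, hi⟩
  have h := (measure_mono (μ := (volume : Measure (ℝ × ℝ))) hsub).trans (measure_iUnion_le _)
  simp only [Measure.volume_eq_prod, Measure.prod_prod, Real.volume_Icc, sub_zero,
    _root_.sub_sub_cancel, tsum_fintype] at h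
  rw [← ENNReal.ofReal_mul ha] at h
  rw [Finset.sum_congr rfl fun i _ => (ENNReal.ofReal_mul (hρ i)).symm] at h
  rw [← ENNReal.ofReal_sum_of_nonneg fun i _ => mul_nonneg (hρ i) (hσ i)] at h
  exact (ENNReal.ofReal_le_ofReal_iff
    (Finset.sum_nonneg fun i _ => mul_nonneg (hρ i) (hσ i))).1 h

/-- A tiling of the rectangle `[0, a] × [0, b]` by squares indexed by the vertices of a graph: the
square of the vertex `i` has side length `ρ i` and upper right corner `(x i, y i)`. -/
structure SqTiling (ι : Type*) [Fintype ι] extends HexGraph ι where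
  a : ℝ
  b : ℝ
  ρ : ι → ℝ
  x : ι → ℝ
  y : ι → ℝ
  a_pos : 0 < a
  b_pos : 0 < b
  ρ_nonneg : ∀ i, 0 ≤ ρ i
  x_pot : IsPot adj Lf Rt a ρ x
  y_pot : IsPot adj Bt Tp b ρ y
  area : ∑ i, ρ i * ρ i ≤ a * b

/-- Exchange the two coordinates of a square tiling. -/
def SqTiling.swap (S : SqTiling ι) : SqTiling ι where
  toHexGraph := S.toHexGraph.swap
  a := S.b
  b := S.a
  ρ := S.ρ
  x := S.y
  y := S.x
  a_pos := S.b_pos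
  b_pos := S.a_pos
  ρ_nonneg := S.ρ_nonneg
  x_pot := S.y_pot
  y_pot := S.x_pot
  area := S.area.trans_eq (mul_comm _ _)

/-- Every finite graph satisfying the Hex lemma carries a square tiling with `a = 1`. -/
lemma HexGraph.exists_sqTiling (G : HexGraph ι) :
    ∃ S : SqTiling ι, S.toHexGraph = G ∧ S.a = 1 ∧
      S.b = ∑ i, S.ρ i * S.ρ i ∧ ∀ σ : ι → ℝ, (∀ i, 0 ≤ σ i) →
        (∀ C, AdjConn G.adj C → (C ∩ G.Lf).Nonempty → (C ∩ G.Rt).Nonempty → 1 ≤ wt σ C) →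
        S.b ≤ ∑ i, σ i * σ i := by
  classical
  let K : Set (EuclideanSpace ℝ ι) := {ρ | (∀ i, 0 ≤ ρ i) ∧
    ∀ C, AdjConn G.adj C → (C ∩ G.Lf).Nonempty → (C ∩ G.Rt).Nonempty → 1 ≤ wt ρ C}
  have hwt : ∀ C : Set ι, Continuous fun ρ : EuclideanSpace ℝ ι => wt ρ C := fun C => by
    refine continuous_finsetSum _ fun i _ => ?_
    by_cases hi : i ∈ C
    · simp only [indicator_of_mem hi]
      fun_prop
    · simp only [indicator_of_notMem hi]
      fun_prop
  have hclosed : IsClosed K := by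
    have hK : K = (⋂ i, {ρ | 0 ≤ ρ i}) ∩ ⋂ (C : Set ι) (_ : AdjConn G.adj C)
        (_ : (C ∩ G.Lf).Nonempty) (_ : (C ∩ G.Rt).Nonempty),
        {ρ : EuclideanSpace ℝ ι | 1 ≤ wt ρ C} := by
      ext ρ
      simp [K]
    rw [hK]
    refine IsClosed.inter (isClosed_iInter fun i => ?_) ?_
    · exact isClosed_le continuous_const (by fun_prop)
    · exact isClosed_iInter fun C => isClosed_iInter fun _ => isClosed_iInter fun _ =>
        isClosed_iInter fun _ => isClosed_le continuous_const (hwt C)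
  have hconv : Convex ℝ K := by
    rintro ρ ⟨h1, h2⟩ σ ⟨h3, h4⟩ p q hp hq hpq
    refine ⟨fun i => ?_, fun C hC hl hr => ?_⟩
    · have := mul_nonneg hp (h1 i)
      have := mul_nonneg hq (h3 i)
      simp only [PiLp.add_apply, PiLp.smul_apply, smul_eq_mul]
      linarith
    · have : wt (p • ρ + q • σ : EuclideanSpace ℝ ι) C = p * wt ρ C + q * wt σ C := by
        simp only [wt, Finset.mul_sum, ← Finset.sum_add_distrib]
        refine Finset.sum_congr rfl fun i _ => ?_
        simp only [indicator_apply, PiLp.add_apply, PiLp.smul_apply, smul_eq_mul]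
        split_ifs <;> simp
      rw [this]
      have := mul_le_mul_of_nonneg_left (h2 C hC hl hr) hp
      have := mul_le_mul_of_nonneg_left (h4 C hC hl hr) hq
      linarith
  have hne : K.Nonempty := by
    refine ⟨WithLp.toLp 2 fun _ => 1, fun i => zero_le_one, fun C _ ⟨i, hi, _⟩ _ => ?_⟩
    exact le_wt (σ := fun _ => 1) (fun _ => zero_le_one) hi
  obtain ⟨ρ, hρK, hρ⟩ := exists_norm_eq_iInf_of_complete_convex hne hclosed.isComplete hconv 0
  have hvar := (norm_eq_iInf_iff_real_inner_le_zero hconv hρK).1 hρ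
  have hinner : ∀ σ ∈ K, ∑ i, ρ i * ρ i ≤ ∑ i, ρ i * σ i := by
    intro σ hσ
    have := hvar σ hσ
    rw [zero_sub, inner_neg_left, inner_sub_right] at this
    simp only [PiLp.inner_apply, RCLike.inner_apply, conj_trivial] at this
    simp only [mul_comm (ρ _) (σ _)]
    linarith
  obtain ⟨hρ0, hρadm⟩ := id hρK
  have hadm : ∀ C, AdjConn G.adj C → (C ∩ G.Bt).Nonempty → (C ∩ G.Tp).Nonempty →
      ∑ i, ρ i * ρ i ≤ wt ρ C := by
    intro C hC hb ht
    have hmem : (WithLp.toLp 2 (C.indicator 1) : EuclideanSpace ℝ ι) ∈ K := by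
      refine ⟨fun i => indicator_nonneg (fun _ _ => zero_le_one) i, fun C' hC' hl hr => ?_⟩
      obtain ⟨i, hi, hi'⟩ := G.cross C' C hC' hC hl hr hb ht
      refine le_trans ?_ (le_wt (fun i => indicator_nonneg (fun _ _ => zero_le_one) i) hi)
      simp [hi']
    refine (hinner _ hmem).trans_eq (Finset.sum_congr rfl fun i _ => ?_)
    by_cases hi : i ∈ C <;> simp [hi]
  have hnn : 0 ≤ ∑ i, ρ i * ρ i := Finset.sum_nonneg fun i _ => mul_self_nonneg _
  have hx := isPot_pot G.symm zero_le_one hρ0 hρadm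
  have hy := isPot_pot G.symm hnn hρ0 hadm
  have hpos : 0 < ∑ i, ρ i * ρ i := by
    obtain ⟨C, hC, hconn, ⟨l, hl, hlL⟩, r, hr, hrR⟩ :
        ∃ C ⊆ (∅ : Set ι)ᶜ, AdjConn G.adj C ∧ (C ∩ G.Lf).Nonempty ∧ (C ∩ G.Rt).Nonempty := by
      refine (G.hex ∅).resolve_left ?_
      rintro ⟨C, hC, _, ⟨b, hb, _⟩, _⟩
      exact hC hb
    have h1 := hρadm C hconn ⟨l, hl, hlL⟩ ⟨r, hr, hrR⟩
    refine lt_of_le_of_ne hnn fun h => ?_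
    have h0 := (Finset.sum_eq_zero_iff_of_nonneg fun i _ => mul_self_nonneg (ρ i)).1 h.symm
    have h0' : ∀ i, ρ i = 0 := fun i => mul_self_eq_zero.1 (h0 i (Finset.mem_univ i))
    have : wt ρ C = 0 := Finset.sum_eq_zero fun i _ => by simp [indicator_apply, h0']
    linarith
  refine ⟨⟨G, 1, ∑ i, ρ i * ρ i, ρ, _, _, zero_lt_one, hpos, hρ0, hx, hy, by rw [one_mul]⟩,
    rfl, rfl, rfl, fun σ hσ hσadm => ?_⟩
  have h1 := hinner (WithLp.toLp 2 σ) ⟨hσ, hσadm⟩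
  have h2 := Finset.sum_mul_sq_le_sq_mul_sq Finset.univ ρ σ
  have h3 : (∑ i, ρ i * ρ i) * (∑ i, ρ i * ρ i) ≤ (∑ i, ρ i * ρ i) * ∑ i, σ i * σ i := by
    rw [← pow_two]
    refine (pow_le_pow_left₀ hpos.le h1 2).trans ?_
    simpa only [pow_two] using h2
  exact le_of_mul_le_mul_left h3 hpos

end

section

variable {ι : Type*} [Fintype ι]

lemma exists_mem_Ioo_notMem {a b : ℝ} (h : a < b) {F : Set ℝ} (hF : F.Finite) :
    ∃ t, a < t ∧ t < b ∧ t ∉ F := by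
  obtain ⟨t, ht, htF⟩ := ((Ioo_infinite h).sdiff hF).nonempty
  exact ⟨t, ht.1, ht.2, htF⟩

namespace SqTiling

variable (S : SqTiling ι)

/-- The levels at which one of the squares starts or ends. -/
def xLevels : Set ℝ := range S.x ∪ range fun i => S.x i - S.ρ i

lemma finite_xLevels : S.xLevels.Finite := (finite_range _).union (finite_range _)

/-- The open square associated with a vertex. -/
def sq (i : ι) : Set (ℝ × ℝ) := Ioo (S.x i - S.ρ i) (S.x i) ×ˢ Ioo (S.y i - S.ρ i) (S.y i)

lemma volume_sq (i : ι) : volume (S.sq i) = ENNReal.ofReal (S.ρ i * S.ρ i) := by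
  rw [sq, Measure.volume_eq_prod, Measure.prod_prod, Real.volume_Ioo, Real.volume_Ioo,
    _root_.sub_sub_cancel, _root_.sub_sub_cancel, ENNReal.ofReal_mul (S.ρ_nonneg i)]

lemma pairwise_disjoint_sq : Pairwise fun i j => Disjoint (S.sq i) (S.sq j) := by
  classical
  intro i j hij
  rw [disjoint_iff_inter_eq_empty, ← not_nonempty_iff_eq_empty]
  intro hne
  set U := S.sq i ∩ S.sq j
  have hopen : IsOpen U := (isOpen_Ioo.prod isOpen_Ioo).inter (isOpen_Ioo.prod isOpen_Ioo)
  have hU := hopen.measure_pos volume hne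
  let Q : ι → Set (ℝ × ℝ) := fun i =>
    Icc (S.x i - S.ρ i) (S.x i) ×ˢ Icc (S.y i - S.ρ i) (S.y i)
  have hsqQ : ∀ i, S.sq i ⊆ Q i := fun i => prod_mono Ioo_subset_Icc_self Ioo_subset_Icc_self
  have hQ : ∀ i, volume (Q i) = ENNReal.ofReal (S.ρ i * S.ρ i) := fun i => by
    simp only [Q]
    rw [Measure.volume_eq_prod, Measure.prod_prod, Real.volume_Icc, Real.volume_Icc,
      _root_.sub_sub_cancel, _root_.sub_sub_cancel, ENNReal.ofReal_mul (S.ρ_nonneg i)]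
  let R : ι → Set (ℝ × ℝ) := fun k => if k = j then Q j \ U else Q k
  have hsub : Icc 0 S.a ×ˢ Icc 0 S.b ⊆ ⋃ i, R i := by
    rintro ⟨s, t⟩ ⟨⟨h1, h2⟩, h3, h4⟩
    obtain ⟨k, hk⟩ := S.toHexGraph.exists_rect S.x_pot S.y_pot h1 h2 h3 h4
    rw [mem_iUnion]
    by_cases hkj : k = j
    · subst hkj
      by_cases hkU : (s, t) ∈ U
      · refine ⟨i, ?_⟩
        simp only [R, if_neg hij]
        exact hsqQ i hkU.1
      · refine ⟨k, ?_⟩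
        simp only [R, if_true]
        exact ⟨hk, hkU⟩
    · refine ⟨k, ?_⟩
      simp only [R, if_neg hkj]
      exact hk
  have h := (measure_mono (μ := (volume : Measure (ℝ × ℝ))) hsub).trans (measure_iUnion_le _)
  have hbox : volume (Icc 0 S.a ×ˢ Icc 0 S.b) = ENNReal.ofReal (S.a * S.b) := by
    rw [Measure.volume_eq_prod, Measure.prod_prod, Real.volume_Icc, Real.volume_Icc,
      sub_zero, sub_zero, ENNReal.ofReal_mul S.a_pos.le]
  have hR : ∑ k, volume (R k) + volume U = ∑ k, volume (Q k) := by
    rw [← Finset.add_sum_erase _ _ (Finset.mem_univ j),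
      ← Finset.add_sum_erase Finset.univ (fun k => volume (Q k)) (Finset.mem_univ j)]
    have h1 : volume (R j) + volume U = volume (Q j) := by
      simp only [R, if_true]
      rw [← measure_inter_add_sdiff (Q j) hopen.measurableSet,
        inter_eq_self_of_subset_right (inter_subset_right.trans (hsqQ j)), add_comm]
    have h2 : ∑ k ∈ Finset.univ.erase j, volume (R k) =
        ∑ k ∈ Finset.univ.erase j, volume (Q k) := Finset.sum_congr rfl fun k hk => by
      simp only [R, if_neg (Finset.ne_of_mem_erase hk)]
    rw [h2, ← h1]
    ring
  have hQs : ∑ k, volume (Q k) ≤ ENNReal.ofReal (S.a * S.b) := by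
    rw [Finset.sum_congr rfl fun k _ => hQ k,
      ← ENNReal.ofReal_sum_of_nonneg fun i _ => mul_self_nonneg (S.ρ i)]
    exact ENNReal.ofReal_le_ofReal S.area
  rw [hbox, tsum_fintype] at h
  have h3 : ENNReal.ofReal (S.a * S.b) + volume U ≤ ENNReal.ofReal (S.a * S.b) + 0 := by
    rw [add_zero]
    exact (add_le_add_left h _).trans (hR.le.trans hQs)
  exact hU.not_ge ((ENNReal.add_le_add_iff_left ENNReal.ofReal_ne_top).1 h3)

variable {S}

lemma eq_of_overlap {i j : ι} {s : ℝ} (hi : S.x i - S.ρ i < s ∧ s < S.x i)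
    (hj : S.x j - S.ρ j < s ∧ s < S.x j) (h1 : S.y i - S.ρ i < S.y j)
    (h2 : S.y j - S.ρ j < S.y i) : i = j := by
  by_contra hij
  have hi0 : 0 < S.ρ i := by linarith
  have hj0 : 0 < S.ρ j := by linarith
  obtain ⟨t, ht1, ht2⟩ : ∃ t, max (S.y i - S.ρ i) (S.y j - S.ρ j) < t ∧ t < min (S.y i) (S.y j) :=
    exists_between (max_lt (lt_min (by linarith) h1) (lt_min h2 (by linarith)))
  rw [max_lt_iff] at ht1
  rw [lt_min_iff] at ht2
  exact Set.disjoint_left.1 (S.pairwise_disjoint_sq hij)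
    (show (s, t) ∈ S.sq i from ⟨hi, ht1.1, ht2.1⟩) ⟨hj, ht1.2, ht2.2⟩

variable (S) in
/-- The squares crossed by the vertical line at `s`. -/
def vstrip (s : ℝ) : Set ι := {i | S.x i - S.ρ i < s ∧ s < S.x i}

lemma vstrip_conn {s : ℝ} (h0 : 0 < s) (hs : s < S.a) (hgen : s ∉ S.xLevels) :
    AdjConn S.adj (S.vstrip s) ∧ (S.vstrip s ∩ S.Bt).Nonempty ∧
      (S.vstrip s ∩ S.Tp).Nonempty := by
  obtain ⟨C, hC, hconn, hB, hT⟩ := S.toHexGraph.exists_strip S.x_pot h0.le hs.le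
  have hsub : C ⊆ S.vstrip s := fun i hi => by
    obtain ⟨h1, h2⟩ := hC hi
    exact ⟨lt_of_le_of_ne h1 fun h => hgen (Or.inr ⟨i, h⟩),
      lt_of_le_of_ne h2 fun h => hgen (Or.inl ⟨i, h.symm⟩)⟩
  have heq : S.vstrip s = C := by
    refine Subset.antisymm (fun i hi => ?_) hsub
    have hρ : 0 < S.ρ i := by linarith [hi.1, hi.2]
    have hy : 0 < S.y i := (lt_min hρ S.b_pos).trans_le (S.y_pot.min_le i)
    have hb := S.y_pot.le i
    obtain ⟨t, h1, h2, ht⟩ := exists_mem_Ioo_notMem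
      (max_lt (show S.y i - S.ρ i < S.y i by linarith) hy) S.swap.finite_xLevels
    rw [max_lt_iff] at h1
    obtain ⟨k, hk, hk1, hk2⟩ := S.y_pot.exists_level hconn hB hT h1.2.le (h2.le.trans hb)
    have hk1' : S.y k - S.ρ k < t := lt_of_le_of_ne hk1 fun h => ht (Or.inr ⟨k, h⟩)
    have hk2' : t < S.y k := lt_of_le_of_ne hk2 fun h => ht (Or.inl ⟨k, h.symm⟩)
    have := eq_of_overlap hi (hsub hk) (by linarith) (by linarith)
    rwa [this]
  rw [heq]
  exact ⟨hconn, hB, hT⟩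

variable (S) in
/-- The squares crossed by the vertical line at `s` between the levels `t₁` and `t₂`. -/
def vwin (s t₁ t₂ : ℝ) : Set ι := {i | i ∈ S.vstrip s ∧ S.y i - S.ρ i < t₂ ∧ t₁ < S.y i}

lemma vwin_conn {s t₁ t₂ : ℝ} (h0 : 0 < s) (hs : s < S.a) (hgen : s ∉ S.xLevels) :
    AdjConn S.adj (S.vwin s t₁ t₂) := by
  have hconn := (vstrip_conn h0 hs hgen).1
  have pos : ∀ {i}, i ∈ S.vstrip s → 0 < S.ρ i := fun hi => by linarith [hi.1, hi.2]
  have sep : ∀ {i j}, i ∈ S.vstrip s → j ∈ S.vstrip s → S.y i < S.y j →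
      S.y i ≤ S.y j - S.ρ j := by
    intro i j hi hj hij
    by_contra! h
    have := eq_of_overlap hi hj (by linarith [pos hi]) h
    rw [this] at hij
    exact hij.false
  have inj : ∀ {i j}, i ∈ S.vstrip s → j ∈ S.vstrip s → S.y i = S.y j → i = j :=
    fun hi hj hij => eq_of_overlap hi hj (by linarith [pos hi]) (by linarith [pos hj])
  have key : ∀ D : Set ι, (∀ i ∈ S.vwin s t₁ t₂, i ∈ D → ∀ j ∈ S.vwin s t₁ t₂, S.adj i j → j ∈ D) →
      ∀ i ∈ S.vwin s t₁ t₂, i ∈ D → ∀ j ∈ S.vwin s t₁ t₂, S.y i < S.y j → j ∈ D := by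
    intro D hD i hi hiD j hj hij
    by_contra hjD
    obtain ⟨m, ⟨hm, hmD, hmj⟩, hmax⟩ := (toFinite {m | m ∈ S.vwin s t₁ t₂ ∧ m ∈ D ∧
      S.y m < S.y j}).exists_maximalFor S.y _ ⟨i, hi, hiD, hij⟩
    have hcut : ∃ k ∈ S.vstrip s, S.y k ≤ S.y m ∧ ∃ l ∈ S.vstrip s, S.adj k l ∧ S.y m < S.y l := by
      by_contra! hcon
      exact hmj.not_ge (hconn {k | S.y k ≤ S.y m} ⟨m, hm.1, (le_refl (S.y m) : S.y m ≤ S.y m)⟩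
        (fun k hk hkm l hl hkl => hcon k hk hkm l hl hkl) hj.1)
    obtain ⟨k, hk, hkm, l, hl, hkl, hlm⟩ := hcut
    have h1 := S.y_pot.step k l hkl
    have h2 := sep hm.1 hl hlm
    obtain rfl : k = m := inj hk hm.1 (by linarith)
    rcases lt_trichotomy (S.y l) (S.y j) with h | h | h
    · have h3 := sep hl hj.1 h
      have hlw : l ∈ S.vwin s t₁ t₂ :=
        ⟨hl, by linarith [hj.2.1, pos hl], by linarith [hm.2.2]⟩
      have := hmax ⟨hlw, hD k hm hmD l hlw hkl, h⟩ hlm.le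
      linarith
    · obtain rfl := inj hl hj.1 h
      exact hjD (hD k hm hmD l hj hkl)
    · have := sep hj.1 hl h
      linarith
  rintro D ⟨i, hi, hiD⟩ hD j hj
  by_contra hjD
  rcases lt_trichotomy (S.y i) (S.y j) with h | h | h
  · exact hjD (key D hD i hi hiD j hj h)
  · exact hjD (inj hi.1 hj.1 h ▸ hiD)
  · refine key Dᶜ (fun p hp hpD q hq hpq hqD => ?_) j hj hjD i hi h hiD
    exact hpD (hD q hq hqD p hp (S.symm _ _ hpq))

lemma exists_mem_vwin {s t t₁ t₂ : ℝ} (h0 : 0 < s) (hs : s < S.a) (hgen : s ∉ S.xLevels)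
    (ht0 : 0 < t) (ht : t < S.b) (hgen' : t ∉ S.swap.xLevels) (h1 : t₁ ≤ t) (h2 : t ≤ t₂) :
    ∃ i ∈ S.vwin s t₁ t₂, S.y i - S.ρ i < t ∧ t < S.y i := by
  obtain ⟨hconn, hB, hT⟩ := vstrip_conn h0 hs hgen
  obtain ⟨k, hk, hk1, hk2⟩ := S.y_pot.exists_level hconn hB hT ht0.le ht.le
  have hk1' : S.y k - S.ρ k < t := lt_of_le_of_ne hk1 fun h => hgen' (Or.inr ⟨k, h⟩)
  have hk2' : t < S.y k := lt_of_le_of_ne hk2 fun h => hgen' (Or.inl ⟨k, h.symm⟩)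
  exact ⟨k, ⟨hk, by linarith, by linarith⟩, hk1', hk2'⟩

end SqTiling

/-- Integrating a lower bound over the levels of an interval. -/
lemma sub_le_sum_of_levels {α β : ℝ} {M : ι → Set ℝ} {m σ : ι → ℝ} {F : Set ℝ}
    (hM : ∀ k, MeasurableSet (M k)) (hm : ∀ k, 0 ≤ m k)
    (hMm : ∀ k, volume (M k) ≤ ENNReal.ofReal (m k)) (hσ : ∀ k, 0 ≤ σ k) (hF : F.Finite)
    (h : ∀ t, α < t → t < β → t ∉ F → 1 ≤ wt σ {k | t ∈ M k}) :
    β - α ≤ ∑ k, σ k * m k := by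
  classical
  have h1 : ENNReal.ofReal (β - α) ≤ ∑ k, ENNReal.ofReal (σ k) * volume (M k) := by
    calc ENNReal.ofReal (β - α) = volume (Ioo α β \ F) := by
          rw [measure_sdiff_null (hF.measure_zero _), Real.volume_Ioo]
      _ = ∫⁻ t, (Ioo α β \ F).indicator 1 t := by
          rw [lintegral_indicator_one (measurableSet_Ioo.diff hF.measurableSet)]
      _ ≤ ∫⁻ t, ∑ k, ENNReal.ofReal (σ k) * (M k).indicator 1 t := by
          refine lintegral_mono fun t => ?_
          by_cases ht : t ∈ Ioo α β \ F
          · rw [indicator_of_mem ht]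
            have h2 := ENNReal.ofReal_le_ofReal (h t ht.1.1 ht.1.2 ht.2)
            rw [wt, ENNReal.ofReal_sum_of_nonneg fun i _ => indicator_nonneg (fun i _ => hσ i) i,
              ENNReal.ofReal_one] at h2
            refine h2.trans (Finset.sum_le_sum fun k _ => ?_)
            by_cases hk : t ∈ M k <;> simp [hk]
          · rw [indicator_of_notMem ht]
            exact zero_le
      _ = ∑ k, ENNReal.ofReal (σ k) * volume (M k) := by
          rw [lintegral_finsetSum _ fun k _ => (measurable_one.indicator (hM k)).const_mul _]
          refine Finset.sum_congr rfl fun k _ => ?_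
          rw [lintegral_const_mul _ (measurable_one.indicator (hM k)),
            lintegral_indicator_one (hM k)]
  have h2 : ENNReal.ofReal (β - α) ≤ ENNReal.ofReal (∑ k, σ k * m k) := by
    rw [ENNReal.ofReal_sum_of_nonneg fun k _ => mul_nonneg (hσ k) (hm k)]
    refine h1.trans (Finset.sum_le_sum fun k _ => ?_)
    rw [ENNReal.ofReal_mul (hσ k)]
    gcongr
    exact hMm k
  exact (ENNReal.ofReal_le_ofReal_iff
    (Finset.sum_nonneg fun k _ => mul_nonneg (hσ k) (hm k))).1 h2

end

section

variable {ι : Type*} [Fintype ι]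

/-- `σ` is a weight for which every connected set joining `E` to `F` has weight at least one. -/
def Separates (adj : ι → ι → Prop) (σ : ι → ℝ) (E F : Set ι) : Prop :=
  ∀ C, AdjConn adj C → (C ∩ E).Nonempty → (C ∩ F).Nonempty → 1 ≤ wt σ C

lemma Separates.mono {adj : ι → ι → Prop} {σ : ι → ℝ} {E E' F F' : Set ι}
    (h : Separates adj σ E F) (hE : E' ⊆ E) (hF : F' ⊆ F) : Separates adj σ E' F' :=
  fun C hC h1 h2 => h C hC (h1.mono (inter_subset_inter_right _ hE))
    (h2.mono (inter_subset_inter_right _ hF))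

namespace SqTiling

variable {S : SqTiling ι}

lemma one_le_wt_strip {σ : ι → ℝ} {E : Set ι}
    (h : Separates S.adj σ E S.Lf ∨ Separates S.adj σ E S.Rt) {t : ℝ} (h0 : 0 < t) (hb : t < S.b)
    (ht : t ∉ S.swap.xLevels) (hE : (S.swap.vstrip t ∩ E).Nonempty) :
    1 ≤ wt σ (S.swap.vstrip t) := by
  obtain ⟨hconn, hL, hR⟩ := vstrip_conn (S := S.swap) h0 hb ht
  rcases h with h | h
  · exact h _ hconn hE hL
  · exact h _ hconn hE hR

lemma sub_le_sum_of_mem {σ : ι → ℝ} (hσ : ∀ i, 0 ≤ σ i) {E : Set ι} (hE : AdjConn S.adj E)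
    (h : Separates S.adj σ E S.Lf ∨ Separates S.adj σ E S.Rt) {i j : ι} (hi : i ∈ E)
    (hj : j ∈ E) : S.y j - S.y i ≤ ∑ k, σ k * S.ρ k := by
  refine sub_le_sum_of_levels (M := fun k => Ioo (S.y k - S.ρ k) (S.y k))
    (fun k => measurableSet_Ioo) S.ρ_nonneg (fun k => ?_) hσ S.swap.finite_xLevels ?_
  · rw [Real.volume_Ioo, _root_.sub_sub_cancel]
  · intro t h1 h2 ht
    have h3 := S.y_pot.nonneg i
    have h4 := S.y_pot.le j
    refine one_le_wt_strip h (by linarith) (by linarith) ht ?_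
    by_contra hne
    rw [not_nonempty_iff_eq_empty, ← disjoint_iff_inter_eq_empty, Set.disjoint_right] at hne
    have := hE {k | S.y k < t} ⟨i, hi, h1⟩ ?_ hj
    · have h5 : S.y j < t := this
      linarith
    · intro k hk hkt l hl hkl
      by_contra hlt
      have h6 := S.y_pot.step k l hkl
      have hkt' : S.y k < t := hkt
      have hlt' : ¬ S.y l < t := hlt
      refine hne hl ⟨?_, ?_⟩
      · change S.y l - S.ρ l < t
        linarith
      · exact lt_of_le_of_ne (not_lt.1 hlt') fun h => ht (Or.inl ⟨l, h.symm⟩)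

lemma min_le_sum_of_mem {σ : ι → ℝ} (hσ : ∀ i, 0 ≤ σ i) {E : Set ι}
    (h : Separates S.adj σ E S.Lf ∨ Separates S.adj σ E S.Rt) {i : ι} (hi : i ∈ E) :
    min (S.ρ i) S.b ≤ ∑ k, σ k * S.ρ k := by
  have h1 := S.y_pot.min_le i
  have key : S.y i - max 0 (S.y i - S.ρ i) ≤ ∑ k, σ k * S.ρ k := by
    refine sub_le_sum_of_levels (M := fun k => Ioo (S.y k - S.ρ k) (S.y k))
      (fun k => measurableSet_Ioo) S.ρ_nonneg (fun k => ?_) hσ S.swap.finite_xLevels ?_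
    · rw [Real.volume_Ioo, _root_.sub_sub_cancel]
    · intro t h2 h3 ht
      rw [max_lt_iff] at h2
      exact one_le_wt_strip h h2.1 (h3.trans_le (S.y_pot.le i)) ht ⟨i, ⟨h2.2, h3⟩, hi⟩
  refine le_trans ?_ key
  rcases max_choice 0 (S.y i - S.ρ i) with h2 | h2 <;> rw [h2]
  · linarith
  · exact (min_le_left _ _).trans (by linarith)

lemma sum_mul_le (S : SqTiling ι) (σ : ι → ℝ) :
    ∑ k, σ k * S.ρ k ≤ √((∑ k, σ k * σ k) * (S.a * S.b)) := by
  refine Real.le_sqrt_of_sq_le ?_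
  have := Finset.sum_mul_sq_le_sq_mul_sq Finset.univ σ S.ρ
  refine this.trans ?_
  have h0 : (0:ℝ) ≤ ∑ k, σ k * σ k := Finset.sum_nonneg fun k _ => mul_self_nonneg _
  simp only [pow_two]
  exact mul_le_mul_of_nonneg_left S.area h0

end SqTiling

end

namespace SqTiling

variable {ι : Type*} [Fintype ι] (S : SqTiling ι) (x₀ y₀ : ℝ)

/-- The squares met by the boundary of the square of centre `(x₀, y₀)` and inner radius `r`. -/
def frame (r : ℝ) : Set ι :=
  {k | (∃ s, (s = x₀ - r ∨ s = x₀ + r) ∧ 0 < s ∧ s < S.a ∧ k ∈ S.vwin s (y₀ - r) (y₀ + r)) ∨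
    ∃ t, (t = y₀ - r ∨ t = y₀ + r) ∧ 0 < t ∧ t < S.b ∧ k ∈ S.swap.vwin t (x₀ - r) (x₀ + r)}

/-- The finitely many radii for which the frame passes along a side of some square. -/
def badRadii : Set ℝ :=
  ((x₀ - ·) ⁻¹' S.xLevels ∪ (x₀ + ·) ⁻¹' S.xLevels) ∪
    ((y₀ - ·) ⁻¹' S.swap.xLevels ∪ (y₀ + ·) ⁻¹' S.swap.xLevels)

lemma finite_badRadii : (S.badRadii x₀ y₀).Finite := by
  refine ((S.finite_xLevels.preimage ?_).union (S.finite_xLevels.preimage ?_)).union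
    ((S.swap.finite_xLevels.preimage ?_).union (S.swap.finite_xLevels.preimage ?_))
  all_goals
    intro u _ v _ h
    simpa using h

variable {S x₀ y₀}

lemma frame_conn (hx0 : 0 ≤ x₀) (hxa : x₀ ≤ S.a) (hy0 : 0 ≤ y₀) (hyb : y₀ ≤ S.b) {r : ℝ}
    (hr : 0 < r) (hra : 2 * r < S.a) (hrb : 2 * r < S.b) (hgen : r ∉ S.badRadii x₀ y₀) :
    AdjConn S.adj (S.frame x₀ y₀ r) := by
  have hgx : ∀ s, s = x₀ - r ∨ s = x₀ + r → s ∉ S.xLevels := by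
    rintro s (rfl | rfl) h
    · exact hgen (Or.inl (Or.inl h))
    · exact hgen (Or.inl (Or.inr h))
  have hgy : ∀ s, s = y₀ - r ∨ s = y₀ + r → s ∉ S.swap.xLevels := by
    rintro s (rfl | rfl) h
    · exact hgen (Or.inr (Or.inl h))
    · exact hgen (Or.inr (Or.inr h))
  have hbd : ∀ z s : ℝ, s = z - r ∨ s = z + r → z - r ≤ s ∧ s ≤ z + r := by
    rintro z s (rfl | rfl) <;> constructor <;> linarith
  have hex : ∀ z c : ℝ, 0 ≤ z → z ≤ c → 2 * r < c →
      ∃ s, (s = z - r ∨ s = z + r) ∧ 0 < s ∧ s < c := by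
    intro z c h0 hc h
    by_cases h1 : 0 < z - r
    · exact ⟨z - r, Or.inl rfl, h1, by linarith⟩
    · exact ⟨z + r, Or.inr rfl, by linarith, by linarith⟩
  rintro D ⟨i, hi, hiD⟩ hD
  have sV : ∀ s, (s = x₀ - r ∨ s = x₀ + r) → 0 < s → s < S.a →
      (∃ k ∈ S.vwin s (y₀ - r) (y₀ + r), k ∈ D) → S.vwin s (y₀ - r) (y₀ + r) ⊆ D :=
    fun s hs h0 ha hne => vwin_conn h0 ha (hgx s hs) D hne fun k hk hkD l hl hkl =>
      hD k (Or.inl ⟨s, hs, h0, ha, hk⟩) hkD l (Or.inl ⟨s, hs, h0, ha, hl⟩) hkl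
  have sH : ∀ t, (t = y₀ - r ∨ t = y₀ + r) → 0 < t → t < S.b →
      (∃ k ∈ S.swap.vwin t (x₀ - r) (x₀ + r), k ∈ D) → S.swap.vwin t (x₀ - r) (x₀ + r) ⊆ D :=
    fun t ht h0 hb hne => vwin_conn (S := S.swap) h0 hb (hgy t ht) D hne fun k hk hkD l hl hkl =>
      hD k (Or.inr ⟨t, ht, h0, hb, hk⟩) hkD l (Or.inr ⟨t, ht, h0, hb, hl⟩) hkl
  have corner : ∀ s, (s = x₀ - r ∨ s = x₀ + r) → 0 < s → s < S.a →
      ∀ t, (t = y₀ - r ∨ t = y₀ + r) → 0 < t → t < S.b →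
      ∃ k, k ∈ S.vwin s (y₀ - r) (y₀ + r) ∧ k ∈ S.swap.vwin t (x₀ - r) (x₀ + r) := by
    intro s hs h0 ha t ht h0' hb
    obtain ⟨k, hk, h1, h2⟩ := exists_mem_vwin (S := S) h0 ha (hgx s hs) h0' hb (hgy t ht)
      (hbd _ _ ht).1 (hbd _ _ ht).2
    exact ⟨k, hk, ⟨h1, h2⟩, lt_of_lt_of_le hk.1.1 (hbd _ _ hs).2,
      lt_of_le_of_lt (hbd _ _ hs).1 hk.1.2⟩
  obtain ⟨s', hs', h0s', has'⟩ := hex x₀ S.a hx0 hxa hra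
  obtain ⟨t', ht', h0t', hbt'⟩ := hex y₀ S.b hy0 hyb hrb
  have hall : (∃ t, (t = y₀ - r ∨ t = y₀ + r) ∧ 0 < t ∧ t < S.b ∧
      S.swap.vwin t (x₀ - r) (x₀ + r) ⊆ D) → S.frame x₀ y₀ r ⊆ D := by
    rintro ⟨t, ht, h0t, hbt, hsub⟩
    have hV : ∀ s, (s = x₀ - r ∨ s = x₀ + r) → 0 < s → s < S.a →
        S.vwin s (y₀ - r) (y₀ + r) ⊆ D := fun s hs h0 ha => by
      obtain ⟨k, hk, hk'⟩ := corner s hs h0 ha t ht h0t hbt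
      exact sV s hs h0 ha ⟨k, hk, hsub hk'⟩
    rintro k (⟨s, hs, h0, ha, hk⟩ | ⟨u, hu, h0, hb, hk⟩)
    · exact hV s hs h0 ha hk
    · obtain ⟨l, hl, hl'⟩ := corner s' hs' h0s' has' u hu h0 hb
      exact sH u hu h0 hb ⟨l, hl', hV s' hs' h0s' has' hl⟩ hk
  rcases hi with ⟨s, hs, h0, ha, hk⟩ | ⟨t, ht, h0, hb, hk⟩
  · obtain ⟨l, hl, hl'⟩ := corner s hs h0 ha t' ht' h0t' hbt'
    exact hall ⟨t', ht', h0t', hbt', sH t' ht' h0t' hbt' ⟨l, hl', sV s hs h0 ha ⟨i, hk, hiD⟩ hl⟩⟩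
  · exact hall ⟨t, ht, h0, hb, sH t ht h0 hb ⟨i, hk, hiD⟩⟩

lemma frame_meets (hx0 : 0 ≤ x₀) (hxa : x₀ ≤ S.a) (hy0 : 0 ≤ y₀) (hyb : y₀ ≤ S.b) {r : ℝ}
    (hr : 0 < r) (hgen : r ∉ S.badRadii x₀ y₀) {E : Set ι} (hE : AdjConn S.adj E) {i j : ι}
    (hi : i ∈ E) (hix : |S.x i - x₀| < r) (hiy : |S.y i - y₀| < r) (hj : j ∈ E)
    (hj' : r ≤ max |S.x j - x₀| |S.y j - y₀|) : (S.frame x₀ y₀ r ∩ E).Nonempty := by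
  by_contra hne
  rw [not_nonempty_iff_eq_empty, ← disjoint_iff_inter_eq_empty, Set.disjoint_right] at hne
  have key := hE {k | |S.x k - x₀| < r ∧ |S.y k - y₀| < r} ⟨i, hi, hix, hiy⟩ ?_ hj
  · have h1 : |S.x j - x₀| < r ∧ |S.y j - y₀| < r := key
    exact hj'.not_gt (max_lt h1.1 h1.2)
  intro k hk hkin l hl hkl
  obtain ⟨hkx, hky⟩ : |S.x k - x₀| < r ∧ |S.y k - y₀| < r := hkin
  rw [abs_lt] at hkx hky
  by_contra hlin
  have hlin' : ¬ (|S.x l - x₀| < r ∧ |S.y l - y₀| < r) := hlin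
  have xs1 := S.x_pot.step k l hkl
  have xs2 := S.x_pot.step l k (S.symm _ _ hkl)
  have ys1 := S.y_pot.step k l hkl
  have ys2 := S.y_pot.step l k (S.symm _ _ hkl)
  have xl0 := S.x_pot.nonneg l
  have xla := S.x_pot.le l
  have yl0 := S.y_pot.nonneg l
  have ylb := S.y_pot.le l
  have rk := S.ρ_nonneg k
  have rl := S.ρ_nonneg l
  have g1 : S.x l ≠ x₀ - r := fun h => hgen (Or.inl (Or.inl (Or.inl ⟨l, h⟩)))
  have g2 : S.x l ≠ x₀ + r := fun h => hgen (Or.inl (Or.inr (Or.inl ⟨l, h⟩)))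
  have g3 : S.y l ≠ y₀ - r := fun h => hgen (Or.inr (Or.inl (Or.inl ⟨l, h⟩)))
  have g4 : S.y l ≠ y₀ + r := fun h => hgen (Or.inr (Or.inr (Or.inl ⟨l, h⟩)))
  have low : S.y l < y₀ - r → False := fun h => by
    refine hne hk (Or.inr ⟨y₀ - r, Or.inl rfl, by linarith, by linarith,
      ⟨?_, ?_⟩, ?_, ?_⟩)
    · change S.y k - S.ρ k < y₀ - r
      linarith
    · change y₀ - r < S.y k
      linarith
    · change S.x k - S.ρ k < x₀ + r
      linarith
    · change x₀ - r < S.x k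
      linarith
  rcases lt_or_gt_of_ne g3 with h3 | h3
  · exact low h3
  rcases lt_or_gt_of_ne g2 with h2 | h2
  · rcases lt_or_gt_of_ne g1 with h1 | h1
    · exact hne hk (Or.inl ⟨x₀ - r, Or.inl rfl, by linarith, by linarith,
        ⟨by linarith, by linarith⟩, by linarith, by linarith⟩)
    · rcases lt_or_gt_of_ne g4 with h4 | h4
      · refine hlin' ⟨abs_lt.2 ⟨by linarith, by linarith⟩, abs_lt.2 ⟨by linarith, by linarith⟩⟩
      · refine hne hl (Or.inr ⟨y₀ + r, Or.inr rfl, by linarith, by linarith,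
          ⟨?_, ?_⟩, ?_, ?_⟩)
        · change S.y l - S.ρ l < y₀ + r
          linarith
        · change y₀ + r < S.y l
          linarith
        · change S.x l - S.ρ l < x₀ + r
          linarith
        · change x₀ - r < S.x l
          linarith
  · exact hne hl (Or.inl ⟨x₀ + r, Or.inr rfl, by linarith, by linarith,
      ⟨by linarith, by linarith⟩, by linarith, by linarith⟩)

variable (S x₀ y₀) in
/-- The squares whose distance from `(x₀, y₀)` is comparable to `ℓ`. -/
def annulus (ℓ : ℝ) : Set ι :=
  {k | 3 / 4 * ℓ ≤ max |S.x k - x₀| |S.y k - y₀| ∧ max |S.x k - x₀| |S.y k - y₀| ≤ 9 / 4 * ℓ}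

lemma frame_subset_annulus {ℓ r : ℝ} (h1 : ℓ ≤ r) (h2 : r ≤ 2 * ℓ)
    (hρ : ∀ k, S.ρ k ≤ ℓ / 4) : S.frame x₀ y₀ r ⊆ S.annulus x₀ y₀ ℓ := by
  intro k hk
  have hk' := hρ k
  have hk0 := S.ρ_nonneg k
  rcases hk with ⟨s, hs, -, -, ⟨hk1, hk2⟩, hk3, hk4⟩ | ⟨s, hs, -, -, ⟨hk1, hk2⟩, hk3, hk4⟩
  · refine ⟨le_max_of_le_left ?_, max_le ?_ ?_⟩
    · rcases hs with rfl | rfl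
      · exact le_trans (by linarith) (neg_le_abs _)
      · exact le_trans (by linarith) (le_abs_self _)
    · rw [abs_le]; rcases hs with rfl | rfl <;> constructor <;> linarith
    · rw [abs_le]; constructor <;> linarith
  · change S.y k - S.ρ k < s at hk1
    change s < S.y k at hk2
    change S.x k - S.ρ k < x₀ + r at hk3
    change x₀ - r < S.x k at hk4
    refine ⟨le_max_of_le_right ?_, max_le ?_ ?_⟩
    · rcases hs with rfl | rfl
      · exact le_trans (by linarith) (neg_le_abs _)
      · exact le_trans (by linarith) (le_abs_self _)
    · rw [abs_le]; constructor <;> linarith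
    · rw [abs_le]; rcases hs with rfl | rfl <;> constructor <;> linarith

lemma sum_annulus_le {ℓ : ℝ} (hℓ : 0 < ℓ) (hρ : ∀ k, S.ρ k ≤ ℓ / 4) :
    ∑ k, (S.annulus x₀ y₀ ℓ).indicator (fun k => S.ρ k * S.ρ k) k ≤ 36 * (ℓ * ℓ) := by
  classical
  have h1 : volume (⋃ k ∈ Finset.univ.filter (· ∈ S.annulus x₀ y₀ ℓ), S.sq k) =
      ∑ k ∈ Finset.univ.filter (· ∈ S.annulus x₀ y₀ ℓ), ENNReal.ofReal (S.ρ k * S.ρ k) := by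
    rw [measure_biUnion_finset (fun i _ j _ hij => S.pairwise_disjoint_sq hij)
      fun k _ => measurableSet_Ioo.prod measurableSet_Ioo]
    exact Finset.sum_congr rfl fun k _ => S.volume_sq k
  have h2 : (⋃ k ∈ Finset.univ.filter (· ∈ S.annulus x₀ y₀ ℓ), S.sq k) ⊆
      Icc (x₀ - 3 * ℓ) (x₀ + 3 * ℓ) ×ˢ Icc (y₀ - 3 * ℓ) (y₀ + 3 * ℓ) := by
    refine iUnion₂_subset fun k hk => ?_
    rw [Finset.mem_filter] at hk
    obtain ⟨-, -, hk⟩ := hk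
    have h3 := abs_le.1 ((le_max_left _ _).trans hk)
    have h4 := abs_le.1 ((le_max_right _ _).trans hk)
    have := hρ k
    rintro ⟨s, t⟩ ⟨⟨h5, h6⟩, h7, h8⟩
    simp only at h5 h6 h7 h8
    refine ⟨⟨?_, ?_⟩, ?_, ?_⟩ <;> simp only <;> linarith
  have h3 := measure_mono (μ := (volume : Measure (ℝ × ℝ))) h2
  rw [h1, ← ENNReal.ofReal_sum_of_nonneg fun i _ => mul_self_nonneg (S.ρ i),
    Measure.volume_eq_prod, Measure.prod_prod, Real.volume_Icc, Real.volume_Icc,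
    ← ENNReal.ofReal_mul (by linarith), ENNReal.ofReal_le_ofReal_iff (by nlinarith)] at h3
  rw [Finset.sum_filter] at h3
  simp only [indicator_apply]
  linarith

lemma one_le_sum_annulus (hx0 : 0 ≤ x₀) (hxa : x₀ ≤ S.a) (hy0 : 0 ≤ y₀) (hyb : y₀ ≤ S.b) {ℓ : ℝ}
    (hℓ : 0 < ℓ) (ha : 4 * ℓ ≤ S.a) (hb : 4 * ℓ ≤ S.b) (hρ : ∀ k, S.ρ k ≤ ℓ / 4) {σ : ι → ℝ}
    (hσ : ∀ k, 0 ≤ σ k) {E F : Set ι} (hE : AdjConn S.adj E) (hF : AdjConn S.adj F)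
    (hEi : ∃ k ∈ E, max |S.x k - x₀| |S.y k - y₀| ≤ ℓ)
    (hEo : ∃ k ∈ E, 2 * ℓ ≤ max |S.x k - x₀| |S.y k - y₀|)
    (hFi : ∃ k ∈ F, max |S.x k - x₀| |S.y k - y₀| ≤ ℓ)
    (hFo : ∃ k ∈ F, 2 * ℓ ≤ max |S.x k - x₀| |S.y k - y₀|) (hsep : Separates S.adj σ E F) :
    1 ≤ 576 * ∑ k, (S.annulus x₀ y₀ ℓ).indicator (fun k => σ k * σ k) k := by
  classical
  set A := S.annulus x₀ y₀ ℓ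
  have meets : ∀ {G : Set ι}, AdjConn S.adj G → (∃ k ∈ G, max |S.x k - x₀| |S.y k - y₀| ≤ ℓ) →
      (∃ k ∈ G, 2 * ℓ ≤ max |S.x k - x₀| |S.y k - y₀|) → ∀ r, ℓ < r → r < 2 * ℓ →
      r ∉ S.badRadii x₀ y₀ → (S.frame x₀ y₀ r ∩ G).Nonempty := by
    rintro G hG ⟨i, hi, hi'⟩ ⟨j, hj, hj'⟩ r h1 h2 hgen
    rw [max_le_iff] at hi'
    exact frame_meets hx0 hxa hy0 hyb (by linarith) hgen hG hi (by linarith) (by linarith) hj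
      (by linarith)
  have main : 2 * ℓ - ℓ ≤ ∑ k, A.indicator σ k * (4 * S.ρ k) := by
    refine sub_le_sum_of_levels (M := fun k =>
        (Ioo (S.x k - S.ρ k - x₀) (S.x k - x₀) ∪ Ioo (x₀ - S.x k) (x₀ - S.x k + S.ρ k)) ∪
        (Ioo (S.y k - S.ρ k - y₀) (S.y k - y₀) ∪ Ioo (y₀ - S.y k) (y₀ - S.y k + S.ρ k)))
      (fun k => (measurableSet_Ioo.union measurableSet_Ioo).union
        (measurableSet_Ioo.union measurableSet_Ioo))
      (fun k => mul_nonneg (by norm_num) (S.ρ_nonneg k)) (fun k => ?_)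
      (fun k => indicator_nonneg (fun k _ => hσ k) k) (S.finite_badRadii x₀ y₀) ?_
    · have h4 : ENNReal.ofReal (4 * S.ρ k) = (ENNReal.ofReal (S.ρ k) + ENNReal.ofReal (S.ρ k)) +
          (ENNReal.ofReal (S.ρ k) + ENNReal.ofReal (S.ρ k)) := by
        have := S.ρ_nonneg k
        rw [← ENNReal.ofReal_add this this, ← ENNReal.ofReal_add (by linarith) (by linarith)]
        congr 1
        ring
      rw [h4]
      refine (measure_union_le _ _).trans (add_le_add ((measure_union_le _ _).trans
        (add_le_add ?_ ?_)) ((measure_union_le _ _).trans (add_le_add ?_ ?_)))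
      all_goals
        rw [Real.volume_Ioo]
        exact ENNReal.ofReal_le_ofReal (by linarith)
    · intro r h1 h2 hgen
      have h3 := hsep _ (frame_conn hx0 hxa hy0 hyb (by linarith) (by linarith) (by linarith) hgen)
        (meets hE hEi hEo r h1 h2 hgen) (meets hF hFi hFo r h1 h2 hgen)
      refine h3.trans (Finset.sum_le_sum fun k _ => ?_)
      by_cases hk : k ∈ S.frame x₀ y₀ r
      · have hkA : k ∈ A := frame_subset_annulus h1.le h2.le hρ hk
        rw [indicator_of_mem hk, indicator_of_mem, indicator_of_mem hkA]
        rcases hk with ⟨s, hs, -, -, ⟨hk1, hk2⟩, hk3, hk4⟩ | ⟨s, hs, -, -, ⟨hk1, hk2⟩, hk3, hk4⟩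
        · rcases hs with rfl | rfl
          · exact Or.inl (Or.inr ⟨by linarith, by linarith⟩)
          · exact Or.inl (Or.inl ⟨by linarith, by linarith⟩)
        · change S.y k - S.ρ k < s at hk1
          change s < S.y k at hk2
          rcases hs with rfl | rfl
          · exact Or.inr (Or.inr ⟨by linarith, by linarith⟩)
          · exact Or.inr (Or.inl ⟨by linarith, by linarith⟩)
      · rw [indicator_of_notMem hk]
        exact indicator_nonneg (fun k _ => indicator_nonneg (fun k _ => hσ k) k) k
  have hcs := Finset.sum_mul_sq_le_sq_mul_sq Finset.univ (A.indicator σ) (A.indicator S.ρ)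
  have hsum : ∑ k, A.indicator σ k * (4 * S.ρ k) =
      4 * ∑ k, A.indicator σ k * A.indicator S.ρ k := by
    rw [Finset.mul_sum]
    refine Finset.sum_congr rfl fun k _ => ?_
    by_cases hk : k ∈ A <;> simp [hk]
    ring
  have hsq : ∀ f : ι → ℝ, ∑ k, A.indicator f k ^ 2 = ∑ k, A.indicator (fun k => f k * f k) k :=
    fun f => Finset.sum_congr rfl fun k _ => by by_cases hk : k ∈ A <;> simp [hk, pow_two]
  rw [hsq, hsq] at hcs
  have hA : ∑ k, A.indicator (fun k => S.ρ k * S.ρ k) k ≤ 36 * (ℓ * ℓ) := sum_annulus_le hℓ hρ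
  have hpos : 0 ≤ ∑ k, A.indicator (fun k => σ k * σ k) k :=
    Finset.sum_nonneg fun k _ => indicator_nonneg (fun k _ => mul_self_nonneg _) k
  rw [hsum] at main
  set T := ∑ k, A.indicator σ k * A.indicator S.ρ k
  set U := ∑ k, A.indicator (fun k => σ k * σ k) k
  have h5 : T ^ 2 ≤ U * (36 * (ℓ * ℓ)) := hcs.trans (mul_le_mul_of_nonneg_left hA hpos)
  have h6 : ℓ * ℓ ≤ 16 * T ^ 2 := by nlinarith
  have h7 : 0 < ℓ * ℓ := by positivity
  by_contra! h8
  nlinarith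

/-- A Loewner type estimate: two connected sets of squares, both joining a small neighbourhood
of a point to the outside of a large one, can only be separated by a heavy weight. -/
lemma nat_le_sum_of_separates (hx0 : 0 ≤ x₀) (hxa : x₀ ≤ S.a) (hy0 : 0 ≤ y₀) (hyb : y₀ ≤ S.b)
    {s₁ s₂ : ℝ} (hs : 0 < s₁) (ha : s₂ ≤ S.a) (hb : s₂ ≤ S.b) (hρ : ∀ k, S.ρ k ≤ s₁ / 4)
    {σ : ι → ℝ} (hσ : ∀ k, 0 ≤ σ k) {E F : Set ι} (hE : AdjConn S.adj E) (hF : AdjConn S.adj F)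
    (hEi : ∃ k ∈ E, max |S.x k - x₀| |S.y k - y₀| ≤ s₁)
    (hEo : ∃ k ∈ E, s₂ ≤ max |S.x k - x₀| |S.y k - y₀|)
    (hFi : ∃ k ∈ F, max |S.x k - x₀| |S.y k - y₀| ≤ s₁)
    (hFo : ∃ k ∈ F, s₂ ≤ max |S.x k - x₀| |S.y k - y₀|) (hsep : Separates S.adj σ E F)
    (n : ℕ) (hn : 4 ^ n * s₁ ≤ s₂) : (n : ℝ) ≤ 576 * ∑ k, σ k * σ k := by
  classical
  have hscale : ∀ j ∈ Finset.range n,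
      (1:ℝ) ≤ 576 * ∑ k, (S.annulus x₀ y₀ (4 ^ j * s₁)).indicator (fun k => σ k * σ k) k := by
    intro j hj
    have h1 : (1:ℝ) ≤ 4 ^ j := one_le_pow₀ (by norm_num)
    have h2 : (4:ℝ) * 4 ^ j ≤ 4 ^ n := by
      rw [← pow_succ']
      exact pow_le_pow_right₀ (by norm_num) (Finset.mem_range.1 hj)
    have h3 : s₁ ≤ 4 ^ j * s₁ := le_mul_of_one_le_left hs.le h1
    have h4 : 4 * (4 ^ j * s₁) ≤ s₂ := by nlinarith
    refine one_le_sum_annulus hx0 hxa hy0 hyb (by positivity) (by linarith) (by linarith)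
      (fun k => (hρ k).trans (by linarith)) hσ hE hF ?_ ?_ ?_ ?_ hsep
    · obtain ⟨k, hk, h⟩ := hEi; exact ⟨k, hk, h.trans h3⟩
    · obtain ⟨k, hk, h⟩ := hEo; exact ⟨k, hk, le_trans (by linarith) h⟩
    · obtain ⟨k, hk, h⟩ := hFi; exact ⟨k, hk, h.trans h3⟩
    · obtain ⟨k, hk, h⟩ := hFo; exact ⟨k, hk, le_trans (by linarith) h⟩
  have h1 := Finset.sum_le_sum hscale
  rw [Finset.sum_const, Finset.card_range, nsmul_eq_mul, mul_one, ← Finset.mul_sum,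
    Finset.sum_comm] at h1
  refine h1.trans (mul_le_mul_of_nonneg_left (Finset.sum_le_sum fun k _ => ?_) (by norm_num))
  by_cases hk : ∃ j ∈ Finset.range n, k ∈ S.annulus x₀ y₀ (4 ^ j * s₁)
  · obtain ⟨j, hj, hkj⟩ := hk
    rw [Finset.sum_eq_single_of_mem j hj]
    · rw [indicator_of_mem hkj]
    · intro i _ hij
      refine indicator_of_notMem (fun hki => ?_) _
      rcases lt_or_gt_of_ne hij with h | h
      · have h2 : (4:ℝ) * 4 ^ i ≤ 4 ^ j := by
          rw [← pow_succ']
          exact pow_le_pow_right₀ (by norm_num) h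
        have h3 := hkj.1.trans hki.2
        have h4 : (0:ℝ) < 4 ^ i * s₁ := by positivity
        nlinarith
      · have h2 : (4:ℝ) * 4 ^ j ≤ 4 ^ i := by
          rw [← pow_succ']
          exact pow_le_pow_right₀ (by norm_num) h
        have h3 := hki.1.trans hkj.2
        have h4 : (0:ℝ) < 4 ^ j * s₁ := by positivity
        nlinarith
  · push Not at hk
    rw [Finset.sum_eq_zero fun j hj => indicator_of_notMem (hk j hj) _]
    exact mul_self_nonneg _

end SqTiling

/-! ### Geodesic spaces and separation in the disc -/

lemma exists_geodesic_path {X : Type*} [MetricSpace X] (hgeo : IsGeodesicSpace X) (x y : X) :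
    ∃ γ : Path x y, ∀ t, dist x (γ t) + dist (γ t) y = dist x y := by
  obtain ⟨⟨a, b, hab, f, hf⟩, ha, hb, hlen⟩ := hgeo x y
  simp only at ha hb
  simp only [MCurve.length] at hlen
  have hmap : ∀ t : unitInterval, a + t * (b - a) ∈ Icc a b := fun t => by
    have := t.2.1
    have := t.2.2
    constructor <;> nlinarith
  refine ⟨⟨⟨fun t => f (a + t * (b - a)), ?_⟩, by simp [ha], by simp [hb]⟩, fun t => ?_⟩
  · exact hf.comp_continuous (by fun_prop) hmap
  · change dist x (f (a + t * (b - a))) + dist (f (a + t * (b - a))) y = dist x y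
    obtain ⟨h1, h2⟩ := hmap t
    set s := a + (t : ℝ) * (b - a)
    refine le_antisymm ?_ (dist_triangle _ _ _)
    have h3 : edist x (f s) + edist (f s) y ≤ edist x y := by
      have hadd := eVariationOn.Icc_add_Icc f h1 h2 (mem_univ s)
      simp only [univ_inter] at hadd
      rw [← hlen, ← hadd]
      refine add_le_add ?_ ?_
      · have := eVariationOn.edist_le f (left_mem_Icc.2 h1) (right_mem_Icc.2 h1)
        rwa [ha] at this
      · have := eVariationOn.edist_le f (left_mem_Icc.2 h2) (right_mem_Icc.2 h2)
        rwa [hb] at this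
    rw [edist_dist, edist_dist, edist_dist, ← ENNReal.ofReal_add dist_nonneg dist_nonneg] at h3
    exact (ENNReal.ofReal_le_ofReal_iff dist_nonneg).1 h3

section Geodesic

variable {X : Type*} [MetricSpace X]

lemma isPathConnected_ball (hgeo : IsGeodesicSpace X) {x : X} {r : ℝ} (hr : 0 < r) :
    IsPathConnected (ball x r) := by
  refine ⟨x, mem_ball_self hr, fun {y} hy => ?_⟩
  obtain ⟨γ, hγ⟩ := exists_geodesic_path hgeo x y
  refine ⟨γ, fun t => ?_⟩
  rw [mem_ball, dist_comm]
  have h1 := hγ t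
  have h2 : 0 ≤ dist (γ t) y := dist_nonneg
  rw [mem_ball, dist_comm] at hy
  linarith

lemma locallyPathConnectedSpace (hgeo : IsGeodesicSpace X) : LocallyPathConnectedSpace X :=
  LocallyPathConnectedSpace.of_bases (fun _ => nhds_basis_ball)
    fun _ _ hr => isPathConnected_ball hgeo hr

/-- A geodesic contains points at any intermediate distance. -/
lemma exists_dist_eq (hgeo : IsGeodesicSpace X) (x y : X) {s : ℝ} (h0 : 0 ≤ s) (hs : s ≤ dist x y) :
    ∃ z, dist x z = s ∧ dist z y = dist x y - s := by
  obtain ⟨γ, hγ⟩ := exists_geodesic_path hgeo x y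
  have hc : Continuous fun t => dist x (γ t) := by fun_prop
  have h := intermediate_value_univ (0 : unitInterval) 1 hc
  have hm : s ∈ Icc (dist x (γ 0)) (dist x (γ 1)) := by simp [h0, hs]
  obtain ⟨t, ht⟩ := h hm
  simp only at ht
  exact ⟨γ t, ht, by linarith [hγ t]⟩

end Geodesic

lemma simplyConnectedSpace_of_homeomorph {X : Type*} [TopologicalSpace X]
    (φ : ↥unitClosedDisc ≃ₜ X) : SimplyConnectedSpace X := by
  have : ContractibleSpace ↥unitClosedDisc := contractibleSpace_closedBall zero_le_one
  have := φ.symm.contractibleSpace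
  infer_instance

/-- The points `x` and `y` are joined by a connected set avoiding `A`. -/
def NotSep {X : Type*} [TopologicalSpace X] (A : Set X) (x y : X) : Prop :=
  ∃ K, IsPreconnected K ∧ x ∈ K ∧ y ∈ K ∧ Disjoint K A

lemma frontier_connectedComponentIn_subset {X : Type*} [TopologicalSpace X]
    [LocallyConnectedSpace X] {A : Set X} (hA : IsClosed A) (x : X) :
    frontier (connectedComponentIn Aᶜ x) ⊆ A := by
  intro q hq
  by_contra hqA
  have hopen : IsOpen (connectedComponentIn Aᶜ q) := hA.isOpen_compl.connectedComponentIn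
  have hmem : q ∈ connectedComponentIn Aᶜ q := mem_connectedComponentIn hqA
  obtain ⟨w, hwq, hwx⟩ := mem_closure_iff.1 hq.1 _ hopen hmem
  have h1 := connectedComponentIn_eq hwq
  have h2 := connectedComponentIn_eq hwx
  rw [h2, ← h1] at hq
  rw [hopen.frontier_eq] at hq
  exact hq.2 hmem

section Janiszewski

variable {X : Type*} [MetricSpace X] [SimplyConnectedSpace X] [LocallyPathConnectedSpace X]

lemma exists_circle_lift (g : C(X, Circle)) : ∃ θ : C(X, ℝ), ∀ z, Circle.exp (θ z) = g z := by
  obtain ⟨x⟩ : Nonempty X := inferInstance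
  obtain ⟨θ, ⟨-, hθ⟩, -⟩ := Circle.isCoveringMap_exp.existsUnique_continuousMap_lifts g x
    (Complex.arg (g x)) (Circle.exp_arg _)
  exact ⟨θ, fun z => congrFun hθ z⟩

/-- In a simply connected space, the union of two disjoint closed sets which do not separate
`x` from `y` does not separate `x` from `y`. -/
lemma NotSep.union {A B : Set X} (hA : IsClosed A) (hB : IsClosed B) (hAB : Disjoint A B)
    {x y : X} (h1 : NotSep A x y) (h2 : NotSep B x y) : NotSep (A ∪ B) x y := by
  classical
  rcases A.eq_empty_or_nonempty with rfl | hAne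
  · rwa [empty_union]
  rcases B.eq_empty_or_nonempty with rfl | hBne
  · rwa [union_empty]
  by_contra hsep
  obtain ⟨K₁, hK₁, hx1, hy1, hd1⟩ := h1
  obtain ⟨K₂, hK₂, hx2, hy2, hd2⟩ := h2
  rw [Set.disjoint_left] at hd1 hd2
  have hxAB : x ∈ (A ∪ B)ᶜ := fun h => h.elim (hd1 hx1) (hd2 hx2)
  set P := connectedComponentIn (A ∪ B)ᶜ x
  have hxP : x ∈ P := mem_connectedComponentIn hxAB
  have hyP : y ∉ P := fun hy => hsep ⟨P, isPreconnected_connectedComponentIn, hxP, hy,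
    Set.disjoint_left.2 fun z hz => connectedComponentIn_subset _ _ hz⟩
  have hden : ∀ z, 0 < infDist z A + infDist z B := by
    intro z
    have ha := infDist_nonneg (x := z) (s := A)
    have hb := infDist_nonneg (x := z) (s := B)
    by_contra! hle
    have ha0 : z ∈ A := (hA.mem_iff_infDist_zero hAne).2 (by linarith)
    have hb0 : z ∈ B := (hB.mem_iff_infDist_zero hBne).2 (by linarith)
    exact Set.disjoint_left.1 hAB ha0 hb0
  set h : X → ℝ := fun z => infDist z A / (infDist z A + infDist z B) with hh
  have hc : Continuous h := (continuous_infDist_pt A).div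
    ((continuous_infDist_pt A).add (continuous_infDist_pt B)) fun z => (hden z).ne'
  have h0 : ∀ z, 0 ≤ h z := fun z => div_nonneg infDist_nonneg (hden z).le
  have h1 : ∀ z, h z ≤ 1 := fun z => (div_le_one (hden z)).2
    (by linarith [infDist_nonneg (x := z) (s := B)])
  have hA0 : ∀ z, h z = 0 ↔ z ∈ A := fun z => by
    rw [hA.mem_iff_infDist_zero hAne, hh]
    simp [(hden z).ne']
  have hB1 : ∀ z, h z = 1 ↔ z ∈ B := fun z => by
    rw [hB.mem_iff_infDist_zero hBne, hh]
    simp only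
    rw [div_eq_one_iff_eq (hden z).ne']
    constructor <;> intro h <;> linarith
  let g : X → Circle := fun z =>
    if z ∈ P then Circle.exp (h z * Real.pi) else Circle.exp (-(h z * Real.pi))
  have hg : Continuous g := by
    refine Continuous.if (fun z hz => ?_) (by fun_prop) (by fun_prop)
    rcases frontier_connectedComponentIn_subset (hA.union hB) x hz with hz | hz
    · rw [(hA0 z).2 hz]; simp
    · rw [(hB1 z).2 hz]
      rw [Circle.exp_eq_exp]
      exact ⟨1, by push_cast; ring⟩
  obtain ⟨θ, hθ⟩ := exists_circle_lift ⟨g, hg⟩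
  have hpi := Real.pi_pos
  have hPz : ∀ z ∈ P, ∃ k : ℤ, θ z = (2 * k + h z) * Real.pi := fun z hz => by
    have h3 := hθ z
    simp only [ContinuousMap.coe_mk, g, if_pos hz] at h3
    obtain ⟨m, hm⟩ := Circle.exp_eq_exp.1 h3
    exact ⟨m, by rw [hm]; ring⟩
  have hPn : ∀ z ∉ P, ∃ k : ℤ, θ z = (2 * k - h z) * Real.pi := fun z hz => by
    have h3 := hθ z
    simp only [ContinuousMap.coe_mk, g, if_neg hz] at h3
    obtain ⟨m, hm⟩ := Circle.exp_eq_exp.1 h3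
    exact ⟨m, by rw [hm]; ring⟩
  have hcase : ∀ z, ∃ k : ℤ, ∃ e : ℝ, (e = h z ∨ e = -h z) ∧ θ z = (2 * k + e) * Real.pi := by
    intro z
    by_cases hz : z ∈ P
    · obtain ⟨k, hk⟩ := hPz z hz
      exact ⟨k, h z, Or.inl rfl, hk⟩
    · obtain ⟨k, hk⟩ := hPn z hz
      exact ⟨k, -h z, Or.inr rfl, by rw [hk]; ring⟩
  obtain ⟨k, hk⟩ := hPz x hxP
  obtain ⟨l, hl⟩ := hPn y hyP
  have hx0 : 0 < h x := lt_of_le_of_ne (h0 x) fun h => hd1 hx1 ((hA0 x).1 h.symm)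
  have hy0 : 0 < h y := lt_of_le_of_ne (h0 y) fun h => hd1 hy1 ((hA0 y).1 h.symm)
  have hx1' : h x < 1 := lt_of_le_of_ne (h1 x) fun h => hd2 hx2 ((hB1 x).1 h)
  have hy1' : h y < 1 := lt_of_le_of_ne (h1 y) fun h => hd2 hy2 ((hB1 y).1 h)
  rcases le_or_gt l k with hlk | hlk
  · have hlk' : (l : ℝ) ≤ k := by exact_mod_cast hlk
    obtain ⟨z, hz, hzk⟩ := hK₁.intermediate_value hy1 hx1 θ.continuous.continuousOn
      (show 2 * (k : ℝ) * Real.pi ∈ Icc (θ y) (θ x) by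
        rw [hk, hl]; constructor <;> nlinarith)
    have hz0 : 0 < h z := lt_of_le_of_ne (h0 z) fun h => hd1 hz ((hA0 z).1 h.symm)
    obtain ⟨m, e, he, hm⟩ := hcase z
    rw [hm] at hzk
    have h4 : 2 * (m : ℝ) + e = 2 * k := mul_right_cancel₀ hpi.ne' hzk
    have h5 := h1 z
    rcases lt_trichotomy m k with h6 | h6 | h6
    · have h7 : (m : ℝ) + 1 ≤ k := by exact_mod_cast h6
      rcases he with rfl | rfl <;> linarith
    · rw [h6] at h4
      rcases he with rfl | rfl <;> linarith
    · have h7 : (k : ℝ) + 1 ≤ m := by exact_mod_cast h6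
      rcases he with rfl | rfl <;> linarith
  · have hlk' : (k : ℝ) + 1 ≤ l := by exact_mod_cast hlk
    obtain ⟨z, hz, hzk⟩ := hK₂.intermediate_value hx2 hy2 θ.continuous.continuousOn
      (show (2 * (k : ℝ) + 1) * Real.pi ∈ Icc (θ x) (θ y) by
        rw [hk, hl]; constructor <;> nlinarith)
    have hz1 : h z < 1 := lt_of_le_of_ne (h1 z) fun h => hd2 hz ((hB1 z).1 h)
    obtain ⟨m, e, he, hm⟩ := hcase z
    rw [hm] at hzk
    have h4 : 2 * (m : ℝ) + e = 2 * k + 1 := mul_right_cancel₀ hpi.ne' hzk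
    have h5 := h0 z
    rcases le_or_gt m k with h6 | h6
    · have h7 : (m : ℝ) ≤ k := by exact_mod_cast h6
      rcases he with rfl | rfl <;> linarith
    · have h7 : (k : ℝ) + 1 ≤ m := by exact_mod_cast h6
      rcases he with rfl | rfl <;> linarith

/-- Closed sets of small total diameter, lying far from `x` and `y`, do not separate them. -/
lemma notSep_of_sum_diam_lt [CompactSpace X] {lam : ℝ} (hlam : 1 ≤ lam)
    (hllc : ∀ (x : X) (r : ℝ), 0 < r → ∀ y ∉ ball x r, ∀ z ∉ ball x r, ∃ C : Set X,
      IsPreconnected C ∧ y ∈ C ∧ z ∈ C ∧ C ⊆ (ball x (r / lam))ᶜ)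
    {D : ℝ} {x y : X} (l : List (Set X)) (hl : ∀ A ∈ l, IsClosed A)
    (hD : (l.map diam).sum < D)
    (hfar : ∀ A ∈ l, ∀ c ∈ A, lam * D ≤ dist x c ∧ lam * D ≤ dist y c) :
    NotSep {z | ∃ A ∈ l, z ∈ A} x y := by
  classical
  have hbdd : ∀ A : Set X, Bornology.IsBounded A := fun A => isBounded_of_compactSpace
  have hnn : ∀ l : List (Set X), 0 ≤ (l.map diam).sum := fun l =>
    List.sum_nonneg fun d hd => by
      obtain ⟨A, -, rfl⟩ := List.mem_map.1 hd
      exact diam_nonneg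
  obtain ⟨n, hn⟩ : ∃ n, l.length = n := ⟨_, rfl⟩
  induction n generalizing l with
  | zero =>
    rw [List.length_eq_zero_iff] at hn
    subst hn
    exact ⟨univ, isPreconnected_univ, mem_univ _, mem_univ _, by simp⟩
  | succ n ih =>
    obtain ⟨A, l, rfl⟩ := List.exists_of_length_succ l hn
    simp only [List.length_cons, Nat.add_right_cancel_iff] at hn
    simp only [List.map_cons, List.sum_cons] at hD
    have hA : IsClosed A := hl A (by simp)
    have hl' : ∀ B ∈ l, IsClosed B := fun B hB => hl B (by simp [hB])
    have hfar' : ∀ B ∈ l, ∀ c ∈ B, lam * D ≤ dist x c ∧ lam * D ≤ dist y c :=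
      fun B hB => hfar B (by simp [hB])
    by_cases hint : ∃ B ∈ l, (A ∩ B).Nonempty
    · obtain ⟨B, hB, hAB⟩ := hint
      have hperm := List.perm_cons_erase hB
      have hlen := hperm.length_eq
      have hsum := (hperm.map diam).sum_eq
      simp only [List.length_cons, List.map_cons, List.sum_cons] at hlen hsum
      have hdu : diam (A ∪ B) ≤ diam A + diam B := diam_union' hAB
      have g1 : ∀ C ∈ (A ∪ B) :: l.erase B, IsClosed C := by
        intro C hC
        rcases List.mem_cons.1 hC with rfl | hC
        · exact hA.union (hl' B hB)
        · exact hl' C (List.mem_of_mem_erase hC)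
      have g2 : (((A ∪ B) :: l.erase B).map diam).sum < D := by
        simp only [List.map_cons, List.sum_cons]
        linarith
      have g3 : ∀ C ∈ (A ∪ B) :: l.erase B, ∀ c ∈ C,
          lam * D ≤ dist x c ∧ lam * D ≤ dist y c := by
        intro C hC
        rcases List.mem_cons.1 hC with rfl | hC
        · rintro c (hc | hc)
          · exact hfar A (by simp) c hc
          · exact hfar' B hB c hc
        · exact hfar' C (List.mem_of_mem_erase hC)
      obtain ⟨K, hK, hxK, hyK, hd⟩ := ih _ g1 g2 g3 (by simp only [List.length_cons]; omega)
      refine ⟨K, hK, hxK, hyK, hd.mono_right ?_⟩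
      rintro z ⟨C, hC, hz⟩
      rcases List.mem_cons.1 hC with rfl | hC
      · exact ⟨_, List.mem_cons_self, Or.inl hz⟩
      · rcases List.mem_cons.1 (hperm.mem_iff.1 hC) with rfl | hC
        · exact ⟨_, List.mem_cons_self, Or.inr hz⟩
        · exact ⟨C, List.mem_cons_of_mem _ hC, hz⟩
    · push Not at hint
      have hset : {z | ∃ B ∈ A :: l, z ∈ B} = A ∪ {z | ∃ B ∈ l, z ∈ B} := by
        ext z
        simp
      have hunion : {z | ∃ B ∈ l, z ∈ B} = ⋃ B ∈ l.toFinset, B := by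
        ext z
        simp
      rw [hset]
      refine NotSep.union hA ?_ ?_ ?_
        (ih l hl' (by linarith [diam_nonneg (s := A)]) hfar' hn)
      · rw [hunion]
        exact isClosed_biUnion_finset fun B hB => hl' B (List.mem_toFinset.1 hB)
      · rw [Set.disjoint_left]
        rintro z hz ⟨B, hB, hzB⟩
        have : z ∈ A ∩ B := ⟨hz, hzB⟩
        rw [hint B hB] at this
        exact this
      · rcases A.eq_empty_or_nonempty with rfl | ⟨c, hc⟩
        · exact ⟨univ, isPreconnected_univ, mem_univ _, mem_univ _, by simp⟩
        have hD0 : 0 < D := by linarith [diam_nonneg (s := A), hnn l]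
        obtain ⟨h1, h2⟩ := hfar A (by simp) c hc
        obtain ⟨K, hK, hxK, hyK, hKc⟩ := hllc c (lam * D) (by positivity) x
          (by rw [mem_ball]; exact h1.not_gt) y (by rw [mem_ball]; exact h2.not_gt)
        refine ⟨K, hK, hxK, hyK, Set.disjoint_left.2 fun z hz hzA => hKc hz ?_⟩
        rw [mul_div_cancel_left₀ _ (by linarith), mem_ball]
        exact (dist_le_diam_of_mem (hbdd A) hzA hc).trans_lt (by linarith [hnn l])

end Janiszewski

/-- The second half of linear local connectivity. -/
def LLC₂ (X : Type*) [MetricSpace X] (lam : ℝ) : Prop :=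
  ∀ (x : X) (r : ℝ), 0 < r → ∀ y ∉ ball x r, ∀ z ∉ ball x r, ∃ C : Set X,
    IsPreconnected C ∧ y ∈ C ∧ z ∈ C ∧ C ⊆ (ball x (r / lam))ᶜ

/-- A set of small Hausdorff measure is covered by balls with small square sum of radii. -/
lemma exists_ball_cover {X : Type*} [MetricSpace X] [MeasurableSpace X] [BorelSpace X]
    (A : Set X) (p : X) {M : ℝ} (hM : 0 < M) (h : μH[2] A < ENNReal.ofReal M) :
    ∃ (c : ℕ → X) (d : ℕ → ℝ), (∀ n, 0 ≤ d n) ∧ A ⊆ ⋃ n, ball (c n) (d n) ∧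
      ∑' n, ENNReal.ofReal (d n * d n) < ENNReal.ofReal (4 * M) := by
  classical
  rw [Measure.hausdorffMeasure_apply] at h
  have h1 := (le_iSup₂ (f := fun (r : ℝ≥0∞) (_ : 0 < r) =>
    ⨅ (t : ℕ → Set X) (_ : A ⊆ ⋃ n, t n) (_ : ∀ n, ediam (t n) ≤ r),
          ∑' n, ⨆ _ : (t n).Nonempty, ediam (t n) ^ (2:ℝ)) 1 one_pos).trans_lt h
  simp only [iInf_lt_iff] at h1
  obtain ⟨t, hcov, hdiam, hsum⟩ := h1
  obtain ⟨ε, hε, hεs⟩ := ENNReal.exists_pos_sum_of_countable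
    (ε := ENNReal.ofReal M) (by simpa using hM) ℕ
  have hη : ∀ n, 0 < √(ε n : ℝ) := fun n => Real.sqrt_pos.2 (hε n)
  refine ⟨fun n => if hn : (t n).Nonempty then hn.some else p,
    fun n => if (t n).Nonempty then diam (t n) + √(ε n : ℝ) else 0, fun n => ?_, ?_, ?_⟩
  · dsimp only
    split_ifs
    · exact add_nonneg diam_nonneg (hη n).le
    · exact le_rfl
  · refine hcov.trans (iUnion_mono fun n z hz => ?_)
    have hn : (t n).Nonempty := ⟨z, hz⟩
    simp only [hn, if_true, dif_pos, mem_ball]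
    have hb : Bornology.IsBounded (t n) := by
      rw [isBounded_iff_ediam_ne_top]
      exact ((hdiam n).trans_lt ENNReal.one_lt_top).ne
    exact (dist_le_diam_of_mem hb hz hn.some_mem).trans_lt (by linarith [hη n])
  · have hle : ∀ n, ENNReal.ofReal ((if (t n).Nonempty then diam (t n) + √(ε n : ℝ) else 0) *
        (if (t n).Nonempty then diam (t n) + √(ε n : ℝ) else 0)) ≤
        2 * (⨆ _ : (t n).Nonempty, ediam (t n) ^ (2:ℝ)) + 2 * (ε n : ℝ≥0∞) := by
      intro n
      by_cases hn : (t n).Nonempty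
      · simp only [hn, if_true, iSup_pos]
        have h2 : ediam (t n) = ENNReal.ofReal (diam (t n)) :=
          (ENNReal.ofReal_toReal ((hdiam n).trans_lt ENNReal.one_lt_top).ne).symm
        have h3 : (ε n : ℝ≥0∞) = ENNReal.ofReal (ε n) := by simp
        rw [h2, h3, ENNReal.ofReal_rpow_of_nonneg diam_nonneg (by norm_num),
          show (2 : ℝ≥0∞) = ENNReal.ofReal 2 by simp, ← ENNReal.ofReal_mul (by norm_num),
          ← ENNReal.ofReal_mul (by norm_num), ← ENNReal.ofReal_add (by positivity) (by positivity)]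
        refine ENNReal.ofReal_le_ofReal ?_
        have h4 := Real.sq_sqrt (ε n).coe_nonneg
        rw [Real.rpow_two]
        nlinarith [sq_nonneg (diam (t n) - √(ε n : ℝ))]
      · simp [hn]
    refine (ENNReal.tsum_le_tsum hle).trans_lt ?_
    rw [ENNReal.tsum_add, ENNReal.tsum_mul_left, ENNReal.tsum_mul_left]
    have h5 : ENNReal.ofReal (4 * M) = 2 * ENNReal.ofReal M + 2 * ENNReal.ofReal M := by
      rw [show (2 : ℝ≥0∞) = ENNReal.ofReal 2 by simp, ← ENNReal.ofReal_mul (by norm_num),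
        ← ENNReal.ofReal_add (by positivity) (by positivity)]
      congr 1
      ring
    rw [h5]
    exact ENNReal.add_lt_add (ENNReal.mul_lt_mul_right (by simp) (by simp) hsum)
      (ENNReal.mul_lt_mul_right (by simp) (by simp) hεs)

lemma exists_far {X : Type*} [MetricSpace X] [Nontrivial X] :
    ∃ r₁ > (0:ℝ), ∀ p : X, ∃ q, r₁ ≤ dist p q := by
  obtain ⟨a, b, hab⟩ := exists_pair_ne X
  refine ⟨dist a b / 2, half_pos (dist_pos.2 hab), fun p => ?_⟩
  by_contra! h
  have h1 := h a
  have h2 := h b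
  have h3 := dist_triangle_left a b p
  linarith

section Mass

variable {X : Type*} [MetricSpace X] [MeasurableSpace X] [BorelSpace X] [CompactSpace X]
  [SimplyConnectedSpace X] [LocallyPathConnectedSpace X]

lemma le_hausdorffMeasure_ball {lam : ℝ} (hlam : 1 ≤ lam) (hllc : LLC₂ X lam) {p q : X} {r : ℝ}
    (hr : 0 < r) (hq : r ≤ dist p q) :
    ENNReal.ofReal (r ^ 2 / (1024 * lam)) ≤ μH[2] (ball p r) := by
  classical
  by_contra! hlt
  have hlam0 : 0 < lam := by linarith
  obtain ⟨c, d, hd, hcov, hsum⟩ := exists_ball_cover _ p (by positivity) hlt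
  set f : ℝ → ℝ≥0∞ := fun s => ∑' n, ENNReal.ofReal (d n) *
    (Ioo (dist p (c n) - d n) (dist p (c n) + d n)).indicator 1 s with hf
  have hint : ∫⁻ s in Ioo (r / 4) (r / 2), f s < ENNReal.ofReal (8 * (r ^ 2 / (1024 * lam))) := by
    calc ∫⁻ s in Ioo (r / 4) (r / 2), f s ≤ ∫⁻ s, f s := setLIntegral_le_lintegral _ _
      _ = ∑' n, ENNReal.ofReal (d n) * ENNReal.ofReal (2 * d n) := by
          rw [hf, lintegral_tsum fun n =>
            ((measurable_one.indicator measurableSet_Ioo).const_mul _).aemeasurable]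
          congr 1
          ext n
          rw [lintegral_const_mul _ (measurable_one.indicator measurableSet_Ioo),
            lintegral_indicator_one measurableSet_Ioo, Real.volume_Ioo]
          congr 2
          ring
      _ = 2 * ∑' n, ENNReal.ofReal (d n * d n) := by
          rw [← ENNReal.tsum_mul_left]
          congr 1
          ext n
          rw [show (2 : ℝ≥0∞) = ENNReal.ofReal 2 by simp, ← ENNReal.ofReal_mul (hd n),
            ← ENNReal.ofReal_mul (by norm_num)]
          congr 1
          ring
      _ < 2 * ENNReal.ofReal (4 * (r ^ 2 / (1024 * lam))) :=
          ENNReal.mul_lt_mul_right (by simp) (by simp) hsum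
      _ = ENNReal.ofReal (8 * (r ^ 2 / (1024 * lam))) := by
          rw [show (2 : ℝ≥0∞) = ENNReal.ofReal 2 by simp, ← ENNReal.ofReal_mul (by norm_num)]
          congr 1
          ring
  obtain ⟨s, hs, hfs⟩ : ∃ s ∈ Ioo (r / 4) (r / 2), f s < ENNReal.ofReal (r / (32 * lam)) := by
    by_contra! hcon
    refine hint.not_ge ?_
    calc ENNReal.ofReal (8 * (r ^ 2 / (1024 * lam)))
        = ENNReal.ofReal (r / (32 * lam)) * volume (Ioo (r / 4) (r / 2)) := by
          rw [Real.volume_Ioo, ← ENNReal.ofReal_mul (by positivity)]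
          congr 1
          field_simp
          ring
      _ = ∫⁻ s in Ioo (r / 4) (r / 2), ENNReal.ofReal (r / (32 * lam)) := by
          rw [setLIntegral_const]
      _ ≤ _ := setLIntegral_mono' measurableSet_Ioo hcon
  have hsph : sphere p s ⊆ ⋃ n, ball (c n) (d n) := fun z hz => hcov <| by
    rw [mem_sphere] at hz
    rw [mem_ball, hz]
    linarith [hs.2]
  obtain ⟨T, hT⟩ := (isCompact_sphere p s).elim_finite_subcover _ (fun n => isOpen_ball) hsph
  set T' := T.filter fun n => s ∈ Ioo (dist p (c n) - d n) (dist p (c n) + d n) with hT'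
  have hsumT : ∑ n ∈ T', d n < r / (32 * lam) := by
    have h1 : ENNReal.ofReal (∑ n ∈ T', d n) ≤ f s := by
      rw [ENNReal.ofReal_sum_of_nonneg fun n _ => hd n]
      refine le_trans (Finset.sum_le_sum fun n hn => ?_) (ENNReal.sum_le_tsum T')
      rw [indicator_of_mem (Finset.mem_filter.1 hn).2]
      simp
    exact (ENNReal.ofReal_lt_ofReal_iff (by positivity)).1 (h1.trans_lt hfs)
  have hdT : ∀ n ∈ T', d n < r / 32 := fun n hn => by
    refine ((Finset.single_le_sum (fun n _ => hd n) hn).trans_lt hsumT).trans_le ?_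
    exact div_le_div_of_nonneg_left hr.le (by norm_num) (by linarith)
  obtain ⟨K, hK, hpK, hqK, hdisj⟩ := notSep_of_sum_diam_lt (x := p) (y := q)
    (D := r / (8 * lam)) hlam hllc (T'.toList.map fun n => closedBall (c n) (d n))
    (fun A hA => by
      obtain ⟨n, -, rfl⟩ := List.mem_map.1 hA
      exact isClosed_closedBall)
    (by
      have h1 : ((T'.toList.map fun n => closedBall (c n) (d n)).map diam).sum =
          ∑ n ∈ T', diam (closedBall (c n) (d n)) := by
        rw [List.map_map, ← Finset.sum_map_toList]
        rfl
      rw [h1]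
      calc ∑ n ∈ T', diam (closedBall (c n) (d n)) ≤ ∑ n ∈ T', 2 * d n :=
            Finset.sum_le_sum fun n _ => diam_closedBall (hd n)
        _ = 2 * ∑ n ∈ T', d n := by rw [Finset.mul_sum]
        _ < 2 * (r / (32 * lam)) := by linarith
        _ ≤ r / (8 * lam) := by
          rw [show 2 * (r / (32 * lam)) = r / (8 * lam) / 2 by field_simp; ring]
          exact half_le_self (by positivity))
    (fun A hA z hz => by
      obtain ⟨n, hn, rfl⟩ := List.mem_map.1 hA
      have hn' := Finset.mem_toList.1 hn
      have h1 := (Finset.mem_filter.1 hn').2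
      have h2 := hdT n hn'
      rw [mem_closedBall] at hz
      have h3 := dist_triangle p z (c n)
      have h4 := dist_triangle p z q
      have h5 := dist_triangle p (c n) z
      rw [dist_comm (c n) z] at h5
      rw [dist_comm q z]
      have h6 : lam * (r / (8 * lam)) = r / 8 := by field_simp
      rw [h6]
      constructor <;> linarith [h1.1, h1.2, hs.1, hs.2])
  obtain ⟨z, hz, hzs⟩ := hK.intermediate_value hpK hqK
    (f := fun z => dist p z) (by fun_prop)
    (show s ∈ Icc (dist p p) (dist p q) by
      rw [dist_self]
      constructor <;> linarith [hs.1, hs.2])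
  simp only at hzs
  have hzT := hT (show z ∈ sphere p s by rw [mem_sphere, dist_comm]; exact hzs)
  simp only [mem_iUnion] at hzT
  obtain ⟨n, hn, hzn⟩ := hzT
  refine Set.disjoint_left.1 hdisj hz ⟨_, List.mem_map_of_mem (Finset.mem_toList.2
    (Finset.mem_filter.2 ⟨hn, ?_⟩)), ball_subset_closedBall hzn⟩
  rw [mem_ball] at hzn
  have h3 := dist_triangle p z (c n)
  have h5 := dist_triangle p (c n) z
  rw [dist_comm (c n) z] at h5
  constructor <;> linarith

/-- Separated sets have quadratically bounded cardinality. -/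
lemma exists_card_le [Nontrivial X] {lam : ℝ} (hlam : 1 ≤ lam) (hllc : LLC₂ X lam) {L : ℝ}
    (hL : 0 < L)
    (hmass : ∀ (x : X) (r : ℝ), 0 < r → μH[2] (ball x r) ≤ ENNReal.ofReal (L * r ^ 2)) :
    ∃ N₀ > (0:ℝ), ∃ ε₀ > (0:ℝ), ∀ ε, 0 < ε → ε ≤ ε₀ → ∀ (z : X) (r : ℝ), 0 ≤ r →
      ∀ T : Finset X, (∀ x ∈ T, ∀ y ∈ T, x ≠ y → ε ≤ dist x y) → (∀ x ∈ T, dist x z ≤ r) →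
      (T.card : ℝ) ≤ N₀ * ((r + ε) / ε) ^ 2 := by
  obtain ⟨r₁, hr₁, hfar⟩ := exists_far (X := X)
  have hlam0 : 0 < lam := by linarith
  refine ⟨4096 * lam * L, by positivity, r₁, hr₁, fun ε hε hε₁ z r hr T hsep hT => ?_⟩
  have h1 : ∑ x ∈ T, μH[2] (ball x (ε / 2)) ≤ μH[2] (ball z (r + ε)) := by
    rw [← measure_biUnion_finset (fun x hx y hy hxy => ?_) fun x _ => measurableSet_ball]
    · refine measure_mono (iUnion₂_subset fun x hx => ball_subset_ball' ?_)
      have := hT x hx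
      linarith
    · refine ball_disjoint_ball ?_
      linarith [hsep x hx y hy hxy]
  have h2 : ∑ x ∈ T, ENNReal.ofReal ((ε / 2) ^ 2 / (1024 * lam)) ≤
      ENNReal.ofReal (L * (r + ε) ^ 2) :=
    (Finset.sum_le_sum fun x _ => by
      obtain ⟨q, hq⟩ := hfar x
      exact le_hausdorffMeasure_ball hlam hllc (half_pos hε)
        (by linarith : ε / 2 ≤ dist x q)).trans (h1.trans (hmass z _ (by linarith)))
  rw [← ENNReal.ofReal_sum_of_nonneg fun _ _ => by positivity,
    ENNReal.ofReal_le_ofReal_iff (by positivity), Finset.sum_const, nsmul_eq_mul] at h2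
  rw [div_pow, ← mul_div_assoc, le_div_iff₀ (by positivity)]
  have h3 : (T.card : ℝ) * ((ε / 2) ^ 2 / (1024 * lam)) = T.card * ε ^ 2 / (4096 * lam) := by
    field_simp
    ring
  rw [h3, div_le_iff₀ (by positivity)] at h2
  linarith

end Mass

/-! ### Partitions of graphs into connected pieces of controlled size -/

section Owner

variable {α I : Type*} {adj : α → α → Prop}

/-- A connected set carries a spanning tree rooted at any of its points. -/
lemma AdjConn.exists_parent (hrefl : ∀ i, adj i i) (hsymm : ∀ i j, adj i j → adj j i) {C : Set α}
    (hC : AdjConn adj C) {x : α} (hx : x ∈ C) :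
    ∃ (rk : α → ℕ) (p : α → α), ∀ v ∈ C, v ≠ x → p v ∈ C ∧ adj v (p v) ∧ rk (p v) < rk v := by
  classical
  let Q : α → ℕ → Prop := fun v m => ∃ P : ℕ → α, P 0 = x ∧ P m = v ∧ (∀ k, P k ∈ C) ∧
    ∀ k, adj (P k) (P (k + 1))
  have hQ : ∀ v ∈ C, ∃ m, Q v m := fun v hv => by
    obtain ⟨P, m, h0, hm, h1, h2⟩ := hC.exists_path hrefl hx hv
    exact ⟨m, P, h0, hm, h1, h2⟩
  let rk : α → ℕ := fun v => if h : ∃ m, Q v m then Nat.find h else 0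
  have key : ∀ v, ∃ w, v ∈ C → v ≠ x → w ∈ C ∧ adj v w ∧ rk w < rk v := fun v => by
    by_cases hv : v ∈ C ∧ v ≠ x
    · have hrk : rk v = Nat.find (hQ v hv.1) := dif_pos (hQ v hv.1)
      obtain ⟨P, h0, hm, h1, h2⟩ := Nat.find_spec (hQ v hv.1)
      rw [← hrk] at hm
      obtain ⟨m, hm'⟩ : ∃ m, rk v = m + 1 := Nat.exists_eq_succ_of_ne_zero fun h => by
        rw [h] at hm
        exact hv.2 (hm.symm.trans h0)
      refine ⟨P m, fun _ _ => ⟨h1 m, hsymm _ _ ?_, ?_⟩⟩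
      · rw [← hm, hm']
        exact h2 m
      · have hw : ∃ m, Q (P m) m := ⟨m, P, h0, rfl, h1, h2⟩
        have hw' : ∃ k, Q (P m) k := ⟨m, P, h0, rfl, h1, h2⟩
        have : rk (P m) = Nat.find hw' := dif_pos hw'
        rw [this, hm', Nat.lt_succ_iff]
        exact Nat.find_le ⟨P, h0, rfl, h1, h2⟩
    · exact ⟨v, fun h h' => absurd ⟨h, h'⟩ hv⟩
  choose p hp using key
  exact ⟨rk, p, hp⟩

/-- A cover by connected sets such that sets of the same colour are disjoint can be refined to a
partition into connected sets whose size is controlled by the number of colours. -/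
lemma exists_owner [Nonempty I] {X : Type*} [MetricSpace X] (hrefl : ∀ i, adj i i)
    (hsymm : ∀ i j, adj i j → adj j i) {B : Set α} {G : I → Set α} {x : I → α}
    (hx : ∀ j, x j ∈ G j) (hG : ∀ j, AdjConn adj (G j)) (hGB : ∀ j, G j ⊆ B)
    (hB : ∀ v ∈ B, ∃ j, v ∈ G j) {c : I → ℕ} {M : ℕ} (hcM : ∀ j, c j ≤ M)
    (hc : ∀ j k, c j = c k → (G j ∩ G k).Nonempty → j = k) {f : α → X} {s : ℝ} (hs : 0 ≤ s)
    (hf : ∀ j, ∀ v ∈ G j, dist (f v) (f (x j)) ≤ s) :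
    ∃ o : α → I, (∀ i, AdjConn adj {v | v ∈ B ∧ o v = i}) ∧
      ∀ v ∈ B, dist (f v) (f (x (o v))) ≤ s * (2 * M + 1) := by
  classical
  have hj : ∀ v, ∃ j, v ∈ B → v ∈ G j ∧ ∀ k, v ∈ G k → c j ≤ c k := fun v => by
    by_cases hv : v ∈ B
    · have hne : {j | v ∈ G j}.Nonempty := hB v hv
      exact ⟨Function.argminOn c {j | v ∈ G j} hne, fun _ =>
        ⟨Function.argminOn_mem c _ hne, fun k hk => Function.argminOn_le c _ hk⟩⟩
    · exact ⟨Classical.arbitrary I, fun h => absurd h hv⟩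
  choose j hj using hj
  choose rk p hp using fun k => (hG k).exists_parent hrefl hsymm (hx k)
  let R : α → α → Prop := InvImage (Prod.Lex (· < ·) (· < ·)) fun v => (c (j v), rk (j v) v)
  have hwf : WellFounded R := InvImage.wf _ (WellFounded.prod_lex wellFounded_lt wellFounded_lt)
  have hpar : ∀ v, v ∈ B ∧ v ≠ x (j v) → p (j v) v ∈ B ∧ adj v (p (j v) v) ∧
      R (p (j v) v) v ∧ (j (p (j v) v) = j v ∨ c (j (p (j v) v)) < c (j v)) ∧
      p (j v) v ∈ G (j v) := by
    rintro v ⟨hv, hne⟩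
    obtain ⟨h1, h2, h3⟩ := hp (j v) v (hj v hv).1 hne
    have hwB := hGB _ h1
    obtain ⟨h4, h5⟩ := hj _ hwB
    have h6 := h5 _ h1
    rcases h6.lt_or_eq with h | h
    · exact ⟨hwB, h2, Prod.Lex.left _ _ h, Or.inr h, h1⟩
    · have h7 := hc _ _ h ⟨_, h4, h1⟩
      refine ⟨hwB, h2, ?_, Or.inl h7, h1⟩
      change Prod.Lex _ _ (c (j (p (j v) v)), rk (j (p (j v) v)) (p (j v) v)) (c (j v), rk (j v) v)
      rw [h7]
      exact Prod.Lex.right _ h3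
  obtain ⟨o, ho⟩ : ∃ o : α → I, ∀ v, o v = if v ∈ B ∧ v ≠ x (j v) then o (p (j v) v) else j v := by
    refine ⟨hwf.fix fun v ih => if h : v ∈ B ∧ v ≠ x (j v) then ih (p (j v) v) (hpar v h).2.2.1
      else j v, fun v => ?_⟩
    rw [hwf.fix_eq]
    split_ifs <;> rfl
  refine ⟨o, fun i D hD hcl => ?_, ?_⟩
  · have key : ∀ v, v ∈ B → o v = i → (v ∈ D ↔ x i ∈ D) := by
      intro v
      induction v using hwf.induction with
      | _ v ih =>
        intro hv hvi
        have h := ho v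
        by_cases hne : v = x (j v)
        · rw [if_neg (by tauto)] at h
          rw [← hvi, h, ← hne]
        · rw [if_pos ⟨hv, hne⟩] at h
          obtain ⟨h1, h2, h3, -⟩ := hpar v ⟨hv, hne⟩
          rw [← ih _ h3 h1 (h.symm.trans hvi)]
          exact ⟨fun h' => hcl v ⟨hv, hvi⟩ h' _ ⟨h1, h.symm.trans hvi⟩ h2,
            fun h' => hcl _ ⟨h1, h.symm.trans hvi⟩ h' v ⟨hv, hvi⟩ (hsymm _ _ h2)⟩
    obtain ⟨v, ⟨hv, hvi⟩, hvD⟩ := hD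
    rintro w ⟨hw, hwi⟩
    exact (key w hw hwi).2 ((key v hv hvi).1 hvD)
  · have key : ∀ v, v ∈ B → dist (f (x (j v))) (f (x (o v))) ≤ 2 * s * c (j v) := by
      intro v
      induction v using hwf.induction with
      | _ v ih =>
        intro hv
        have h := ho v
        by_cases hne : v = x (j v)
        · rw [if_neg (by tauto)] at h
          rw [h, dist_self]
          positivity
        · rw [if_pos ⟨hv, hne⟩] at h
          obtain ⟨h1, h2, h3, h4, h5⟩ := hpar v ⟨hv, hne⟩
          have h6 := ih _ h3 h1
          rw [h]
          rcases h4 with h4 | h4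
          · rwa [h4] at h6
          · have h7 := hf _ _ h5
            have h8 := hf _ _ (hj _ h1).1
            have h9 := dist_triangle_left (f (x (j v))) (f (x (j (p (j v) v)))) (f (p (j v) v))
            have h10 := dist_triangle (f (x (j v))) (f (x (j (p (j v) v))))
              (f (x (o (p (j v) v))))
            have h11 : (c (j (p (j v) v)) : ℝ) + 1 ≤ c (j v) := by exact_mod_cast h4
            nlinarith
    intro v hv
    have h1 := key v hv
    have h2 := hf _ _ (hj v hv).1
    have h3 := dist_triangle (f v) (f (x (j v))) (f (x (o v)))
    have h4 : (c (j v) : ℝ) ≤ M := by exact_mod_cast hcM _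
    nlinarith

/-- Greedy colouring. -/
lemma exists_coloring [Fintype I] (r : I → I → Prop) (hr : ∀ i j, r i j → r j i) (M : ℕ)
    (hM : ∀ i, {j | r i j}.ncard ≤ M) :
    ∃ c : I → ℕ, (∀ i, c i ≤ M) ∧ ∀ i j, c i = c j → r i j → i = j := by
  classical
  suffices h : ∀ S : Finset I, ∃ c : I → ℕ, (∀ i, c i ≤ M) ∧
      ∀ i ∈ S, ∀ j ∈ S, c i = c j → r i j → i = j by
    obtain ⟨c, h1, h2⟩ := h Finset.univ
    exact ⟨c, h1, fun i j => h2 i (Finset.mem_univ _) j (Finset.mem_univ _)⟩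
  intro S
  induction S using Finset.induction_on with
  | empty => exact ⟨fun _ => 0, fun _ => Nat.zero_le _, by simp⟩
  | insert a S ha ih =>
    obtain ⟨c, h1, h2⟩ := ih
    obtain ⟨m, hm, hm'⟩ : ∃ m ∈ Finset.range (M + 1), m ∉ (Finset.univ.filter (r a)).image c := by
      by_contra! h
      have h3 := Finset.card_le_card (show Finset.range (M + 1) ⊆ _ from h)
      have h4 := h3.trans Finset.card_image_le
      have h5 := hM a
      rw [Set.ncard_eq_toFinset_card'] at h5
      rw [Finset.card_range] at h4
      have h6 : (Finset.univ.filter (r a)).card = (Set.toFinset {j | r a j}).card := by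
        congr 1
        ext j
        simp
      omega
    have hm2 : ∀ j, r a j → c j ≠ m := fun j hj hjm =>
      hm' (Finset.mem_image.2 ⟨j, by simpa using hj, hjm⟩)
    refine ⟨Function.update c a m, fun i => ?_, fun i hi j hj hij hrij => ?_⟩
    · by_cases h : i = a
      · subst h
        rw [Function.update_self]
        exact Nat.lt_succ_iff.1 (Finset.mem_range.1 hm)
      · rw [Function.update_of_ne h]
        exact h1 i
    · by_cases h : i = a <;> by_cases h' : j = a
      · rw [h, h']
      · subst h
        rw [Function.update_self, Function.update_of_ne h'] at hij
        exact absurd hij.symm (hm2 j hrij)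
      · subst h'
        rw [Function.update_self, Function.update_of_ne h] at hij
        exact absurd hij (hm2 i (hr _ _ hrij))
      · rw [Function.update_of_ne h, Function.update_of_ne h'] at hij
        exact h2 i (Finset.mem_of_mem_insert_of_ne hi h) j
          (Finset.mem_of_mem_insert_of_ne hj h') hij hrij

end Owner

section OwnerGraph

variable {I : Type*}

lemma adjConn_linkedTo {α : Type*} {adj : α → α → Prop} (S : Set α) (x : α) :
    AdjConn adj (linkedTo adj S {x}) := by
  have key : ∀ C ⊆ S, AdjConn adj C → x ∈ C → C ⊆ linkedTo adj S {x} := fun C hCS hC hx v hv =>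
    ⟨C, hCS, hC, hv, x, hx, rfl⟩
  rintro D ⟨v, ⟨C, hCS, hC, hv, y, hy, rfl⟩, hvD⟩ hcl w ⟨C', hCS', hC', hw, y', hy', rfl⟩
  have h1 := key C hCS hC hy
  have h2 := key C' hCS' hC' hy'
  have hxD : y' ∈ D := hC D ⟨v, hv, hvD⟩ (fun i hi hiD j hj => hcl i (h1 hi) hiD j (h1 hj)) hy
  exact hC' D ⟨y', hy', hxD⟩ (fun i hi hiD j hj => hcl i (h2 hi) hiD j (h2 hj)) hw

/-- Adjacency of the pieces of a partition of a grid. -/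
def ownerAdj (N : ℕ) (o : ℤ × ℤ → I) (i k : I) : Prop :=
  ∃ v ∈ gridBox N, ∃ w ∈ gridBox N, o v = i ∧ o w = k ∧ hexAdj v w

lemma adjConn_image {N : ℕ} {o : ℤ × ℤ → I} {C : Set (ℤ × ℤ)} (hC : AdjConn hexAdj C)
    (hCN : C ⊆ gridBox N) : AdjConn (ownerAdj N o) (o '' C) := by
  rintro D ⟨_, ⟨v, hv, rfl⟩, hvD⟩ hcl
  have := hC (o ⁻¹' D) ⟨v, hv, hvD⟩ fun i hi hiD j hj hij =>
    hcl (o i) ⟨i, hi, rfl⟩ hiD (o j) ⟨j, hj, rfl⟩ ⟨i, hCN hi, j, hCN hj, rfl, rfl, hij⟩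
  rintro _ ⟨w, hw, rfl⟩
  exact this hw

lemma adjConn_preimage {N : ℕ} {o : ℤ × ℤ → I}
    (ho : ∀ i, AdjConn hexAdj {v | v ∈ gridBox N ∧ o v = i}) {C : Set I}
    (hC : AdjConn (ownerAdj N o) C) : AdjConn hexAdj {v | v ∈ gridBox N ∧ o v ∈ C} := by
  rintro D ⟨v, ⟨hv, hvC⟩, hvD⟩ hcl
  have hfib : ∀ v ∈ gridBox N, o v ∈ C → v ∈ D → ∀ w ∈ gridBox N, o w = o v → w ∈ D := by
    intro v hv hvC hvD w hw hwv
    refine ho (o v) D ⟨v, ⟨hv, rfl⟩, hvD⟩ (fun i hi hiD j hj => hcl i ⟨hi.1, ?_⟩ hiD j ⟨hj.1, ?_⟩)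
      ⟨hw, hwv⟩
    · rw [hi.2]; exact hvC
    · rw [hj.2]; exact hvC
  have h := hC {i | ∀ w ∈ gridBox N, o w = i → w ∈ D} ⟨o v, hvC, hfib v hv hvC hvD⟩ (by
    rintro i hi hiD j hj ⟨v', hv', w', hw', rfl, rfl, hvw⟩ u hu huw
    exact hfib w' hw' hj (hcl v' ⟨hv', hi⟩ (hiD v' hv' rfl) w' ⟨hw', hj⟩ hvw) u hu huw)
  rintro w ⟨hw, hwC⟩
  exact h hwC w hw rfl

/-- The graph formed by the pieces of a partition of a grid into connected sets. -/
def ownerGraph (N : ℕ) (o : ℤ × ℤ → I)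
    (ho : ∀ i, AdjConn hexAdj {v | v ∈ gridBox N ∧ o v = i}) : HexGraph I where
  adj := ownerAdj N o
  symm i j := fun ⟨v, hv, w, hw, h1, h2, h3⟩ => ⟨w, hw, v, hv, h2, h1, hexAdj_symm _ _ h3⟩
  Lf := o '' {v | v ∈ gridBox N ∧ v.1 = 0}
  Rt := o '' {v | v ∈ gridBox N ∧ v.1 = N}
  Bt := o '' {v | v ∈ gridBox N ∧ v.2 = 0}
  Tp := o '' {v | v ∈ gridBox N ∧ v.2 = N}
  hex W := by
    rcases hex_exists N (o ⁻¹' W) with ⟨C, hCW, hC, ⟨v, hv, hv0⟩, w, hw, hwN⟩ |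
      ⟨C, hCW, hC, ⟨v, hv, hv0⟩, w, hw, hwN⟩
    · refine Or.inl ⟨o '' C, ?_, adjConn_image hC fun v hv => (hCW hv).2,
        ⟨o v, ⟨v, hv, rfl⟩, v, ⟨(hCW hv).2, hv0⟩, rfl⟩,
        o w, ⟨w, hw, rfl⟩, w, ⟨(hCW hw).2, hwN⟩, rfl⟩
      rintro _ ⟨u, hu, rfl⟩
      exact (hCW hu).1
    · refine Or.inr ⟨o '' C, ?_, adjConn_image hC fun v hv => (hCW hv).1,
        ⟨o v, ⟨v, hv, rfl⟩, v, ⟨(hCW hv).1, hv0⟩, rfl⟩,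
        o w, ⟨w, hw, rfl⟩, w, ⟨(hCW hw).1, hwN⟩, rfl⟩
      rintro _ ⟨u, hu, rfl⟩
      exact (hCW hu).2
  cross C C' hC hC' := by
    rintro ⟨_, hl, v₁, ⟨h1, h1'⟩, rfl⟩ ⟨_, hr, v₂, ⟨h2, h2'⟩, rfl⟩ ⟨_, hb, v₃, ⟨h3, h3'⟩, rfl⟩
      ⟨_, ht, v₄, ⟨h4, h4'⟩, rfl⟩
    obtain ⟨v, ⟨-, hv⟩, -, hv'⟩ := hex_cross (adjConn_preimage ho hC) (adjConn_preimage ho hC')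
      (fun v hv => hv.1) (fun v hv => hv.1) ⟨v₁, ⟨h1, hl⟩, h1'⟩ ⟨v₂, ⟨h2, hr⟩, h2'⟩
      ⟨v₃, ⟨h3, hb⟩, h3'⟩ ⟨v₄, ⟨h4, ht⟩, h4'⟩
    exact ⟨o v, hv, hv'⟩

end OwnerGraph

/-- A parametrisation of `X` by the unit square. -/
structure SquareChart (X : Type*) [TopologicalSpace X] where
  ψ : ℝ × ℝ → X
  κ : X → ℝ × ℝ
  cont : ContinuousOn ψ (Icc 0 1)
  cont_inv : Continuous κ
  mem : ∀ p, κ p ∈ Icc (0 : ℝ × ℝ) 1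
  left_inv : ∀ p, ψ (κ p) = p
  right_inv : ∀ q ∈ Icc (0 : ℝ × ℝ) 1, κ (ψ q) = q

namespace SquareChart

section Top

variable {X : Type*} [TopologicalSpace X] (χ : SquareChart X)

/-- The lattice points near the image of a set under the inverse chart, rescaled by `N`. -/
def gridNear (N : ℕ) (K : Set X) : Set (ℤ × ℤ) :=
  {v | ∃ p ∈ K, |(v.1 : ℝ) - N * (χ.κ p).1| < 1 ∧ |(v.2 : ℝ) - N * (χ.κ p).2| < 1}

/-- The image of a lattice point. -/
def gridPt (N : ℕ) (v : ℤ × ℤ) : X := χ.ψ ((v.1 : ℝ) / N, (v.2 : ℝ) / N)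

/-- The lattice point below a point. -/
def gridFloor (N : ℕ) (p : X) : ℤ × ℤ := (⌊N * (χ.κ p).1⌋, ⌊N * (χ.κ p).2⌋)

lemma gridFloor_mem {N : ℕ} {K : Set X} {p : X} (hp : p ∈ K) :
    χ.gridFloor N p ∈ χ.gridNear N K := by
  refine ⟨p, hp, ?_, ?_⟩ <;> rw [abs_sub_comm] <;>
    exact (abs_of_nonneg (Int.fract_nonneg _)).trans_lt (Int.fract_lt_one _)

lemma gridNear_subset (N : ℕ) (K : Set X) : χ.gridNear N K ⊆ gridBox N := by
  rintro v ⟨p, -, h1, h2⟩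
  obtain ⟨⟨h3, h4⟩, h5, h6⟩ := χ.mem p
  simp only [Prod.fst_zero, Prod.snd_zero, Prod.fst_one, Prod.snd_one] at h3 h4 h5 h6
  rw [abs_lt] at h1 h2
  have hN : (0:ℝ) ≤ N := Nat.cast_nonneg N
  have h7 : (N:ℝ) * (χ.κ p).1 ≤ N := mul_le_of_le_one_right hN h5
  have h8 : (N:ℝ) * (χ.κ p).2 ≤ N := mul_le_of_le_one_right hN h6
  have h9 : 0 ≤ (N:ℝ) * (χ.κ p).1 := mul_nonneg hN h3
  have h10 : 0 ≤ (N:ℝ) * (χ.κ p).2 := mul_nonneg hN h4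
  refine ⟨⟨?_, ?_⟩, ?_, ?_⟩
  · have : (-1:ℝ) < v.1 := by linarith
    have : (-1:ℤ) < v.1 := by exact_mod_cast this
    omega
  · have : (v.1:ℝ) < N + 1 := by linarith
    have : (v.1:ℤ) < N + 1 := by exact_mod_cast this
    omega
  · have : (-1:ℝ) < v.2 := by linarith
    have : (-1:ℤ) < v.2 := by exact_mod_cast this
    omega
  · have : (v.2:ℝ) < N + 1 := by linarith
    have : (v.2:ℤ) < N + 1 := by exact_mod_cast this
    omega

lemma gridNear_conn (N : ℕ) {K : Set X} (hK : IsPreconnected K) :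
    AdjConn hexAdj (χ.gridNear N K) := by
  rintro D ⟨v, ⟨p, hp, hvp⟩, hvD⟩ hcl
  by_contra hnot
  obtain ⟨w, ⟨q, hq, hwq⟩, hwD⟩ := not_subset.1 hnot
  let O : Set (ℤ × ℤ) → Set X := fun A => ⋃ v ∈ A,
    {p | |(v.1 : ℝ) - N * (χ.κ p).1| < 1 ∧ |(v.2 : ℝ) - N * (χ.κ p).2| < 1}
  have hO : ∀ A, IsOpen (O A) := fun A => by
    refine isOpen_biUnion fun v _ => ?_
    have h1 := χ.cont_inv.fst
    have h2 := χ.cont_inv.snd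
    exact (isOpen_lt ((continuous_const.sub (continuous_const.mul h1)).abs)
      continuous_const).inter (isOpen_lt ((continuous_const.sub (continuous_const.mul h2)).abs)
      continuous_const)
  have hmem : ∀ A p, p ∈ O A ↔ ∃ v ∈ A, |(v.1 : ℝ) - N * (χ.κ p).1| < 1 ∧
      |(v.2 : ℝ) - N * (χ.κ p).2| < 1 := fun A p => by
    simp only [O, mem_iUnion₂, mem_ofPred_eq, exists_prop]
  obtain ⟨s, hs, hsD, hsD'⟩ := hK (O D) (O Dᶜ) (hO _) (hO _) (fun s hs => by
    obtain ⟨s', hs', h⟩ := χ.gridFloor_mem (N := N) (mem_singleton s)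
    rw [mem_singleton_iff.1 hs'] at h
    by_cases hD : χ.gridFloor N s ∈ D
    · exact Or.inl ((hmem _ _).2 ⟨_, hD, h⟩)
    · exact Or.inr ((hmem _ _).2 ⟨_, hD, h⟩)) ⟨p, hp, (hmem _ _).2 ⟨v, hvD, hvp⟩⟩
      ⟨q, hq, (hmem _ _).2 ⟨w, hwD, hwq⟩⟩
  obtain ⟨v', hv', h1, h2⟩ := (hmem _ _).1 hsD
  obtain ⟨w', hw', h3, h4⟩ := (hmem _ _).1 hsD'
  have hd : ∀ (a b : ℤ) (t : ℝ), |(a:ℝ) - t| < 1 → |(b:ℝ) - t| < 1 → -1 ≤ b - a ∧ b - a ≤ 1 := by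
    intro a b t ha hb
    rw [abs_lt] at ha hb
    have h1 : (a:ℝ) < b + 2 := by linarith
    have h2 : (b:ℝ) < a + 2 := by linarith
    have h3 : a < b + 2 := by exact_mod_cast h1
    have h4 : b < a + 2 := by exact_mod_cast h2
    omega
  have h5 := hd _ _ _ h1 h3
  have h6 := hd _ _ _ h2 h4
  have h7 := hcl v' ⟨s, hs, h1, h2⟩ hv' (v'.1, w'.2) ⟨s, hs, h1, h4⟩ (by
    unfold hexAdj
    dsimp only
    omega)
  exact hw' (hcl (v'.1, w'.2) ⟨s, hs, h1, h4⟩ h7 w' ⟨s, hs, h3, h4⟩ (by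
    unfold hexAdj
    dsimp only
    omega))

lemma div_mem {N : ℕ} (hN : 0 < N) {v : ℤ × ℤ} (hv : v ∈ gridBox N) :
    ((v.1 : ℝ) / N, (v.2 : ℝ) / N) ∈ Icc (0 : ℝ × ℝ) 1 := by
  obtain ⟨⟨h1, h2⟩, h3, h4⟩ := hv
  have hN' : (0:ℝ) < N := by exact_mod_cast hN
  have h1' : (0:ℝ) ≤ v.1 := by exact_mod_cast h1
  have h2' : (v.1:ℝ) ≤ N := by exact_mod_cast h2
  have h3' : (0:ℝ) ≤ v.2 := by exact_mod_cast h3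
  have h4' : (v.2:ℝ) ≤ N := by exact_mod_cast h4
  exact ⟨⟨div_nonneg h1' hN'.le, div_nonneg h3' hN'.le⟩, (div_le_one hN').2 h2',
    (div_le_one hN').2 h4'⟩

lemma κ_gridPt {N : ℕ} (hN : 0 < N) {v : ℤ × ℤ} (hv : v ∈ gridBox N) :
    χ.κ (χ.gridPt N v) = ((v.1 : ℝ) / N, (v.2 : ℝ) / N) := χ.right_inv _ (div_mem hN hv)

lemma mem_gridNear_gridPt {N : ℕ} (hN : 0 < N) {v : ℤ × ℤ} (hv : v ∈ gridBox N) {K : Set X}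
    (hK : χ.gridPt N v ∈ K) : v ∈ χ.gridNear N K := by
  have hN' : (N:ℝ) ≠ 0 := by exact_mod_cast hN.ne'
  refine ⟨_, hK, ?_, ?_⟩ <;> rw [χ.κ_gridPt hN hv] <;> simp [mul_div_cancel₀ _ hN']

end Top

variable {X : Type*} [MetricSpace X] (χ : SquareChart X)

lemma exists_grid {δ : ℝ} (hδ : 0 < δ) :
    ∃ N : ℕ, 0 < N ∧ (∀ v ∈ gridBox N, ∀ w ∈ gridBox N, hexAdj v w →
      dist (χ.gridPt N v) (χ.gridPt N w) ≤ δ) ∧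
      ∀ K : Set X, ∀ v ∈ χ.gridNear N K, ∃ p ∈ K, dist (χ.gridPt N v) p ≤ δ := by
  have huc : UniformContinuousOn χ.ψ (Icc 0 1) :=
    isCompact_Icc.uniformContinuousOn_of_continuous χ.cont
  obtain ⟨τ, hτ, h⟩ := Metric.uniformContinuousOn_iff.1 huc δ hδ
  obtain ⟨N, hN⟩ := exists_nat_gt (2 / τ)
  have hN0 : (0:ℝ) < N := (div_pos two_pos hτ).trans hN
  have hN1 : 0 < N := by exact_mod_cast hN0
  have hNτ : 2 / N < τ := by
    rw [div_lt_iff₀ hτ] at hN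
    rw [div_lt_iff₀ hN0]
    linarith
  have key : ∀ a b : ℝ, |a - N * b| ≤ 1 → |a / N - b| < τ := fun a b hab => by
    have : a / N - b = (a - N * b) / N := by field_simp
    rw [this, abs_div, abs_of_pos hN0]
    refine lt_of_le_of_lt ?_ hNτ
    gcongr
    linarith
  refine ⟨N, hN1, fun v hv w hw hvw => ?_, ?_⟩
  · refine (h _ (div_mem hN1 hv) _ (div_mem hN1 hw) ?_).le
    obtain ⟨⟨h1, h2⟩, ⟨h3, h4⟩, -⟩ := hvw
    rw [Prod.dist_eq, max_lt_iff, Real.dist_eq, Real.dist_eq]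
    have h1' : (-1:ℝ) ≤ w.1 - v.1 := by exact_mod_cast h1
    have h2' : (w.1 - v.1 : ℝ) ≤ 1 := by exact_mod_cast h2
    have h3' : (-1:ℝ) ≤ w.2 - v.2 := by exact_mod_cast h3
    have h4' : (w.2 - v.2 : ℝ) ≤ 1 := by exact_mod_cast h4
    constructor <;> refine key _ _ ?_ <;> rw [mul_div_cancel₀ _ hN0.ne', abs_le] <;>
      constructor <;> linarith
  · rintro K v ⟨p, hp, h1, h2⟩
    have hv : v ∈ gridBox N := χ.gridNear_subset N {p} ⟨p, rfl, h1, h2⟩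
    refine ⟨p, hp, ?_⟩
    have := h _ (div_mem hN1 hv) _ (χ.mem p) (by
      rw [Prod.dist_eq, max_lt_iff, Real.dist_eq, Real.dist_eq]
      exact ⟨key _ _ h1.le, key _ _ h2.le⟩)
    rw [χ.left_inv] at this
    exact this.le

end SquareChart

section

/-- A decomposition of a topological square into finitely many connected pieces of size comparable
to `ε`, recorded by its adjacency graph. -/
structure Discretization {X : Type*} [MetricSpace X] (χ : SquareChart X) (R ε : ℝ) where
  ι : Type
  fintype : Fintype ι
  G : HexGraph ι
  pt : ι → X
  own : X → ι
  sep : ∀ i j, i ≠ j → ε ≤ dist (pt i) (pt j)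
  adj_le : ∀ i j, G.adj i j → dist (pt i) (pt j) ≤ R * ε
  own_le : ∀ p, dist (pt (own p)) p ≤ R * ε
  tiles : ∀ K : Set X, IsPreconnected K → ∃ E, AdjConn G.adj E ∧ (∀ p ∈ K, own p ∈ E) ∧
    ∀ i ∈ E, ∃ p ∈ K, dist (pt i) p ≤ R * ε
  own_surj : ∀ C, AdjConn G.adj C → (C ∩ G.Bt).Nonempty → C ⊆ range own
  own_Lf : ∀ p, (χ.κ p).1 = 0 → own p ∈ G.Lf
  own_Rt : ∀ p, (χ.κ p).1 = 1 → own p ∈ G.Rt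
  own_Bt : ∀ p, (χ.κ p).2 = 0 → own p ∈ G.Bt
  own_Tp : ∀ p, (χ.κ p).2 = 1 → own p ∈ G.Tp
  of_Lf : ∀ i ∈ G.Lf, ∃ p, (χ.κ p).1 = 0 ∧ dist (pt i) p ≤ R * ε
  of_Rt : ∀ i ∈ G.Rt, ∃ p, (χ.κ p).1 = 1 ∧ dist (pt i) p ≤ R * ε
  of_Bt : ∀ i ∈ G.Bt, ∃ p, (χ.κ p).2 = 0 ∧ dist (pt i) p ≤ R * ε
  of_Tp : ∀ i ∈ G.Tp, ∃ p, (χ.κ p).2 = 1 ∧ dist (pt i) p ≤ R * ε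

lemma exists_separated_net {α X : Type*} [MetricSpace X] {B : Set α} (hB : B.Finite) (g : α → X)
    {ε : ℝ} (hε : 0 < ε) : ∃ S : Finset α, (∀ v ∈ S, v ∈ B) ∧
      (∀ v ∈ S, ∀ w ∈ S, v ≠ w → ε ≤ dist (g v) (g w)) ∧
      ∀ v ∈ B, ∃ w ∈ S, dist (g v) (g w) < ε := by
  classical
  let P : Finset α → Prop := fun S => ∀ v ∈ S, ∀ w ∈ S, v ≠ w → ε ≤ dist (g v) (g w)
  obtain ⟨S, hS, hmax⟩ := (hB.toFinset.powerset.filter P).exists_max_image Finset.card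
    ⟨∅, by simp [P]⟩
  obtain ⟨hSB, hSε⟩ := Finset.mem_filter.1 hS
  have hSB' : ∀ v ∈ S, v ∈ B := fun v hv => by simpa using Finset.mem_powerset.1 hSB hv
  refine ⟨S, hSB', hSε, fun v hv => ?_⟩
  by_contra! h
  have hvS : v ∉ S := fun hvS => by
    have := h v hvS
    rw [dist_self] at this
    linarith
  have := hmax (insert v S) (Finset.mem_filter.2 ⟨Finset.mem_powerset.2 fun w hw => by
    rcases Finset.mem_insert.1 hw with rfl | hw
    · simpa using hv
    · simpa using hSB' w hw, fun w hw u hu hwu => by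
    rcases Finset.mem_insert.1 hw with h1 | hw <;> rcases Finset.mem_insert.1 hu with h2 | hu
    · exact absurd (h1.trans h2.symm) hwu
    · rw [h1]
      exact h u hu
    · rw [h2, dist_comm]
      exact h w hw
    · exact hSε w hw u hu hwu⟩)
  rw [Finset.card_insert_of_notMem hvS] at this
  omega

lemma finite_gridBox (N : ℕ) : (gridBox N).Finite := by
  refine ((Set.finite_Icc (0:ℤ) N).prod (Set.finite_Icc (0:ℤ) N)).subset ?_
  rintro ⟨a, b⟩ ⟨⟨h1, h2⟩, h3, h4⟩
  exact ⟨⟨h1, h2⟩, h3, h4⟩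

variable {X : Type*} [MetricSpace X]

/-- A geodesic square whose separated sets have quadratically bounded cardinality admits
discretizations of every sufficiently small scale. -/
lemma exists_discretization (hgeo : IsGeodesicSpace X) (χ : SquareChart X) {N₀ ε₀ : ℝ}
    (hcard : ∀ ε, 0 < ε → ε ≤ ε₀ → ∀ (z : X) (r : ℝ), 0 ≤ r →
      ∀ T : Finset X, (∀ x ∈ T, ∀ y ∈ T, x ≠ y → ε ≤ dist x y) → (∀ x ∈ T, dist x z ≤ r) →
      (T.card : ℝ) ≤ N₀ * ((r + ε) / ε) ^ 2) :
    ∃ R ≥ (1:ℝ), ∀ ε, 0 < ε → ε ≤ ε₀ → Nonempty (Discretization χ R ε) := by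
  classical
  let M := ⌊N₀ * 25⌋₊
  refine ⟨4 * (2 * M + 1) + 1, by simp; positivity, fun ε hε hε₀ => ?_⟩
  obtain ⟨N, hN, hadj, hnear⟩ := χ.exists_grid hε
  let g := χ.gridPt N
  obtain ⟨S, hSB, hSε, hS⟩ := exists_separated_net (finite_gridBox N) g hε
  have h00 : ((0, 0) : ℤ × ℤ) ∈ gridBox N := by simp [gridBox]
  obtain ⟨v₀, hv₀, -⟩ := hS _ h00
  have : Nonempty S := ⟨⟨v₀, hv₀⟩⟩
  let A : S → Set (ℤ × ℤ) := fun j => {v | v ∈ gridBox N ∧ dist (g v) (g j) ≤ 2 * ε}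
  let G : S → Set (ℤ × ℤ) := fun j => linkedTo hexAdj (A j) {(j : ℤ × ℤ)}
  have hGA : ∀ j, G j ⊆ A j := fun j => linkedTo_subset
  have hxG : ∀ j : S, (j : ℤ × ℤ) ∈ G j := fun j =>
    mem_linkedTo_of_mem ⟨hSB _ j.2, by rw [dist_self]; positivity⟩ rfl
  have hsepS : ∀ i j : S, i ≠ j → ε ≤ dist (g i) (g j) := fun i j hij =>
    hSε _ i.2 _ j.2 fun h => hij (Subtype.ext h)
  have hginj : Function.Injective fun j : S => g j := fun i j hij => by
    by_contra hne
    have h1 := hsepS i j hne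
    rw [show g i = g j from hij, dist_self] at h1
    linarith
  have hcover : ∀ v ∈ gridBox N, ∃ j, v ∈ G j := fun v hv => by
    obtain ⟨w, hw, hvw⟩ := hS v hv
    obtain ⟨γ, hγ⟩ := exists_geodesic_path hgeo (g v) (g w)
    refine ⟨⟨w, hw⟩, χ.gridNear N (range γ), fun u hu => ⟨χ.gridNear_subset _ _ hu, ?_⟩,
      χ.gridNear_conn N (isPreconnected_range γ.continuous),
      χ.mem_gridNear_gridPt hN hv ⟨0, γ.source⟩, w,
      χ.mem_gridNear_gridPt hN (hSB w hw) ⟨1, γ.target⟩, rfl⟩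
    obtain ⟨_, ⟨t, rfl⟩, ht⟩ := hnear _ u hu
    have h1 := hγ t
    have h2 := dist_triangle (g u) (γ t) (g w)
    have h3 : 0 ≤ dist (g v) (γ t) := dist_nonneg
    change dist (g u) (g w) ≤ 2 * ε
    linarith
  obtain ⟨c, hcM, hc⟩ := exists_coloring (fun j k : S => (G j ∩ G k).Nonempty)
    (fun j k h => by rwa [inter_comm]) M (fun j => by
      have hT := hcard ε hε hε₀ (g j) (4 * ε) (by positivity)
        ((Finset.univ.filter fun k : S => (G j ∩ G k).Nonempty).image fun k : S => g k) (by
          intro x hx y hy hxy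
          obtain ⟨i, -, rfl⟩ := Finset.mem_image.1 hx
          obtain ⟨k, -, rfl⟩ := Finset.mem_image.1 hy
          exact hsepS i k fun h => hxy (by rw [h])) (by
          intro x hx
          obtain ⟨i, hi, rfl⟩ := Finset.mem_image.1 hx
          obtain ⟨u, hu, hu'⟩ := (Finset.mem_filter.1 hi).2
          have h1 : dist (g u) (g j) ≤ 2 * ε := (hGA _ hu).2
          have h2 : dist (g u) (g i) ≤ 2 * ε := (hGA _ hu').2
          have h3 := dist_triangle_left (g i) (g j) (g u)
          linarith)
      rw [Finset.card_image_of_injective _ hginj] at hT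
      rw [show (4 * ε + ε) / ε = 5 by field_simp; norm_num] at hT
      rw [Set.ncard_eq_toFinset_card']
      refine Nat.le_floor ?_
      have h6 : (Finset.univ.filter fun k : S => (G j ∩ G k).Nonempty).card =
          (Set.toFinset {k : S | (G j ∩ G k).Nonempty}).card := by
        congr 1
        ext j
        simp
      rw [← h6]
      linarith)
  obtain ⟨o, hoconn, hod⟩ := exists_owner hexAdj_refl hexAdj_symm (B := gridBox N) hxG
    (fun j => adjConn_linkedTo _ _) (fun j v hv => (hGA j hv).1) hcover hcM hc (f := g)
    (by positivity : 0 ≤ 2 * ε) fun j v hv => (hGA j hv).2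
  have hM0 : (0:ℝ) ≤ M := Nat.cast_nonneg M
  have hfl : ∀ p, χ.gridFloor N p ∈ gridBox N := fun p =>
    χ.gridNear_subset N {p} (χ.gridFloor_mem rfl)
  have htile : ∀ K, ∀ v ∈ χ.gridNear N K, ∃ p ∈ K,
      dist (g (o v)) p ≤ (4 * (2 * M + 1) + 1) * ε := fun K v hv => by
    obtain ⟨p, hp, hpv⟩ := hnear K v hv
    have h1 := hod v (χ.gridNear_subset N K hv)
    have h2 := dist_triangle_left (g (o v)) p (g v)
    have h3 : dist (g v) p ≤ ε := hpv
    exact ⟨p, hp, by nlinarith⟩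
  have hside : ∀ v ∈ gridBox N, dist (g (o v)) (g v) ≤ (4 * (2 * M + 1) + 1) * ε := fun v hv => by
    have h1 := hod v hv
    rw [dist_comm] at h1
    nlinarith
  have hNR : (N:ℝ) ≠ 0 := by exact_mod_cast hN.ne'
  have hrange : ∀ v ∈ gridBox N, o v ∈ range fun p => o (χ.gridFloor N p) := fun v hv =>
    ⟨g v, by simp [SquareChart.gridFloor, g, χ.κ_gridPt hN hv, mul_div_cancel₀ _ hNR]⟩
  refine ⟨{
    ι := S
    fintype := inferInstance
    G := ownerGraph N o hoconn
    pt := fun j => g j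
    own := fun p => o (χ.gridFloor N p)
    sep := hsepS
    adj_le := ?_
    own_le := fun p => ?_
    tiles := fun K hK => ⟨o '' χ.gridNear N K, adjConn_image (χ.gridNear_conn N hK)
      (χ.gridNear_subset N K), fun p hp => ⟨_, χ.gridFloor_mem hp, rfl⟩, ?_⟩
    own_surj := ?_
    own_Lf := fun p hp => ⟨_, ⟨hfl p, ?_⟩, rfl⟩
    own_Rt := fun p hp => ⟨_, ⟨hfl p, ?_⟩, rfl⟩
    own_Bt := fun p hp => ⟨_, ⟨hfl p, ?_⟩, rfl⟩
    own_Tp := fun p hp => ⟨_, ⟨hfl p, ?_⟩, rfl⟩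
    of_Lf := ?_
    of_Rt := ?_
    of_Bt := ?_
    of_Tp := ?_ }⟩
  · rintro _ _ ⟨v, hv, w, hw, rfl, rfl, hvw⟩
    have h1 := hod v hv
    have h2 := hod w hw
    have h3 : dist (g v) (g w) ≤ ε := hadj v hv w hw hvw
    have h4 := dist_triangle4 (g (o v)) (g v) (g w) (g (o w))
    rw [dist_comm (g (o v)) (g v)] at h4
    nlinarith
  · obtain ⟨q, hq, h⟩ := htile {p} _ (χ.gridFloor_mem rfl)
    rwa [mem_singleton_iff.1 hq] at h
  · rintro _ ⟨v, hv, rfl⟩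
    exact htile K v hv
  · rintro C hC ⟨i, hi, v, ⟨hv, -⟩, rfl⟩
    refine hC _ ⟨_, hi, hrange v hv⟩ ?_
    rintro _ _ _ _ _ ⟨u, -, w, hw, -, rfl, -⟩
    exact hrange w hw
  · simp [SquareChart.gridFloor, hp]
  · simp [SquareChart.gridFloor, hp]
  · simp [SquareChart.gridFloor, hp]
  · simp [SquareChart.gridFloor, hp]
  all_goals
    rintro _ ⟨v, ⟨hv, hv'⟩, rfl⟩
    exact ⟨g v, by rw [χ.κ_gridPt hN hv]; simp [hv', hNR], hside v hv⟩

end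

/-- Separated sets of scale at most `ε₀` have quadratically bounded cardinality. -/
def QuadCount (X : Type*) [MetricSpace X] (N₀ ε₀ : ℝ) : Prop :=
  ∀ ε, 0 < ε → ε ≤ ε₀ → ∀ (z : X) (r : ℝ), 0 ≤ r →
    ∀ T : Finset X, (∀ x ∈ T, ∀ y ∈ T, x ≠ y → ε ≤ dist x y) → (∀ x ∈ T, dist x z ≤ r) →
    (T.card : ℝ) ≤ N₀ * ((r + ε) / ε) ^ 2

namespace Discretization

variable {X : Type*} [MetricSpace X] {χ : SquareChart X} {R ε : ℝ} (d : Discretization χ R ε)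

instance : Fintype d.ι := d.fintype

lemma card_le {N₀ ε₀ : ℝ} (hcard : QuadCount X N₀ ε₀) (hε : 0 < ε) (hε₀ : ε ≤ ε₀) {z : X} {r : ℝ}
    (hr : 0 ≤ r) {T : Finset d.ι} (hT : ∀ i ∈ T, dist (d.pt i) z ≤ r) :
    (T.card : ℝ) ≤ N₀ * ((r + ε) / ε) ^ 2 := by
  classical
  have hinj : Function.Injective d.pt := fun i j hij => by
    by_contra hne
    have := d.sep i j hne
    rw [hij, dist_self] at this
    linarith
  rw [← Finset.card_image_of_injective T hinj]
  refine hcard ε hε hε₀ z r hr _ (fun x hx y hy hxy => ?_) fun x hx => ?_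
  · obtain ⟨i, -, rfl⟩ := Finset.mem_image.1 hx
    obtain ⟨j, -, rfl⟩ := Finset.mem_image.1 hy
    exact d.sep i j fun h => hxy (by rw [h])
  · obtain ⟨i, hi, rfl⟩ := Finset.mem_image.1 hx
    exact hT i hi

open Classical in
/-- A weight supported on the pieces on which `h` is comparable to `r`. -/
def ringWt (h : X → ℝ) (r : ℝ) (i : d.ι) : ℝ :=
  if r ≤ h (d.pt i) ∧ h (d.pt i) ≤ 2 * r then 4 * (R * ε) / r else 0

lemma ringWt_nonneg (hRε : 0 ≤ R * ε) (h : X → ℝ) {r : ℝ} (hr : 0 ≤ r) (i : d.ι) :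
    0 ≤ d.ringWt h r i := by
  unfold ringWt
  split_ifs
  · positivity
  · exact le_rfl

lemma one_le_wt_ringWt {h : X → ℝ} (hh : ∀ p q, h p ≤ h q + dist p q) {r : ℝ} (hRε : 0 < R * ε)
    (hr : 4 * (R * ε) ≤ r) {C : Set d.ι} (hC : AdjConn d.G.adj C) {i j : d.ι} (hi : i ∈ C)
    (hj : j ∈ C) (hir : h (d.pt i) ≤ r) (hjr : 2 * r ≤ h (d.pt j)) : 1 ≤ wt (d.ringWt h r) C := by
  classical
  have hr0 : 0 < r := by linarith
  have hstep : ∀ k l, d.G.adj k l → h (d.pt l) ≤ h (d.pt k) + R * ε := fun k l hkl => by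
    have h1 := d.adj_le k l hkl
    have h2 := hh (d.pt l) (d.pt k)
    rw [dist_comm] at h2
    linarith
  let τ : d.ι → ℝ := fun k => if k ∈ C ∧ r ≤ h (d.pt k) ∧ h (d.pt k) ≤ 2 * r then 1 else 0
  have hτ0 : ∀ k, 0 ≤ τ k := fun k => by
    dsimp only [τ]
    split_ifs <;> norm_num
  have key := sub_le_sum_of_levels (α := r + R * ε) (β := 2 * r - R * ε) (σ := τ)
    (M := fun k => Icc (h (d.pt k) - R * ε) (h (d.pt k) + R * ε)) (m := fun _ => 2 * (R * ε))
    (F := ∅) (fun k => measurableSet_Icc) (fun _ => by positivity) (fun k => by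
      rw [Real.volume_Icc]
      exact ENNReal.ofReal_le_ofReal (by linarith)) hτ0 finite_empty (fun t h1 h2 _ => by
      obtain ⟨k, hk, hkt⟩ : ∃ k ∈ C, h (d.pt k) - R * ε ≤ t ∧ t ≤ h (d.pt k) + R * ε := by
        by_contra! hne
        have := hC {k | h (d.pt k) ≤ t} ⟨i, hi, by change h (d.pt i) ≤ t; linarith⟩ (by
          intro k hk hkt l hl hkl
          have hkt' : h (d.pt k) ≤ t := hkt
          have h3 := hne k hk (by linarith)
          have h4 := hstep k l hkl
          change h (d.pt l) ≤ t
          linarith) hj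
        have h5 : h (d.pt j) ≤ t := this
        linarith
      refine le_trans ?_ (le_wt hτ0 (i := k) hkt)
      dsimp only [τ]
      rw [if_pos ⟨hk, by linarith, by linarith⟩])
  rw [← Finset.sum_mul] at key
  have h3 : wt (d.ringWt h r) C = (∑ k, τ k) * (4 * (R * ε) / r) := by
    rw [wt, Finset.sum_mul]
    refine Finset.sum_congr rfl fun k _ => ?_
    by_cases hk : k ∈ C
    · rw [indicator_of_mem hk]
      simp [ringWt, τ, hk]
    · rw [indicator_of_notMem hk]
      simp [τ, hk]
  rw [h3, ← mul_div_assoc, le_div_iff₀ hr0]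
  linarith

/-- The total mass of the square of a ring weight is bounded by the number of pieces. -/
lemma sum_ringWt_sq_le {N₀ ε₀ : ℝ} (hcard : QuadCount X N₀ ε₀) (hε : 0 < ε) (hε₀ : ε ≤ ε₀)
    {h : X → ℝ} {r s : ℝ} {z : X} (hs : 0 ≤ s) (hsh : ∀ p, h p ≤ 2 * r → dist p z ≤ s) :
    ∑ i, d.ringWt h r i * d.ringWt h r i ≤ (4 * R / r) ^ 2 * (N₀ * (s + ε) ^ 2) := by
  classical
  let T := Finset.univ.filter fun i => r ≤ h (d.pt i) ∧ h (d.pt i) ≤ 2 * r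
  have h1 : ∑ i, d.ringWt h r i * d.ringWt h r i = T.card * (4 * (R * ε) / r) ^ 2 := by
    rw [← nsmul_eq_mul, ← Finset.sum_const, Finset.sum_filter]
    refine Finset.sum_congr rfl fun i _ => ?_
    unfold ringWt
    split_ifs <;> ring
  have h2 := d.card_le hcard hε hε₀ hs (T := T) fun i hi =>
    hsh _ (Finset.mem_filter.1 hi).2.2
  rw [h1]
  calc (T.card : ℝ) * (4 * (R * ε) / r) ^ 2
      ≤ (N₀ * ((s + ε) / ε) ^ 2) * (4 * (R * ε) / r) ^ 2 := by gcongr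
    _ = (4 * R / r) ^ 2 * (N₀ * (s + ε) ^ 2) := by
      field_simp

/-- A weight of small mass for which connected sets joining a small ball to the complement of a
large ball have weight at least one. -/
lemma exists_log_weight {N₀ ε₀ : ℝ} (hcard : QuadCount X N₀ ε₀) (hN₀ : 0 ≤ N₀) (hε : 0 < ε)
    (hε₀ : ε ≤ ε₀) (hR : 1 ≤ R) (z : X) {r : ℝ} (hr : 4 * (R * ε) ≤ r) {m : ℕ} (hm : 0 < m) :
    ∃ σ : d.ι → ℝ, (∀ i, 0 ≤ σ i) ∧ ∑ i, σ i * σ i ≤ 144 * R ^ 2 * N₀ / m ∧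
      ∀ C, AdjConn d.G.adj C → (∃ i ∈ C, dist (d.pt i) z ≤ r) →
        (∃ j ∈ C, 4 ^ m * r ≤ dist (d.pt j) z) → 1 ≤ wt σ C := by
  classical
  have hRε : 0 < R * ε := by positivity
  have hr0 : 0 < r := by linarith
  have hm0 : (0:ℝ) < m := by exact_mod_cast hm
  let h : X → ℝ := fun p => dist p z
  have hh : ∀ p q, h p ≤ h q + dist p q := fun p q => by
    have := dist_triangle p q z
    change dist p z ≤ dist q z + dist p q
    linarith
  let τ : ℕ → d.ι → ℝ := fun k => d.ringWt h (4 ^ k * r)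
  have hτ0 : ∀ k i, 0 ≤ τ k i := fun k i => d.ringWt_nonneg hRε.le h (by positivity) i
  have hrk : ∀ k : ℕ, r ≤ 4 ^ k * r := fun k =>
    le_mul_of_one_le_left hr0.le (one_le_pow₀ (by norm_num))
  have hdisj : ∀ i, ∀ k l, k < l → τ k i * τ l i = 0 := fun i k l hkl => by
    by_contra hne
    obtain ⟨h1, h2⟩ := mul_ne_zero_iff.1 hne
    have h3 : h (d.pt i) ≤ 2 * (4 ^ k * r) := by
      by_contra h'
      exact h1 (if_neg (by tauto))
    have h4 : 4 ^ l * r ≤ h (d.pt i) := by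
      by_contra h'
      exact h2 (if_neg (by tauto))
    have h5 : (4:ℝ) ^ (k + 1) ≤ 4 ^ l := pow_le_pow_right₀ (by norm_num) hkl
    have h6 : (4:ℝ) ^ (k + 1) * r ≤ 4 ^ l * r := by gcongr
    have h7 := hrk k
    rw [pow_succ] at h6
    linarith
  have hdisj' : ∀ i, ∀ k l, k ≠ l → τ k i * τ l i = 0 := fun i k l hkl => by
    rcases lt_or_gt_of_ne hkl with h1 | h1
    · exact hdisj i k l h1
    · rw [mul_comm]
      exact hdisj i l k h1
  have hmass : ∀ k, ∑ i, τ k i * τ k i ≤ 144 * R ^ 2 * N₀ := fun k => by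
    have h1 := hrk k
    have h2 := d.sum_ringWt_sq_le hcard hε hε₀ (h := h) (r := 4 ^ k * r) (s := 2 * (4 ^ k * r))
      (z := z) (by positivity) fun p hp => hp
    refine h2.trans ?_
    have h3 : 0 < 4 ^ k * r := by positivity
    have h4 : 2 * (4 ^ k * r) + ε ≤ 3 * (4 ^ k * r) := by nlinarith
    calc (4 * R / (4 ^ k * r)) ^ 2 * (N₀ * (2 * (4 ^ k * r) + ε) ^ 2)
        ≤ (4 * R / (4 ^ k * r)) ^ 2 * (N₀ * (3 * (4 ^ k * r)) ^ 2) := by gcongr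
      _ = 144 * R ^ 2 * N₀ := by
        field_simp
        ring
  refine ⟨fun i => (∑ k ∈ Finset.range m, τ k i) / m, fun i => by
    have := Finset.sum_nonneg fun k (_ : k ∈ Finset.range m) => hτ0 k i
    positivity, ?_, ?_⟩
  · have h1 : ∀ i, (∑ k ∈ Finset.range m, τ k i) / m * ((∑ k ∈ Finset.range m, τ k i) / m) =
        (∑ k ∈ Finset.range m, τ k i * τ k i) / m ^ 2 := fun i => by
      rw [div_mul_div_comm, Finset.sum_mul_sum, ← pow_two]
      congr 1
      refine Finset.sum_congr rfl fun k hk => ?_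
      rw [Finset.sum_eq_single k (fun l _ hl => hdisj' i k l hl.symm) (fun h => absurd hk h)]
    simp only [h1]
    rw [← Finset.sum_div, Finset.sum_comm]
    have h2 : ∑ k ∈ Finset.range m, ∑ i, τ k i * τ k i ≤ m * (144 * R ^ 2 * N₀) := by
      refine (Finset.sum_le_sum fun k _ => hmass k).trans ?_
      rw [Finset.sum_const, Finset.card_range, nsmul_eq_mul]
    rw [div_le_div_iff₀ (by positivity) hm0]
    nlinarith
  · rintro C hC ⟨i, hi, hir⟩ ⟨j, hj, hjr⟩
    have h1 : wt (fun i => (∑ k ∈ Finset.range m, τ k i) / m) C =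
        (∑ k ∈ Finset.range m, wt (τ k) C) / m := by
      unfold wt
      rw [Finset.sum_comm, Finset.sum_div]
      refine Finset.sum_congr rfl fun i _ => ?_
      by_cases hi : i ∈ C
      · simp [indicator_of_mem hi]
      · simp [indicator_of_notMem hi]
    rw [h1, le_div_iff₀ hm0, one_mul]
    have h2 : ∀ k ∈ Finset.range m, (1:ℝ) ≤ wt (τ k) C := fun k hk => by
      have h3 := hrk k
      have h5 : (4:ℝ) ^ (k + 1) ≤ 4 ^ m :=
        pow_le_pow_right₀ (by norm_num) (Finset.mem_range.1 hk)
      have h6 : (4:ℝ) ^ (k + 1) * r ≤ 4 ^ m * r := by gcongr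
      rw [pow_succ] at h6
      exact d.one_le_wt_ringWt hh hRε (by linarith) hC hi hj (by change dist _ _ ≤ _; linarith)
        (by change _ ≤ dist _ _; linarith)
    have := Finset.sum_le_sum h2
    simpa using this

end Discretization

section

/-- A discretization together with a square tiling of a rectangle of controlled shape. -/
structure TiledDisc {X : Type*} [MetricSpace X] (χ : SquareChart X) (R ε A : ℝ) where
  d : Discretization χ R ε
  S : SqTiling d.ι
  graph_eq : S.toHexGraph = d.G
  a_eq : S.a = 1
  le_b : A⁻¹ ≤ S.b
  b_le : S.b ≤ A

/-- The upper right corner of the square of the piece owning a point. -/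
def TiledDisc.map {X : Type*} [MetricSpace X] {χ : SquareChart X} {R ε A : ℝ}
    (T : TiledDisc χ R ε A) (p : X) : ℝ × ℝ := (T.S.x (T.d.own p), T.S.y (T.d.own p))

/-- Opposite sides of the square, and distinct corners, are at distance at least `D`. -/
def SideDist {X : Type*} [MetricSpace X] (χ : SquareChart X) (D : ℝ) : Prop :=
  (∀ p q, (χ.κ p).1 = 0 → (χ.κ q).1 = 1 → D ≤ dist p q) ∧
    ∀ p q, (χ.κ p).2 = 0 → (χ.κ q).2 = 1 → D ≤ dist p q

variable {X : Type*} [MetricSpace X] {χ : SquareChart X}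

lemma exists_sideDist [CompactSpace X] (χ : SquareChart X) : ∃ D > (0:ℝ), SideDist χ D := by
  obtain ⟨D, hD, h⟩ := Metric.uniformContinuous_iff.1
    (CompactSpace.uniformContinuous_of_continuous χ.cont_inv) 1 one_pos
  refine ⟨D, hD, fun p q hp hq => ?_, fun p q hp hq => ?_⟩ <;> by_contra hlt
  all_goals
    have h1 := h (not_le.1 hlt)
    rw [Prod.dist_eq, max_lt_iff, Real.dist_eq, Real.dist_eq] at h1
  · rw [hp, hq] at h1
    norm_num at h1
  · rw [hp, hq] at h1
    norm_num at h1

lemma Discretization.exists_side_weight [CompactSpace X] {R ε N₀ ε₀ D : ℝ}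
    (d : Discretization χ R ε) (hcard : QuadCount X N₀ ε₀) (hN₀ : 0 ≤ N₀)
    (hε : 0 < ε) (hε₀ : ε ≤ ε₀) (hR : 1 ≤ R) (hεD : 16 * (R * ε) ≤ D)
    {s s' : Set X} (hs : s.Nonempty) (hss' : ∀ p ∈ s, ∀ q ∈ s', D ≤ dist p q) {E E' : Set d.ι}
    (hE : ∀ i ∈ E, ∃ p ∈ s, dist (d.pt i) p ≤ R * ε)
    (hE' : ∀ i ∈ E', ∃ p ∈ s', dist (d.pt i) p ≤ R * ε) :
    ∃ σ : d.ι → ℝ, (∀ i, 0 ≤ σ i) ∧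
      ∑ i, σ i * σ i ≤ (16 * R / D) ^ 2 * (N₀ * (diam (univ : Set X) + ε₀) ^ 2) ∧
      Separates d.G.adj σ E E' := by
  have hRε : 0 < R * ε := by positivity
  have hD : 0 < D := by linarith
  obtain ⟨p₀, hp₀⟩ := hs
  have hh : ∀ p q, infDist p s ≤ infDist q s + dist p q := fun p q => infDist_le_infDist_add_dist
  refine ⟨d.ringWt (fun p => infDist p s) (D / 4), d.ringWt_nonneg hRε.le _ (by positivity), ?_, ?_⟩
  · have h1 := d.sum_ringWt_sq_le hcard hε hε₀ (h := fun p => infDist p s) (r := D / 4)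
      (s := diam (univ : Set X)) (z := p₀) diam_nonneg fun p _ =>
        dist_le_diam_of_mem isBounded_of_compactSpace (mem_univ _) (mem_univ _)
    refine h1.trans ?_
    have h2 : 4 * R / (D / 4) = 16 * R / D := by field_simp; norm_num
    rw [h2]
    have h3 : 0 ≤ diam (univ : Set X) := diam_nonneg
    gcongr
  · rintro C hC ⟨i, hi, hiE⟩ ⟨j, hj, hjE⟩
    refine d.one_le_wt_ringWt hh hRε (by linarith) hC hi hj ?_ ?_
    · obtain ⟨p, hp, hip⟩ := hE i hiE
      have := infDist_le_dist_of_mem (x := d.pt i) hp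
      change infDist _ _ ≤ _
      linarith
    · obtain ⟨q, hq, hjq⟩ := hE' j hjE
      refine (le_infDist ⟨p₀, hp₀⟩).2 fun p hp => ?_
      have h1 := hss' p hp q hq
      have h2 := dist_triangle_left p q (d.pt j)
      linarith

/-- Discretizations of small scale carry square tilings of rectangles of controlled shape. -/
lemma exists_tiledDisc [CompactSpace X] {R N₀ ε₀ D : ℝ} (hcard : QuadCount X N₀ ε₀)
    (hN₀ : 0 < N₀) (hε₀ : 0 < ε₀) (hR : 1 ≤ R) (hD : 0 < D) (hχ : SideDist χ D) :
    ∃ A > (0:ℝ), ∀ ε, 0 < ε → ε ≤ ε₀ → 16 * (R * ε) ≤ D → ∀ d : Discretization χ R ε,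
      ∃ T : TiledDisc χ R ε A, T.d = d := by
  have h0 : 0 ≤ diam (univ : Set X) := diam_nonneg
  have hmem : ((0, 0) : ℝ × ℝ) ∈ Icc (0 : ℝ × ℝ) 1 := ⟨le_rfl, by simp [Prod.le_def]⟩
  have h00 := χ.right_inv _ hmem
  refine ⟨(16 * R / D) ^ 2 * (N₀ * (diam (univ : Set X) + ε₀) ^ 2), by positivity,
    fun ε hε hεε₀ hεD d => ?_⟩
  set A := (16 * R / D) ^ 2 * (N₀ * (diam (univ : Set X) + ε₀) ^ 2) with hA
  have hA0 : 0 < A := by positivity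
  obtain ⟨S, hG, ha, -, hmin⟩ := d.G.exists_sqTiling
  obtain ⟨σ, hσ0, hσ, hsep⟩ := d.exists_side_weight hcard hN₀.le hε hεε₀ hR hεD
    (s := {p | (χ.κ p).1 = 0}) (s' := {p | (χ.κ p).1 = 1}) ⟨χ.ψ (0, 0), by simp [h00]⟩
    (fun p hp q hq => hχ.1 p q hp hq) d.of_Lf d.of_Rt
  obtain ⟨σ', hσ0', hσ', hsep'⟩ := d.exists_side_weight hcard hN₀.le hε hεε₀ hR hεD
    (s := {p | (χ.κ p).2 = 0}) (s' := {p | (χ.κ p).2 = 1}) ⟨χ.ψ (0, 0), by simp [h00]⟩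
    (fun p hp q hq => hχ.2 p q hp hq) d.of_Bt d.of_Tp
  refine ⟨⟨d, S, hG, ha, ?_, (hmin σ hσ0 hsep).trans hσ⟩, rfl⟩
  have hy := isPot_pot d.G.symm (zero_le_one (α := ℝ)) hσ0' hsep'
  have hx := S.x_pot
  rw [ha] at hx
  have hx' : IsPot d.G.adj d.G.Lf d.G.Rt 1 S.ρ S.x := by rwa [← hG]
  have h1 := d.G.mul_le_sum zero_le_one S.ρ_nonneg hσ0' hx' hy
  have h2 := S.sum_mul_le σ'
  simp only [mul_comm (S.ρ _)] at h1
  have h3 : (1:ℝ) ≤ √((∑ k, σ' k * σ' k) * (S.a * S.b)) := by linarith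
  rw [Real.one_le_sqrt, ha, one_mul] at h3
  have h4 := S.b_pos
  rw [inv_le_iff_one_le_mul₀ hA0]
  nlinarith

namespace TiledDisc

variable {R ε A : ℝ} (T : TiledDisc χ R ε A)

/-- Oscillation bound for the two coordinates of the tiling map. -/
lemma osc_le {σ : T.d.ι → ℝ} (hσ : ∀ i, 0 ≤ σ i) {E : Set T.d.ι} (hE : AdjConn T.d.G.adj E)
    (h1 : Separates T.d.G.adj σ E T.d.G.Lf ∨ Separates T.d.G.adj σ E T.d.G.Rt)
    (h2 : Separates T.d.G.adj σ E T.d.G.Bt ∨ Separates T.d.G.adj σ E T.d.G.Tp) {m : ℝ}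
    (hm : ∑ i, σ i * σ i ≤ m) {i j : T.d.ι} (hi : i ∈ E) (hj : j ∈ E) :
    |T.S.x i - T.S.x j| ≤ √(m * A) ∧ |T.S.y i - T.S.y j| ≤ √(m * A) ∧
      min (T.S.ρ i) T.S.b ≤ √(m * A) := by
  have ha := T.a_eq
  have hb' := T.b_le
  obtain ⟨S, hS⟩ : ∃ S, S = T.S := ⟨_, rfl⟩
  have hG : T.d.G = S.toHexGraph := by rw [hS, T.graph_eq]
  rw [← hS] at ha hb' ⊢
  rw [hG] at hE h1 h2
  have h0 : (0:ℝ) ≤ ∑ i, σ i * σ i := Finset.sum_nonneg fun i _ => mul_self_nonneg _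
  have h3 : ∑ k, σ k * S.ρ k ≤ √(m * A) := by
    refine (S.sum_mul_le σ).trans (Real.sqrt_le_sqrt ?_)
    rw [ha, one_mul]
    have := S.b_pos
    have := h0.trans hm
    gcongr
  refine ⟨abs_le.2 ⟨?_, ?_⟩, abs_le.2 ⟨?_, ?_⟩, ?_⟩
  · have : S.x j - S.x i ≤ _ := SqTiling.sub_le_sum_of_mem (S := S.swap) hσ hE h2 hi hj
    have h4 : ∑ k, σ k * S.swap.ρ k ≤ √(m * A) := h3
    linarith
  · have : S.x i - S.x j ≤ _ := SqTiling.sub_le_sum_of_mem (S := S.swap) hσ hE h2 hj hi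
    have h4 : ∑ k, σ k * S.swap.ρ k ≤ √(m * A) := h3
    linarith
  · have : S.y j - S.y i ≤ _ := SqTiling.sub_le_sum_of_mem (S := S) hσ hE h1 hi hj
    change - _ ≤ S.y i - S.y j
    linarith
  · exact (SqTiling.sub_le_sum_of_mem (S := S) hσ hE h1 hj hi).trans h3
  · exact (SqTiling.min_le_sum_of_mem (S := S) hσ h1 hi).trans h3

end TiledDisc

end

section

variable {X : Type*} [MetricSpace X] {χ : SquareChart X}

lemma exists_geodesic_set (hgeo : IsGeodesicSpace X) (x y : X) :
    ∃ K : Set X, IsPreconnected K ∧ x ∈ K ∧ y ∈ K ∧ ∀ p ∈ K, dist x p ≤ dist x y := by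
  obtain ⟨γ, hγ⟩ := exists_geodesic_path hgeo x y
  refine ⟨range γ, isPreconnected_range γ.continuous, ⟨0, γ.source⟩, ⟨1, γ.target⟩, ?_⟩
  rintro p ⟨t, rfl⟩
  have := hγ t
  have := dist_nonneg (x := γ t) (y := y)
  linarith

namespace TiledDisc

variable {R ε A N₀ ε₀ D : ℝ} (T : TiledDisc χ R ε A)

lemma separates_or {r : ℝ} {z : X} {σ : T.d.ι → ℝ} {m : ℕ} (hD : 0 < D)
    (hRε : 16 * (R * ε) ≤ D)
    (hrD : 4 ^ m * r ≤ D / 4) {E : Set T.d.ι} (hE : ∀ i ∈ E, dist (T.d.pt i) z ≤ r)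
    (hσ : ∀ C, AdjConn T.d.G.adj C → (∃ i ∈ C, dist (T.d.pt i) z ≤ r) →
        (∃ j ∈ C, 4 ^ m * r ≤ dist (T.d.pt j) z) → 1 ≤ wt σ C)
    {s s' : Set X} (hss' : ∀ p ∈ s, ∀ q ∈ s', D ≤ dist p q) {F F' : Set T.d.ι}
    (hF : ∀ i ∈ F, ∃ p ∈ s, dist (T.d.pt i) p ≤ R * ε)
    (hF' : ∀ i ∈ F', ∃ p ∈ s', dist (T.d.pt i) p ≤ R * ε) :
    Separates T.d.G.adj σ E F ∨ Separates T.d.G.adj σ E F' := by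
  by_cases h : ∀ j ∈ F, 4 ^ m * r ≤ dist (T.d.pt j) z
  · refine Or.inl ?_
    rintro C hC ⟨i, hi, hiE⟩ ⟨j, hj, hjF⟩
    exact hσ C hC ⟨i, hi, hE i hiE⟩ ⟨j, hj, h j hjF⟩
  · push Not at h
    obtain ⟨k, hk, hkz⟩ := h
    refine Or.inr ?_
    rintro C hC ⟨i, hi, hiE⟩ ⟨j, hj, hjF⟩
    refine hσ C hC ⟨i, hi, hE i hiE⟩ ⟨j, hj, ?_⟩
    obtain ⟨p, hp, hkp⟩ := hF k hk
    obtain ⟨q, hq, hjq⟩ := hF' j hjF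
    have h1 := hss' p hp q hq
    have h2 := dist_triangle p z q
    have h3 := dist_triangle_left p z (T.d.pt k)
    have h4 := dist_triangle_left z q (T.d.pt j)
    linarith

lemma osc_le_of_close (hcard : QuadCount X N₀ ε₀) (hN₀ : 0 ≤ N₀) (hR : 1 ≤ R)
    (hD : 0 < D) (hχ : SideDist χ D) (hε : 0 < ε) (hε₀ : ε ≤ ε₀) (hRε : 16 * (R * ε) ≤ D) {r : ℝ}
    (hr : 4 * (R * ε) ≤ r) {m : ℕ} (hm : 0 < m) (hrD : 4 ^ m * r ≤ D / 4) {z : X}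
    {E : Set T.d.ι} (hE : AdjConn T.d.G.adj E) (hEz : ∀ i ∈ E, dist (T.d.pt i) z ≤ r)
    {i j : T.d.ι} (hi : i ∈ E) (hj : j ∈ E) :
    |T.S.x i - T.S.x j| ≤ √(144 * R ^ 2 * N₀ / m * A) ∧
      |T.S.y i - T.S.y j| ≤ √(144 * R ^ 2 * N₀ / m * A) ∧
      min (T.S.ρ i) T.S.b ≤ √(144 * R ^ 2 * N₀ / m * A) := by
  obtain ⟨σ, hσ0, hσm, hσ⟩ := T.d.exists_log_weight hcard hN₀ hε hε₀ hR z hr hm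
  exact T.osc_le hσ0 hE
    (T.separates_or hD hRε hrD hEz hσ (fun p hp q hq => hχ.1 p q hp hq) T.d.of_Lf T.d.of_Rt)
    (T.separates_or hD hRε hrD hEz hσ (fun p hp q hq => hχ.2 p q hp hq) T.d.of_Bt T.d.of_Tp)
    hσm hi hj

/-- Maps given by fine square tilings are equicontinuous up to a small error, and the squares are
small. -/
lemma equicontinuous (hgeo : IsGeodesicSpace X) (hcard : QuadCount X N₀ ε₀) (hN₀ : 0 ≤ N₀)
    (hε₀ : 0 < ε₀) (hR : 1 ≤ R) (hA : 0 < A) (hD : 0 < D) (hχ : SideDist χ D) {δ : ℝ}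
    (hδ : 0 < δ) :
    ∃ τ > (0:ℝ), ∃ ε₁ > (0:ℝ), ∀ ε, 0 < ε → ε ≤ ε₁ → ∀ T : TiledDisc χ R ε A,
      (∀ i, T.S.ρ i ≤ δ) ∧ ∀ p q, dist p q ≤ τ → dist (T.map p) (T.map q) ≤ δ := by
  obtain ⟨m, hm⟩ := exists_nat_gt ((144 * R ^ 2 * N₀ * A) / (min δ (A⁻¹ / 2)) ^ 2)
  have hδ' : 0 < min δ (A⁻¹ / 2) := by positivity
  have hm0 : (0:ℝ) < m := lt_of_le_of_lt (by positivity) hm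
  have hbound : √(144 * R ^ 2 * N₀ / m * A) ≤ min δ (A⁻¹ / 2) := by
    rw [Real.sqrt_le_left hδ'.le, div_mul_eq_mul_div, div_le_iff₀ hm0,
      ← div_le_iff₀' (by positivity)]
    linarith
  obtain ⟨r, hr0, hrD⟩ : ∃ r > (0:ℝ), 4 ^ m * r ≤ D / 4 :=
    ⟨D / 4 / 4 ^ m, by positivity, by field_simp; exact le_rfl⟩
  refine ⟨r / 2, by positivity, min ε₀ (min (D / (16 * R)) (r / (4 * R))), by positivity,
    fun ε hε hεε T => ?_⟩
  simp only [le_min_iff] at hεε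
  obtain ⟨h1, h2, h3⟩ := hεε
  rw [le_div_iff₀ (by positivity)] at h2 h3
  have hbound' := le_min_iff.1 hbound
  constructor
  · intro i
    have h4 := (T.osc_le_of_close hcard hN₀ hR hD hχ hε h1 (by linarith) (by linarith)
      (by exact_mod_cast hm0) hrD (adjConn_singleton i)
      (z := T.d.pt i) (fun j hj => by rw [mem_singleton_iff.1 hj, dist_self]; exact hr0.le)
      rfl rfl).2.2
    rcases min_le_iff.1 (h4.trans hbound) with h5 | h5
    · exact h5.trans (min_le_left _ _)
    · have h6 := T.le_b
      have h7 : 0 < A⁻¹ := by positivity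
      linarith [h5.trans (min_le_right _ _)]
  · intro p q hpq
    obtain ⟨K, hK, hp, hq, hKp⟩ := exists_geodesic_set hgeo p q
    obtain ⟨E, hE, hKE, hEK⟩ := T.d.tiles K hK
    have h4 := T.osc_le_of_close hcard hN₀ hR hD hχ hε h1 (by linarith) (by linarith)
      (by exact_mod_cast hm0) hrD hE (z := p) (fun i hi => by
        obtain ⟨k, hk, hik⟩ := hEK i hi
        have h5 := hKp k hk
        have h6 := dist_triangle_right (T.d.pt i) p k
        linarith) (hKE p hp) (hKE q hq)
    rw [Prod.dist_eq, max_le_iff, Real.dist_eq, Real.dist_eq]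
    exact ⟨h4.1.trans hbound'.1, h4.2.1.trans hbound'.1⟩

/-- The Loewner type estimate for maps given by square tilings. -/
lemma lt_of_separated (hgeo : IsGeodesicSpace X) (hcard : QuadCount X N₀ ε₀) (hN₀ : 0 ≤ N₀)
    (hR : 1 ≤ R) (hε : 0 < ε) (hε₀ : ε ≤ ε₀) {z a b w : X} {r : ℝ} (hza : dist z a ≤ r / 16)
    (hr : 32 * (R * ε) ≤ r) {K : Set X} (hK : IsPreconnected K) (hb : b ∈ K) (hw : w ∈ K)
    (hKz : ∀ p ∈ K, r ≤ dist z p) {n : ℕ} (hn : 576 * (144 * R ^ 2 * N₀) < n) {s₁ s₂ : ℝ}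
    (hs₁ : 0 < s₁) (hρ : ∀ k, T.S.ρ k ≤ s₁ / 4) (hbz : dist (T.map b) (T.map z) ≤ s₁)
    (h1 : s₂ ≤ 1) (h2 : s₂ ≤ T.S.b) (haz : s₂ ≤ dist (T.map a) (T.map z))
    (hwz : s₂ ≤ dist (T.map w) (T.map z)) : s₂ < 4 ^ n * s₁ := by
  by_contra! hle
  have hRε : 0 < R * ε := by positivity
  obtain ⟨K', hK', hz, ha, hK'z⟩ := exists_geodesic_set hgeo z a
  obtain ⟨E, hE, hKE, hEK⟩ := T.d.tiles K' hK'
  obtain ⟨F, hF, hKF, hFK⟩ := T.d.tiles K hK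
  obtain ⟨σ, hσ0, hσm, hσ⟩ := T.d.exists_log_weight hcard hN₀ hε hε₀ hR z (r := r / 8)
    (by linarith) one_pos
  have hsep : Separates T.d.G.adj σ E F := by
    rintro C hC ⟨i, hi, hiE⟩ ⟨j, hj, hjF⟩
    refine hσ C hC ⟨i, hi, ?_⟩ ⟨j, hj, ?_⟩
    · obtain ⟨p, hp, hip⟩ := hEK i hiE
      have h3 := hK'z p hp
      have h4 := dist_triangle_right (T.d.pt i) z p
      linarith
    · obtain ⟨p, hp, hjp⟩ := hFK j hjF
      have h3 := hKz p hp
      have h4 := dist_triangle_left z p (T.d.pt j)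
      norm_num
      linarith
  rw [← T.graph_eq] at hE hF hsep
  have h3 := T.S.nat_le_sum_of_separates (x₀ := T.S.x (T.d.own z)) (y₀ := T.S.y (T.d.own z))
    (T.S.x_pot.nonneg _) (T.S.x_pot.le _) (T.S.y_pot.nonneg _) (T.S.y_pot.le _) hs₁
    (by rwa [T.a_eq]) h2 hρ hσ0 hE hF ⟨_, hKE z hz, by simpa using hs₁.le⟩ ⟨_, hKE a ha, haz⟩
    ⟨_, hKF b hb, hbz⟩ ⟨_, hKF w hw, hwz⟩ hsep n hle
  rw [Nat.cast_one, div_one] at hσm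
  linarith

end TiledDisc

end

section

variable {X : Type*} [MetricSpace X] {χ : SquareChart X}

lemma TiledDisc.exists_map_close {R ε A : ℝ} (T : TiledDisc χ R ε A) {δ : ℝ} (hδ : 0 < δ)
    (hρ : ∀ i, T.S.ρ i ≤ δ) {s t : ℝ} (hs : s ∈ Icc (0:ℝ) 1) (ht : t ∈ Icc 0 T.S.b) :
    ∃ p, dist (T.map p) (s, t) ≤ 2 * δ := by
  have hb := T.S.b_pos
  obtain ⟨s', h1, h2, h3⟩ := exists_mem_Ioo_notMem (a := max 0 (s - δ)) (b := min 1 (s + δ))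
    (max_lt (lt_min one_pos (by linarith [hs.1])) (lt_min (by linarith [hs.2]) (by linarith)))
    T.S.finite_xLevels
  obtain ⟨t', h4, h5, h6⟩ := exists_mem_Ioo_notMem (a := max 0 (t - δ)) (b := min T.S.b (t + δ))
    (max_lt (lt_min hb (by linarith [ht.1])) (lt_min (by linarith [ht.2]) (by linarith)))
    T.S.swap.finite_xLevels
  rw [max_lt_iff] at h1 h4
  rw [lt_min_iff] at h2 h5
  have h2' : s' < T.S.a := by rw [T.a_eq]; exact h2.1
  obtain ⟨i, ⟨hi, -⟩, hi1, hi2⟩ := T.S.exists_mem_vwin h1.1 h2' h3 h4.1 h5.1 h6 le_rfl le_rfl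
  obtain ⟨hC, hB, -⟩ := T.S.vstrip_conn h1.1 h2' h3
  have hsub := T.d.own_surj (T.S.vstrip s')
  rw [← T.graph_eq] at hsub
  obtain ⟨p, hp⟩ := hsub hC hB hi
  have hρi := hρ i
  refine ⟨p, ?_⟩
  have hmap : T.map p = (T.S.x i, T.S.y i) := by rw [TiledDisc.map, hp]
  rw [hmap, Prod.dist_eq, max_le_iff, Real.dist_eq, Real.dist_eq, abs_le, abs_le]
  refine ⟨⟨?_, ?_⟩, ?_, ?_⟩
  · change -_ ≤ T.S.x i - s
    linarith [hi.2]
  · change T.S.x i - s ≤ _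
    linarith [hi.1]
  · change -_ ≤ T.S.y i - t
    linarith
  · change T.S.y i - t ≤ _
    linarith

/-- The properties of limits of maps given by square tilings. -/
structure IsTilingLimit (χ : SquareChart X) (F : X → ℝ × ℝ) (B H : ℝ) : Prop where
  pos : 0 < B
  cont : Continuous F
  range_eq : range F = Icc 0 (1, B)
  left : ∀ p, (χ.κ p).1 = 0 → (F p).1 = 0
  right : ∀ p, (χ.κ p).1 = 1 → (F p).1 = 1
  bot : ∀ p, (χ.κ p).2 = 0 → (F p).2 = 0
  top : ∀ p, (χ.κ p).2 = 1 → (F p).2 = B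
  loewner : ∀ z a b w r, 0 < r → dist z a ≤ r / 16 → ∀ K, IsPreconnected K → b ∈ K → w ∈ K →
    (∀ p ∈ K, r ≤ dist z p) →
      min (min 1 B) (min (dist (F a) (F z)) (dist (F w) (F z))) ≤ H * dist (F b) (F z)

lemma exists_isTilingLimit [CompactSpace X] (hgeo : IsGeodesicSpace X) {N₀ ε₀ : ℝ}
    (hcard : QuadCount X N₀ ε₀) (hN₀ : 0 < N₀) (hε₀ : 0 < ε₀) (χ : SquareChart X) :
    ∃ F B H, 0 < H ∧ IsTilingLimit χ F B H := by
  obtain ⟨D, hD, hχ⟩ := exists_sideDist χ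
  obtain ⟨R, hR, hdisc⟩ := exists_discretization hgeo χ hcard
  obtain ⟨A, hA, htiled⟩ := exists_tiledDisc (χ := χ) hcard hN₀ hε₀ hR hD hχ
  have hR0 : 0 < R := by linarith
  have hT : ∀ n : ℕ, ∃ ε, 0 < ε ∧ ε ≤ ε₀ ∧ ε ≤ 1 / (n + 1) ∧ Nonempty (TiledDisc χ R ε A) := by
    intro n
    refine ⟨min ε₀ (min (D / (16 * R)) (1 / (n + 1))), by positivity, min_le_left _ _,
      (min_le_right _ _).trans (min_le_right _ _), ?_⟩
    obtain ⟨d⟩ := hdisc (min ε₀ (min (D / (16 * R)) (1 / (n + 1)))) (by positivity)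
      (min_le_left _ _)
    obtain ⟨T, -⟩ := htiled _ (by positivity) (min_le_left _ _) (by
      have h1 : min ε₀ (min (D / (16 * R)) (1 / (n + 1))) ≤ D / (16 * R) :=
        (min_le_right _ _).trans (min_le_left _ _)
      rw [le_div_iff₀ (by positivity)] at h1
      linarith) d
    exact ⟨T⟩
  choose ε hε hεε₀ hεn hTn using hT
  let T := fun n => (hTn n).some
  let U : Ultrafilter ℕ := hyperfilter ℕ
  have hU : (U : Filter ℕ) ≤ atTop := Nat.hyperfilter_le_atTop
  have hεlim : ∀ δ > 0, ∀ᶠ n in (U : Filter ℕ), ε n ≤ δ := fun δ hδ => by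
    have h1 : Tendsto ε atTop (𝓝 0) := squeeze_zero (fun n => (hε n).le) hεn
      tendsto_one_div_add_atTop_nhds_zero_nat
    exact (h1.mono_left hU).eventually (ge_mem_nhds hδ)
  have hequi : ∀ δ > 0, ∃ τ > (0:ℝ), ∀ᶠ n in (U : Filter ℕ), (∀ i, (T n).S.ρ i ≤ δ) ∧
      ∀ p q, dist p q ≤ τ → dist ((T n).map p) ((T n).map q) ≤ δ := fun δ hδ => by
    obtain ⟨τ, hτ, ε₁, hε₁, h⟩ := TiledDisc.equicontinuous hgeo hcard hN₀.le hε₀ hR hA hD hχ hδ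
    refine ⟨τ, hτ, ?_⟩
    filter_upwards [hεlim ε₁ hε₁] with n hn
    exact h _ (hε n) hn _
  obtain ⟨F, hF⟩ : ∃ F : X → ℝ × ℝ, ∀ p, Tendsto (fun n => (T n).map p) U (𝓝 (F p)) := by
    have h1 : ∀ p, ∃ y, Tendsto (fun n => (T n).map p) U (𝓝 y) := fun p => by
      obtain ⟨y, -, hy⟩ := (isCompact_Icc (a := ((0, 0) : ℝ × ℝ)) (b := (1, A))).ultrafilter_le_nhds
        (U.map fun n => (T n).map p) (by
          rw [Ultrafilter.coe_map, Filter.le_principal_iff, mem_map]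
          refine univ_mem' fun n => ⟨⟨(T n).S.x_pot.nonneg _, (T n).S.y_pot.nonneg _⟩,
            ((T n).S.x_pot.le _).trans_eq (T n).a_eq, ((T n).S.y_pot.le _).trans (T n).b_le⟩)
      exact ⟨y, hy⟩
    choose F hF using h1
    exact ⟨F, hF⟩
  obtain ⟨B, hBA, hB⟩ : ∃ B, B ∈ Icc A⁻¹ A ∧ Tendsto (fun n => (T n).S.b) U (𝓝 B) := by
    obtain ⟨y, hy, hy'⟩ := (isCompact_Icc (a := A⁻¹) (b := A)).ultrafilter_le_nhds
      (U.map fun n => (T n).S.b) (by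
        rw [Ultrafilter.coe_map, Filter.le_principal_iff, mem_map]
        exact univ_mem' fun n => ⟨(T n).le_b, (T n).b_le⟩)
    exact ⟨y, hy, hy'⟩
  have hB0 : 0 < B := lt_of_lt_of_le (by positivity) hBA.1
  have hdist : ∀ p q, Tendsto (fun n => dist ((T n).map p) ((T n).map q)) U
      (𝓝 (dist (F p) (F q))) := fun p q => (hF p).dist (hF q)
  have hcontF : Continuous F := by
    rw [Metric.continuous_iff]
    intro q δ hδ
    obtain ⟨τ, hτ, h⟩ := hequi (δ / 2) (by positivity)
    refine ⟨τ, hτ, fun p hp => ?_⟩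
    have h1 : dist (F p) (F q) ≤ δ / 2 :=
      le_of_tendsto (hdist p q) (h.mono fun n hn => hn.2 p q hp.le)
    linarith
  have hfst : ∀ p, Tendsto (fun n => (T n).S.x ((T n).d.own p)) U (𝓝 (F p).1) := fun p =>
    (continuous_fst.tendsto _).comp (hF p)
  have hsnd : ∀ p, Tendsto (fun n => (T n).S.y ((T n).d.own p)) U (𝓝 (F p).2) := fun p =>
    (continuous_snd.tendsto _).comp (hF p)
  obtain ⟨n, hn⟩ := exists_nat_gt (576 * (144 * R ^ 2 * N₀))
  refine ⟨F, B, 4 ^ n, by positivity, hB0, hcontF, ?_, fun p hp => ?_, fun p hp => ?_,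
    fun p hp => ?_, fun p hp => ?_, ?_⟩
  · refine Subset.antisymm ?_ ?_
    · rintro _ ⟨p, rfl⟩
      exact ⟨⟨ge_of_tendsto' (hfst p) fun n => (T n).S.x_pot.nonneg _,
        ge_of_tendsto' (hsnd p) fun n => (T n).S.y_pot.nonneg _⟩,
        le_of_tendsto' (hfst p) fun n => ((T n).S.x_pot.le _).trans_eq (T n).a_eq,
        le_of_tendsto_of_tendsto' (hsnd p) hB fun n => (T n).S.y_pot.le _⟩
    · rintro ⟨s, t⟩ ⟨⟨hs0, ht0⟩, hs1, ht1⟩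
      rw [← (isCompact_range hcontF).isClosed.closure_eq, Metric.mem_closure_iff]
      intro δ hδ
      obtain ⟨τ, hτ, h⟩ := hequi (δ / 8) (by positivity)
      have h1 : ∀ᶠ n in (U : Filter ℕ), ∃ p, dist ((T n).map p) (s, t) ≤ δ / 2 := by
        filter_upwards [h, hB.eventually (Metric.closedBall_mem_nhds B (by positivity : 0 < δ / 8))]
          with n hn hnB
        rw [Real.dist_eq, abs_le] at hnB
        obtain ⟨p, hp⟩ := (T n).exists_map_close (by positivity) hn.1 (s := s)
          (t := min t (T n).S.b) ⟨hs0, hs1⟩ ⟨le_min ht0 (T n).S.b_pos.le, min_le_right _ _⟩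
        refine ⟨p, (dist_triangle _ (s, min t (T n).S.b) _).trans ?_⟩
        have h2 : dist (s, min t (T n).S.b) (s, t) ≤ δ / 8 := by
          rw [Prod.dist_eq, dist_self, max_le_iff]
          refine ⟨by positivity, ?_⟩
          change dist (min t (T n).S.b) t ≤ _
          rw [Real.dist_eq, abs_le]
          rcases min_cases t (T n).S.b with h3 | h3 <;> rw [h3.1] <;>
            constructor <;> linarith [show t ≤ B from ht1]
        linarith
      obtain ⟨p, hp⟩ := h1.choice
      obtain ⟨q, -, hq⟩ := isCompact_univ.ultrafilter_le_nhds (U.map p) (by simp)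
      refine ⟨F q, mem_range_self q, ?_⟩
      have hq' : Tendsto p U (𝓝 q) := hq
      have h3 : dist (F q) (s, t) ≤ δ / 8 + δ / 2 := by
        refine le_of_tendsto ((hF q).dist tendsto_const_nhds) ?_
        filter_upwards [h, hp, hq'.eventually (Metric.closedBall_mem_nhds q hτ)] with n h4 h5 h6
        have h7 := h4.2 q (p n) (by rwa [dist_comm])
        have h8 := dist_triangle ((T n).map q) ((T n).map (p n)) (s, t)
        linarith
      rw [dist_comm]
      linarith
  · refine le_antisymm (le_of_forall_pos_le_add fun δ hδ => ?_)
      (ge_of_tendsto' (hfst p) fun n => (T n).S.x_pot.nonneg _)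
    obtain ⟨_, _, h⟩ := hequi δ hδ
    rw [zero_add]
    refine le_of_tendsto (hfst p) (h.mono fun n hn => ?_)
    refine ((T n).S.x_pot.start _ ?_).trans (hn.1 _)
    rw [(T n).graph_eq]
    exact (T n).d.own_Lf p hp
  · refine tendsto_nhds_unique (hfst p) (tendsto_const_nhds.congr fun n => ?_)
    rw [(T n).S.x_pot.finish, (T n).a_eq]
    rw [(T n).graph_eq]
    exact (T n).d.own_Rt p hp
  · refine le_antisymm (le_of_forall_pos_le_add fun δ hδ => ?_)
      (ge_of_tendsto' (hsnd p) fun n => (T n).S.y_pot.nonneg _)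
    obtain ⟨_, _, h⟩ := hequi δ hδ
    rw [zero_add]
    refine le_of_tendsto (hsnd p) (h.mono fun n hn => ?_)
    refine ((T n).S.y_pot.start _ ?_).trans (hn.1 _)
    rw [(T n).graph_eq]
    exact (T n).d.own_Bt p hp
  · refine tendsto_nhds_unique (hsnd p) (hB.congr fun n => ?_)
    rw [(T n).S.y_pot.finish]
    rw [(T n).graph_eq]
    exact (T n).d.own_Tp p hp
  · intro z a b w r hr hza K hK hb hw hKz
    by_contra! hlt
    obtain ⟨s₂, h1, h2⟩ := exists_between hlt
    have h4n : (0:ℝ) < 4 ^ n := by positivity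
    obtain ⟨s₁, h3, h4⟩ := exists_between ((lt_div_iff₀' h4n).2 h1)
    simp only [lt_min_iff] at h2
    have hs₁ : 0 < s₁ := lt_of_le_of_lt dist_nonneg h3
    rw [lt_div_iff₀' h4n] at h4
    obtain ⟨_, _, h5⟩ := hequi (s₁ / 4) (by positivity)
    have h6 : ∀ᶠ n in (U : Filter ℕ), False := by
      filter_upwards [h5, hεlim (r / (32 * R)) (by positivity),
        (hdist b z).eventually (gt_mem_nhds h3), hB.eventually (lt_mem_nhds h2.1.2),
        (hdist a z).eventually (lt_mem_nhds h2.2.1), (hdist w z).eventually (lt_mem_nhds h2.2.2)]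
        with k k1 k2 k3 k4 k5 k6
      rw [le_div_iff₀ (by positivity)] at k2
      have := (T k).lt_of_separated hgeo hcard hN₀.le hR (hε k) (hεε₀ k) hza (by linarith) hK hb hw
        hKz hn hs₁ k1.1 k3.le h2.1.1.le k4.le k5.le k6.le
      linarith
    exact h6.exists.choose_spec

end

section

/-- A weak form of quasisymmetry. -/
def WeakQS {X Y : Type*} [MetricSpace X] [MetricSpace Y] (c H : ℝ) (F : X → Y) : Prop :=
  ∀ z a b, dist z a ≤ c * dist z b → dist (F z) (F a) ≤ H * dist (F z) (F b)

variable {X : Type*} [MetricSpace X] {χ : SquareChart X}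

namespace IsTilingLimit

variable {F : X → ℝ × ℝ} {B H : ℝ}

lemma exists_far (hF : IsTilingLimit χ F B H) {D : ℝ} (hχ : SideDist χ D) (z : X) :
    ∃ w, D / 2 ≤ dist z w ∧ B / 2 ≤ dist (F w) (F z) := by
  have key : ∀ s : ℝ, s ∈ Icc (0:ℝ) 1 → (∀ p, (χ.κ p).1 = s → D / 2 ≤ dist z p) →
      ∃ w, D / 2 ≤ dist z w ∧ B / 2 ≤ dist (F w) (F z) := fun s hs h => by
    have h0 := χ.right_inv (s, 0) ⟨⟨hs.1, le_rfl⟩, hs.2, zero_le_one⟩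
    have h1 := χ.right_inv (s, 1) ⟨⟨hs.1, zero_le_one⟩, hs.2, le_rfl⟩
    have hsnd : ∀ w, |(F w).2 - (F z).2| ≤ dist (F w) (F z) := fun w => le_max_right _ _
    rcases le_total (B / 2) (F z).2 with h2 | h2
    · refine ⟨χ.ψ (s, 0), h _ (by rw [h0]), le_trans ?_ (hsnd _)⟩
      rw [hF.bot _ (by rw [h0]), zero_sub, abs_neg]
      exact h2.trans (le_abs_self _)
    · refine ⟨χ.ψ (s, 1), h _ (by rw [h1]), le_trans ?_ (hsnd _)⟩
      rw [hF.top _ (by rw [h1])]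
      exact le_trans (by linarith) (le_abs_self _)
  by_cases h : ∀ p, (χ.κ p).1 = 0 → D / 2 ≤ dist z p
  · exact key 0 ⟨le_rfl, zero_le_one⟩ h
  · push Not at h
    obtain ⟨p, hp, hpz⟩ := h
    refine key 1 ⟨zero_le_one, le_rfl⟩ fun q hq => ?_
    have h1 := hχ.1 p q hp hq
    have h2 := dist_triangle_left p q z
    linarith

lemma exists_weakQS (hF : IsTilingLimit χ F B H) [CompactSpace X] (hH : 0 < H) {lam : ℝ}
    (hlam : 1 ≤ lam) (hllc : LLC₂ X lam) : ∃ c > (0:ℝ), ∃ H' > (0:ℝ), WeakQS c H' F := by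
  obtain ⟨D, hD, hχ⟩ := exists_sideDist χ
  have hB := hF.pos
  have hd : 0 ≤ diam (univ : Set X) := diam_nonneg
  refine ⟨min (1 / (16 * lam)) (D / (32 * lam * (diam (univ : Set X) + 1))), by positivity,
    max 1 B / min 1 (B / 2) * H, by positivity, fun z a b hab => ?_⟩
  have hFF : ∀ p, F p ∈ Icc (0 : ℝ × ℝ) (1, B) := fun p => hF.range_eq ▸ mem_range_self p
  have hdF : dist (F a) (F z) ≤ max 1 B := by
    obtain ⟨⟨h1, h2⟩, h3, h4⟩ := hFF a
    obtain ⟨⟨h5, h6⟩, h7, h8⟩ := hFF z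
    exact max_le_max (Real.dist_le_of_mem_Icc_01 ⟨h1, h3⟩ ⟨h5, h7⟩)
      ((Real.dist_le_of_mem_Icc ⟨h2, h4⟩ ⟨h6, h8⟩).trans (sub_zero B).le)
  have key : min (min 1 (B / 2)) (dist (F a) (F z)) ≤ H * dist (F b) (F z) := by
    rcases eq_or_ne z b with rfl | hzb
    · rw [dist_self, mul_zero] at hab
      rw [dist_le_zero.1 hab, dist_self, mul_zero]
      exact min_le_right _ _
    obtain ⟨w, hw, hwF⟩ := hF.exists_far hχ z
    have hzb' := dist_pos.2 hzb
    obtain ⟨C, hC, hbC, hwC, hCz⟩ := hllc z (min (dist z b) (D / 2)) (by positivity) b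
      (by rw [mem_ball', not_lt]; exact min_le_left _ _) w
      (by rw [mem_ball', not_lt]; exact (min_le_right _ _).trans hw)
    have h1 := hF.loewner z a b w (min (dist z b) (D / 2) / lam) (by positivity) (by
      rw [div_div, le_div_iff₀ (by positivity)]
      refine le_min ?_ ?_
      · have h2 : min (1 / (16 * lam)) (D / (32 * lam * (diam (univ : Set X) + 1))) * dist z b ≤
          1 / (16 * lam) * dist z b := by gcongr; exact min_le_left _ _
        calc dist z a * (lam * 16) ≤ 1 / (16 * lam) * dist z b * (lam * 16) := by
              gcongr; exact hab.trans h2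
          _ = dist z b := by field_simp
      · have h3 : dist z b ≤ diam (univ : Set X) + 1 := by
          have := dist_le_diam_of_mem (isBounded_of_compactSpace (s := (univ : Set X)))
            (mem_univ z) (mem_univ b)
          linarith
        have h2 : min (1 / (16 * lam)) (D / (32 * lam * (diam (univ : Set X) + 1))) * dist z b ≤
          D / (32 * lam * (diam (univ : Set X) + 1)) * (diam (univ : Set X) + 1) := by
            gcongr; exact min_le_right _ _
        calc dist z a * (lam * 16) ≤ D / (32 * lam * (diam (univ : Set X) + 1)) *
              (diam (univ : Set X) + 1) * (lam * 16) := by gcongr; exact hab.trans h2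
          _ = D / 2 := by field_simp; norm_num) C hC hbC hwC fun p hp => by
        have := hCz hp
        rwa [mem_compl_iff, mem_ball', not_lt] at this
    refine le_trans ?_ h1
    simp only [le_min_iff, min_le_iff]
    refine ⟨⟨Or.inl (Or.inl le_rfl), Or.inl (Or.inr (by linarith))⟩, Or.inr le_rfl,
      Or.inl (Or.inr hwF)⟩
  rw [dist_comm, dist_comm (F z)]
  have hm : 0 < min 1 (B / 2) := by positivity
  have hM : min 1 (B / 2) ≤ max 1 B := (min_le_left _ _).trans (le_max_left _ _)
  rw [mul_assoc, div_mul_eq_mul_div, le_div_iff₀ hm]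
  rcases min_le_iff.1 key with h | h
  · gcongr
  · rw [mul_comm]
    gcongr

lemma injective (hF : IsTilingLimit χ F B H) [PreconnectedSpace X] {c H' : ℝ} (hc : 0 < c)
    (hW : WeakQS c H' F) : Function.Injective F := by
  intro p q hpq
  by_contra hne
  have hclosed : IsClosed (F ⁻¹' {F p}) := isClosed_singleton.preimage hF.cont
  have hopen : IsOpen (F ⁻¹' {F p}) := by
    rw [Metric.isOpen_iff]
    intro z hz
    obtain ⟨b, hb, hbz⟩ : ∃ b, F b = F p ∧ z ≠ b := by
      by_cases h : z = p
      · exact ⟨q, hpq.symm, h ▸ hne⟩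
      · exact ⟨p, rfl, h⟩
    have := dist_pos.2 hbz
    refine ⟨c * dist z b, by positivity, fun a ha => ?_⟩
    have hz' : F z = F p := hz
    have h1 := hW z a b (mem_ball'.1 ha).le
    rw [hz', hb, dist_self, mul_zero] at h1
    exact (dist_le_zero.1 h1).symm
  have huniv := IsClopen.eq_univ ⟨hclosed, hopen⟩ ⟨p, rfl⟩
  have hB := hF.pos
  have h0 : ((0, 0) : ℝ × ℝ) ∈ range F := by
    rw [hF.range_eq]
    exact ⟨le_rfl, zero_le_one, hB.le⟩
  have h1 : ((1, B) : ℝ × ℝ) ∈ range F := by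
    rw [hF.range_eq]
    exact ⟨⟨zero_le_one, hB.le⟩, le_rfl⟩
  obtain ⟨x, hx⟩ := h0
  obtain ⟨y, hy⟩ := h1
  have hx' : x ∈ F ⁻¹' {F p} := huniv ▸ mem_univ x
  have hy' : y ∈ F ⁻¹' {F p} := huniv ▸ mem_univ y
  have := hx.symm.trans (Eq.trans hx' (Eq.trans hy'.symm hy))
  simp at this

end IsTilingLimit

end

section Radial

variable {V W : Type*} [NormedAddCommGroup V] [NormedSpace ℝ V] [NormedAddCommGroup W]
  [NormedSpace ℝ W]

/-- The norm preserving map which is a positive multiple of `e` on each ray. -/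
def radial (e : V ≃L[ℝ] W) (v : V) : W := (‖v‖ / ‖e v‖) • e v

lemma norm_radial (e : V ≃L[ℝ] W) (v : V) : ‖radial e v‖ = ‖v‖ := by
  rcases eq_or_ne v 0 with rfl | hv
  · simp [radial]
  · have : ‖e v‖ ≠ 0 := by simpa using hv
    rw [radial, norm_smul, norm_div, norm_norm, norm_norm, div_mul_cancel₀ _ this]

lemma radial_symm_radial (e : V ≃L[ℝ] W) (v : V) : radial e.symm (radial e v) = v := by
  rcases eq_or_ne v 0 with rfl | hv
  · simp [radial]
  · have h1 : 0 < ‖e v‖ := by simpa using hv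
    have h2 : 0 < ‖v‖ := by simpa using hv
    have h3 : e.symm (radial e v) = (‖v‖ / ‖e v‖) • v := by simp [radial]
    rw [radial, norm_radial, h3, norm_smul, norm_div, norm_norm, norm_norm, smul_smul]
    convert one_smul ℝ v using 2
    field_simp

lemma exists_norm_radial_sub_le (e : V ≃L[ℝ] W) :
    ∃ M > (0:ℝ), ∀ v v', ‖radial e v - radial e v'‖ ≤ M * ‖v - v'‖ := by
  let C := ‖(e : V →L[ℝ] W)‖
  let C' := ‖(e.symm : W →L[ℝ] V)‖
  have hC : ∀ v, ‖e v‖ ≤ C * ‖v‖ := (e : V →L[ℝ] W).le_opNorm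
  have hC' : ∀ v, ‖v‖ ≤ C' * ‖e v‖ := fun v => by
    simpa using (e.symm : W →L[ℝ] V).le_opNorm (e v)
  have hC0 : 0 ≤ C := norm_nonneg _
  have hC0' : 0 ≤ C' := norm_nonneg _
  refine ⟨1 + 2 * C' * C, by positivity, fun v v' => ?_⟩
  rcases eq_or_ne v 0 with rfl | hv
  · have h0 : radial e 0 = 0 := by simp [radial]
    rw [h0, zero_sub, norm_neg, norm_radial, zero_sub, norm_neg]
    exact le_mul_of_one_le_left (norm_nonneg _) (by linarith [mul_nonneg hC0' hC0])
  rcases eq_or_ne v' 0 with rfl | hv'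
  · have h0 : radial e 0 = 0 := by simp [radial]
    rw [h0, sub_zero, norm_radial, sub_zero]
    exact le_mul_of_one_le_left (norm_nonneg _) (by linarith [mul_nonneg hC0' hC0])
  have h1 : 0 < ‖e v‖ := by simpa using hv
  have h1' : 0 < ‖e v'‖ := by simpa using hv'
  have h2 : radial e v - radial e v' = ((‖v‖ - ‖v'‖) / ‖e v‖) • e v +
      (‖v'‖ / (‖e v‖ * ‖e v'‖)) • ((‖e v'‖ - ‖e v‖) • e v + ‖e v‖ • (e v - e v')) := by
    rw [radial, radial]
    match_scalars <;> field_simp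
    ring
  have h3 : ‖((‖v‖ - ‖v'‖) / ‖e v‖) • e v‖ ≤ ‖v - v'‖ := by
    rw [norm_smul, norm_div, norm_norm, div_mul_cancel₀ _ h1.ne']
    exact abs_norm_sub_norm_le v v'
  have h4 : ‖(‖e v'‖ - ‖e v‖) • e v + ‖e v‖ • (e v - e v')‖ ≤ 2 * ‖e v‖ * (C * ‖v - v'‖) := by
    have h5 : ‖e v - e v'‖ ≤ C * ‖v - v'‖ := by simpa using hC (v - v')
    have h6 : ‖‖e v'‖ - ‖e v‖‖ ≤ ‖e v - e v'‖ := by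
      rw [← norm_neg (e v - e v'), neg_sub]
      exact abs_norm_sub_norm_le _ _
    calc _ ≤ ‖‖e v'‖ - ‖e v‖‖ * ‖e v‖ + ‖e v‖ * ‖e v - e v'‖ := by
          refine (norm_add_le _ _).trans ?_
          rw [norm_smul, norm_smul, norm_norm]
      _ ≤ C * ‖v - v'‖ * ‖e v‖ + ‖e v‖ * (C * ‖v - v'‖) := by
          gcongr
          exact h6.trans h5
      _ = _ := by ring
  rw [h2]
  calc _ ≤ ‖v - v'‖ + ‖v'‖ / (‖e v‖ * ‖e v'‖) * (2 * ‖e v‖ * (C * ‖v - v'‖)) := by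
        refine (norm_add_le _ _).trans (add_le_add h3 ?_)
        rw [norm_smul, Real.norm_of_nonneg (by positivity)]
        gcongr
    _ = ‖v - v'‖ + ‖v'‖ * (2 * (C * ‖v - v'‖)) / ‖e v'‖ := by
        field_simp
    _ ≤ ‖v - v'‖ + (C' * ‖e v'‖) * (2 * (C * ‖v - v'‖)) / ‖e v'‖ := by
        gcongr
        exact hC' v'
    _ = _ := by
        field_simp

end Radial

/-- Rectangles are bilipschitz equivalent to the disc. -/
lemma exists_rectangle_homeomorph {B : ℝ} (hB : 0 < B) :
    ∃ h : Icc (0 : ℝ × ℝ) (1, B) ≃ₜ unitClosedDisc, ∃ M > (0:ℝ),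
      ∀ p q, dist (h p) (h q) ≤ M * dist p q ∧ dist p q ≤ M * dist (h p) (h q) := by
  let e : (ℝ × ℝ) ≃L[ℝ] EuclideanSpace ℝ (Fin 2) := ContinuousLinearEquiv.ofFinrankEq (by simp)
  obtain ⟨M₁, hM₁, h1⟩ := exists_norm_radial_sub_le e
  obtain ⟨M₂, hM₂, h2⟩ := exists_norm_radial_sub_le e.symm
  let s : ℝ × ℝ → ℝ × ℝ := fun p => (2 * p.1 - 1, 2 / B * p.2 - 1)
  let s' : ℝ × ℝ → ℝ × ℝ := fun p => ((p.1 + 1) / 2, B / 2 * (p.2 + 1))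
  have hs : ∀ p q, ‖s p - s q‖ ≤ (2 + 2 / B) * dist p q := fun p q => by
    rw [Prod.norm_def, Prod.dist_eq, max_le_iff]
    have h3 := le_max_left (dist p.1 q.1) (dist p.2 q.2)
    have h4 := le_max_right (dist p.1 q.1) (dist p.2 q.2)
    have h5 := dist_nonneg (x := p.1) (y := q.1)
    have hB' : 0 < 2 / B := by positivity
    constructor
    · have : (s p - s q).1 = 2 * (p.1 - q.1) := by simp [s]; ring
      rw [this, norm_mul, ← dist_eq_norm]
      norm_num
      nlinarith
    · have : (s p - s q).2 = 2 / B * (p.2 - q.2) := by simp [s]; ring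
      rw [this, norm_mul, Real.norm_of_nonneg hB'.le, ← dist_eq_norm]
      nlinarith
  have hs' : ∀ p q, dist (s' p) (s' q) ≤ (1 + B) * ‖p - q‖ := fun p q => by
    rw [← dist_eq_norm, Prod.dist_eq (x := s' p), Prod.dist_eq, max_le_iff]
    have h3 := le_max_left (dist p.1 q.1) (dist p.2 q.2)
    have h4 := le_max_right (dist p.1 q.1) (dist p.2 q.2)
    have h5 := dist_nonneg (x := p.1) (y := q.1)
    have h6 := dist_nonneg (x := p.2) (y := q.2)
    constructor
    · have : (s' p).1 - (s' q).1 = 1 / 2 * (p.1 - q.1) := by simp [s']; ring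
      rw [Real.dist_eq, this, abs_mul, ← Real.dist_eq, abs_of_pos (by norm_num)]
      nlinarith
    · have : (s' p).2 - (s' q).2 = B / 2 * (p.2 - q.2) := by simp [s']; ring
      rw [Real.dist_eq, this, abs_mul, ← Real.dist_eq, abs_of_pos (by positivity)]
      nlinarith
  have hss' : ∀ p, s (s' p) = p := fun p => by
    ext
    · simp [s, s']; ring
    · simp [s, s']; field_simp; ring
  have hs's : ∀ p, s' (s p) = p := fun p => by
    ext
    · simp [s, s']
    · simp [s, s']; field_simp
  have hmem : ∀ p ∈ Icc (0 : ℝ × ℝ) (1, B), ‖s p‖ ≤ 1 := by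
    rintro p ⟨⟨h3, h4⟩, h5, h6⟩
    change 0 ≤ p.1 at h3
    change 0 ≤ p.2 at h4
    change p.1 ≤ 1 at h5
    change p.2 ≤ B at h6
    rw [Prod.norm_def, max_le_iff, Real.norm_eq_abs, Real.norm_eq_abs, abs_le, abs_le]
    refine ⟨⟨?_, ?_⟩, ?_, ?_⟩
    · change -1 ≤ 2 * p.1 - 1
      linarith
    · change 2 * p.1 - 1 ≤ 1
      linarith
    · change -1 ≤ 2 / B * p.2 - 1
      have : 0 ≤ 2 / B * p.2 := by positivity
      linarith
    · change 2 / B * p.2 - 1 ≤ 1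
      have : 2 / B * p.2 ≤ 2 := by rw [div_mul_eq_mul_div, div_le_iff₀ hB]; linarith
      linarith
  have hmem' : ∀ p, ‖p‖ ≤ 1 → s' p ∈ Icc (0 : ℝ × ℝ) (1, B) := by
    intro p hp
    rw [Prod.norm_def, max_le_iff, Real.norm_eq_abs, Real.norm_eq_abs, abs_le, abs_le] at hp
    obtain ⟨⟨h3, h4⟩, h5, h6⟩ := hp
    refine ⟨⟨?_, ?_⟩, ?_, ?_⟩
    · change 0 ≤ (p.1 + 1) / 2
      linarith
    · change 0 ≤ B / 2 * (p.2 + 1)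
      have : 0 ≤ p.2 + 1 := by linarith
      positivity
    · change (p.1 + 1) / 2 ≤ 1
      linarith
    · change B / 2 * (p.2 + 1) ≤ B
      nlinarith
  let E : Icc (0 : ℝ × ℝ) (1, B) ≃ unitClosedDisc := {
    toFun := fun p => ⟨radial e (s p), by
      rw [unitClosedDisc, mem_closedBall_zero_iff, norm_radial]
      exact hmem p p.2⟩
    invFun := fun q => ⟨s' (radial e.symm q), hmem' _ (by
      rw [norm_radial]
      exact mem_closedBall_zero_iff.1 q.2)⟩
    left_inv := fun p => Subtype.ext (by
      change s' (radial e.symm (radial e (s p))) = p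
      rw [radial_symm_radial, hs's])
    right_inv := fun q => Subtype.ext (by
      change radial e (s (s' (radial e.symm q))) = q
      rw [hss']
      exact radial_symm_radial e.symm (q : EuclideanSpace ℝ (Fin 2))) }
  have hE : ∀ p q, dist (E p) (E q) ≤ M₁ * (2 + 2 / B) * dist p q := fun p q => by
    rw [Subtype.dist_eq, dist_eq_norm, mul_assoc]
    refine (h1 (s p) (s q)).trans ?_
    gcongr
    exact hs p q
  have hE' : ∀ p q, dist (E.symm p) (E.symm q) ≤ (1 + B) * M₂ * dist p q := fun p q => by
    rw [Subtype.dist_eq, mul_assoc]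
    refine (hs' _ _).trans ?_
    gcongr
    rw [Subtype.dist_eq, dist_eq_norm]
    exact h2 _ _
  refine ⟨⟨E, ?_, ?_⟩, max (M₁ * (2 + 2 / B)) ((1 + B) * M₂), by positivity, fun p q => ⟨?_, ?_⟩⟩
  · exact (LipschitzWith.of_dist_le_mul (K := ⟨M₁ * (2 + 2 / B), by positivity⟩) hE).continuous
  · exact (LipschitzWith.of_dist_le_mul (K := ⟨(1 + B) * M₂, by positivity⟩) hE').continuous
  · refine (hE p q).trans ?_
    gcongr
    exact le_max_left _ _
  · have := hE' (E p) (E q)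
    rw [E.symm_apply_apply, E.symm_apply_apply] at this
    refine this.trans ?_
    change _ ≤ _ * dist (E p) (E q)
    gcongr
    exact le_max_right _ _

open Classical in
lemma nonempty_squareChart {X : Type*} [MetricSpace X] (φ : unitClosedDisc ≃ₜ X) :
    Nonempty (SquareChart X) := by
  obtain ⟨h, -⟩ := exists_rectangle_homeomorph one_pos
  let g : Icc (0 : ℝ × ℝ) 1 ≃ₜ X := h.trans φ
  have h0 : (0 : ℝ × ℝ) ∈ Icc (0 : ℝ × ℝ) 1 := ⟨le_rfl, zero_le_one, zero_le_one⟩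
  let ψ : ℝ × ℝ → X := fun q => if hq : q ∈ Icc (0 : ℝ × ℝ) 1 then g ⟨q, hq⟩ else g ⟨0, h0⟩
  have hψ : ∀ q : Icc (0 : ℝ × ℝ) 1, ψ q = g q := fun q => dif_pos q.2
  exact ⟨{
    ψ := ψ
    κ := fun p => g.symm p
    cont := continuousOn_iff_continuous_domRestrict.2 (g.continuous.congr fun q => (hψ q).symm)
    cont_inv := continuous_subtype_val.comp g.symm.continuous
    mem := fun p => (g.symm p).2
    left_inv := fun p => by rw [hψ, g.apply_symm_apply]
    right_inv := fun q hq => by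
      rw [show ψ q = g ⟨q, hq⟩ from hψ ⟨q, hq⟩, g.symm_apply_apply] }⟩

/-- A monotone function with limit zero at zero is dominated by a homeomorphism of `[0, ∞)`. -/
lemma exists_homeomorph_ge {θ : ℝ → ℝ} (hmono : Monotone θ) (h0 : ∀ t, 0 ≤ θ t)
    (hlim : ∀ s > 0, ∃ τ > 0, θ τ ≤ s) : ∃ η : ℝ≥0 ≃ₜ ℝ≥0, ∀ t : ℝ≥0, θ t ≤ η t := by
  have hint : ∀ a b, IntervalIntegrable θ volume a b := fun a b => hmono.intervalIntegrable
  let g : ℝ → ℝ := fun t => ∫ u in (1:ℝ)..2, θ (t * u)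
  have hmul : ∀ t, 0 ≤ t → Monotone fun u => θ (t * u) := fun t ht u v huv =>
    hmono (mul_le_mul_of_nonneg_left huv ht)
  have hgi : ∀ t, 0 ≤ t → IntervalIntegrable (fun u => θ (t * u)) volume 1 2 := fun t ht =>
    (hmul t ht).intervalIntegrable
  have hg_ge : ∀ t, 0 ≤ t → θ t ≤ g t := fun t ht => by
    have := intervalIntegral.integral_mono_on (by norm_num : (1:ℝ) ≤ 2)
      (intervalIntegrable_const (c := θ t)) (hgi t ht) fun u hu =>
        hmono (le_mul_of_one_le_right ht hu.1)
    norm_num at this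
    exact this
  have hg_le : ∀ t, 0 ≤ t → g t ≤ θ (t * 2) := fun t ht => by
    have := intervalIntegral.integral_mono_on (by norm_num : (1:ℝ) ≤ 2) (hgi t ht)
      (intervalIntegrable_const (c := θ (t * 2))) fun u hu =>
        hmono (mul_le_mul_of_nonneg_left hu.2 ht)
    norm_num at this
    exact this
  have hg_mono : ∀ s t, 0 ≤ s → s ≤ t → g s ≤ g t := fun s t hs hst =>
    intervalIntegral.integral_mono_on (by norm_num : (1:ℝ) ≤ 2) (hgi s hs)
      (hgi t (hs.trans hst)) fun u hu => hmono (mul_le_mul_of_nonneg_right hst (by linarith [hu.1]))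
  have hg0 : g 0 = 0 := by
    have h1 : θ 0 ≤ 0 := le_of_forall_pos_le_add fun s hs => by
      obtain ⟨τ, hτ, h⟩ := hlim s hs
      have := hmono hτ.le
      linarith
    have h2 := hg_le 0 le_rfl
    rw [zero_mul] at h2
    exact le_antisymm (h2.trans h1) ((h0 0).trans (hg_ge 0 le_rfl))
  have hg_cont : ContinuousOn g (Ici 0) := by
    intro t ht
    rcases eq_or_lt_of_le (show 0 ≤ t from ht) with rfl | ht'
    · rw [Metric.continuousWithinAt_iff]
      intro s hs
      obtain ⟨τ, hτ, h⟩ := hlim (s / 2) (by positivity)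
      refine ⟨τ / 2, by positivity, fun {x} hx hxt => ?_⟩
      have hx0 : 0 ≤ x := hx
      rw [Real.dist_eq, sub_zero, abs_of_nonneg hx0] at hxt
      rw [hg0, Real.dist_eq, sub_zero, abs_of_nonneg ((h0 x).trans (hg_ge x hx0))]
      have h1 := hg_le x hx0
      have h2 : θ (x * 2) ≤ θ τ := hmono (by linarith)
      linarith
    · refine ContinuousAt.continuousWithinAt ?_
      have h1 : ContinuousAt (fun t => t⁻¹ * ((∫ u in (0:ℝ)..(t * 2), θ u) -
          ∫ u in (0:ℝ)..(t * 1), θ u)) t := by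
        have h2 := intervalIntegral.continuous_primitive hint 0
        refine ContinuousAt.mul (continuousAt_inv₀ ht'.ne') (Continuous.continuousAt ?_)
        exact (h2.comp (continuous_mul_const 2)).sub (h2.comp (continuous_mul_const 1))
      refine h1.congr ?_
      filter_upwards [lt_mem_nhds ht'] with x hx
      rw [intervalIntegral.integral_interval_sub_left (hint _ _) (hint _ _)]
      have h3 := intervalIntegral.integral_comp_mul_left (a := 1) (b := 2) θ hx.ne'
      rw [smul_eq_mul] at h3
      exact h3.symm
  let f : ℝ≥0 → ℝ≥0 := fun t => t + ⟨g t, (h0 t).trans (hg_ge t t.2)⟩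
  have hf : ∀ t, (f t : ℝ) = t + g t := fun t => rfl
  have hf_mono : StrictMono f := fun s t hst => by
    rw [← NNReal.coe_lt_coe, hf, hf]
    have h1 := hg_mono s t s.2 (NNReal.coe_le_coe.2 hst.le)
    have h2 := NNReal.coe_lt_coe.2 hst
    linarith
  have hf_cont : Continuous f := by
    refine NNReal.isEmbedding_coe.continuous_iff.2 ?_
    change Continuous fun t : ℝ≥0 => (t : ℝ) + g t
    exact NNReal.continuous_coe.add
      (hg_cont.comp_continuous NNReal.continuous_coe fun t => t.2)
  have hf_surj : Function.Surjective f := fun y => by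
    have h1 := intermediate_value_Icc (zero_le : 0 ≤ y) hf_cont.continuousOn
    obtain ⟨x, -, hx⟩ := h1 (show y ∈ Icc (f 0) (f y) from
      ⟨by
        rw [← NNReal.coe_le_coe, hf, NNReal.coe_zero, hg0, add_zero]
        exact y.2, by
        rw [← NNReal.coe_le_coe, hf]
        linarith [(h0 y).trans (hg_ge y y.2)]⟩)
    exact ⟨x, hx⟩
  refine ⟨(hf_mono.orderIsoOfSurjective f hf_surj).toHomeomorph, fun t => ?_⟩
  change θ t ≤ (f t : ℝ)
  rw [hf]
  have h1 := hg_ge t t.2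
  have h2 : (0:ℝ) ≤ t := t.2
  linarith

/-- A relation between ratios which is bounded, and small for small ratios, is controlled by a
homeomorphism of `[0, ∞)`. -/
lemma exists_homeomorph_of_ratio {P : ℝ → ℝ → Prop}
    (hsmall : ∀ s > 0, ∃ τ > 0, ∀ t q, t ≤ τ → P t q → q ≤ s)
    (hbdd : ∀ T, ∃ N, ∀ t q, t ≤ T → P t q → q ≤ N) :
    ∃ η : ℝ≥0 ≃ₜ ℝ≥0, ∀ (t : ℝ≥0) q, P t q → q ≤ η t := by
  let Q : ℝ → Set ℝ := fun t => {q | q = 0 ∨ ∃ t' ≤ t, P t' q}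
  have hne : ∀ t, (Q t).Nonempty := fun t => ⟨0, Or.inl rfl⟩
  have hbd : ∀ t, BddAbove (Q t) := fun t => by
    obtain ⟨N, hN⟩ := hbdd t
    refine ⟨max 0 N, ?_⟩
    rintro q (rfl | ⟨t', ht', hq⟩)
    · exact le_max_left _ _
    · exact (hN t' q ht' hq).trans (le_max_right _ _)
  obtain ⟨η, hη⟩ := exists_homeomorph_ge (θ := fun t => sSup (Q t))
    (fun s t hst => csSup_le_csSup (hbd t) (hne s) (by
      rintro q (rfl | ⟨t', ht', hq⟩)
      · exact Or.inl rfl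
      · exact Or.inr ⟨t', ht'.trans hst, hq⟩))
    (fun t => le_csSup (hbd t) (Or.inl rfl)) (fun s hs => by
      obtain ⟨τ, hτ, h⟩ := hsmall s hs
      refine ⟨τ, hτ, csSup_le (hne τ) ?_⟩
      rintro q (rfl | ⟨t', ht', hq⟩)
      · exact hs.le
      · exact h t' q ht' hq)
  exact ⟨η, fun t q hq => (le_csSup (hbd t) (Or.inr ⟨t, le_rfl, hq⟩)).trans (hη t)⟩

/-- Among sufficiently many points of a bounded subset of the plane, two are close. -/
lemma exists_dist_lt_of_norm_le (R : ℝ) {δ : ℝ} (hδ : 0 < δ) : ∃ N : ℕ, ∀ v : ℕ → E2,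
    (∀ i ≤ N, ‖v i‖ ≤ R) → ∃ i j, i < j ∧ j ≤ N ∧ dist (v i) (v j) < δ := by
  obtain ⟨t, ht, hcov⟩ := Metric.totallyBounded_iff.1
    (isCompact_closedBall (0 : E2) R).totallyBounded (δ / 2) (by positivity)
  refine ⟨ht.toFinset.card, fun v hv => ?_⟩
  have hc : ∀ i ∈ Finset.range (ht.toFinset.card + 1), ∃ y ∈ t, dist (v i) y < δ / 2 := by
    intro i hi
    have h1 := hcov (mem_closedBall_zero_iff.2 (hv i (Nat.lt_succ_iff.1 (Finset.mem_range.1 hi))))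
    obtain ⟨y, hy, h2⟩ := mem_iUnion₂.1 h1
    exact ⟨y, hy, h2⟩
  choose! y hy hvy using hc
  obtain ⟨i, hi, j, hj, hij, h⟩ := Finset.exists_ne_map_eq_of_card_lt_of_maps_to
    (s := Finset.range (ht.toFinset.card + 1)) (t := ht.toFinset) (by simp)
    (f := y) (fun i hi => ht.mem_toFinset.2 (hy i hi))
  have key : dist (v i) (v j) < δ := by
    have h1 := hvy i hi
    have h2 := hvy j hj
    rw [← h] at h2
    linarith [dist_triangle_right (v i) (v j) (y i)]
  rcases hij.lt_or_gt with h1 | h1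
  · exact ⟨i, j, h1, Nat.lt_succ_iff.1 (Finset.mem_range.1 hj), key⟩
  · exact ⟨j, i, h1, Nat.lt_succ_iff.1 (Finset.mem_range.1 hi), by rwa [dist_comm]⟩

namespace WeakQS

variable {X : Type*} [MetricSpace X] {c H : ℝ}

/-- On a geodesic space the weak quasisymmetry condition self-improves to all ratios. -/
lemma dist_le_of_dist_le {Y : Type*} [MetricSpace Y] {G : X → Y} (hgeo : IsGeodesicSpace X)
    (hG : WeakQS c H G) (hc : 0 < c) (hH : 0 < H) (k : ℕ) : ∀ z a b : X,
    dist z b ≤ c * (1 + c) ^ k * dist z a →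
      dist (G z) (G b) ≤ H * (1 + H) ^ k * dist (G z) (G a) := by
  induction k with
  | zero =>
    intro z a b h
    simpa using hG z b a (by simpa using h)
  | succ k ih =>
    intro z a b h
    obtain ⟨b', h1, h2⟩ := exists_dist_eq hgeo z b (s := dist z b / (1 + c)) (by positivity)
      (div_le_self dist_nonneg (by linarith))
    have h3 : dist z b' ≤ c * (1 + c) ^ k * dist z a := by
      rw [h1, div_le_iff₀ (by positivity)]
      calc _ ≤ _ := h
        _ = _ := by ring
    have h4 := ih z a b' h3
    have h5 : dist b' b ≤ c * dist b' z := by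
      rw [dist_comm b' z, h1, h2]
      refine le_of_eq ?_
      field_simp
      ring
    have h6 := hG b' b z h5
    rw [dist_comm (G b') (G z)] at h6
    have h7 := dist_triangle (G z) (G b') (G b)
    calc dist (G z) (G b) ≤ (1 + H) * dist (G z) (G b') := by linarith
      _ ≤ (1 + H) * (H * (1 + H) ^ k * dist (G z) (G a)) :=
        mul_le_mul_of_nonneg_left h4 (by positivity)
      _ = _ := by ring

/-- Ratios of distances are bounded in terms of the ratios of their images. -/
lemma exists_ratio_bound {G : X → E2} (hgeo : IsGeodesicSpace X) (hG : WeakQS c H G)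
    (hinj : Function.Injective G) (hc : 0 < c) (hH : 0 < H) (T : ℝ) : ∃ Q, ∀ z a b : X, z ≠ b →
    dist (G z) (G a) ≤ T * dist (G z) (G b) → dist z a / dist z b ≤ Q := by
  obtain ⟨N, hN⟩ := exists_dist_lt_of_norm_le (H * T) (δ := 1 / H ^ 2) (by positivity)
  set K := 1 / c + 1 with hK
  have hK1 : 1 ≤ K := by
    rw [hK]
    linarith [show 0 < 1 / c by positivity]
  have hcK : c * (K - 1) = 1 := by
    rw [hK]
    field_simp
    ring
  have hpow : ∀ i ≤ N, K ^ (i + 1) ≤ K ^ (N + 1) := fun i hi => pow_le_pow_right₀ hK1 (by omega)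
  refine ⟨K ^ (N + 1) / c + K ^ (N + 1), fun z a b hzb h => ?_⟩
  have hs : 0 < dist z b := dist_pos.2 hzb
  have hD : 0 < dist (G z) (G b) := dist_pos.2 (hinj.ne hzb)
  by_contra! hlt
  rw [lt_div_iff₀ hs, add_mul] at hlt
  have hlt1 : K ^ (N + 1) * dist z b ≤ dist z a := by
    have : 0 ≤ K ^ (N + 1) / c * dist z b := by positivity
    linarith
  have hlt2 : K ^ (N + 1) * dist z b ≤ c * dist z a := by
    have h1 : 0 ≤ K ^ (N + 1) * dist z b := by positivity
    have h2 : K ^ (N + 1) / c * dist z b ≤ dist z a := by linarith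
    calc _ = c * (K ^ (N + 1) / c * dist z b) := by field_simp
      _ ≤ _ := mul_le_mul_of_nonneg_left h2 hc.le
  have hex : ∀ i ≤ N, ∃ p, dist z p = K ^ (i + 1) * dist z b := fun i hi => by
    obtain ⟨p, hp, -⟩ := exists_dist_eq hgeo z a (s := K ^ (i + 1) * dist z b) (by positivity)
      ((mul_le_mul_of_nonneg_right (hpow i hi) hs.le).trans hlt1)
    exact ⟨p, hp⟩
  have : Nonempty X := ⟨z⟩
  choose! p hp using hex
  have hge : ∀ i ≤ N, dist (G z) (G b) ≤ H * dist (G z) (G (p i)) := fun i hi => by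
    refine hG z b (p i) ?_
    rw [hp i hi, ← mul_assoc]
    refine le_mul_of_one_le_left hs.le ?_
    calc (1:ℝ) ≤ c * K := by linarith
      _ ≤ c * K ^ (i + 1) := mul_le_mul_of_nonneg_left (le_self_pow₀ hK1 (by omega)) hc.le
  have hle : ∀ i ≤ N, dist (G z) (G (p i)) ≤ H * dist (G z) (G a) := fun i hi => by
    refine hG z (p i) a ?_
    rw [hp i hi]
    exact (mul_le_mul_of_nonneg_right (hpow i hi) hs.le).trans hlt2
  have hsep : ∀ i j, i < j → j ≤ N → dist (G z) (G (p i)) ≤ H * dist (G (p i)) (G (p j)) := by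
    intro i j hij hj
    rw [dist_comm (G z)]
    refine hG (p i) z (p j) ?_
    have h1 := dist_triangle z (p i) (p j)
    have h2 : K * dist z (p i) ≤ dist z (p j) := by
      rw [hp i (hij.le.trans hj), hp j hj, ← mul_assoc, ← pow_succ']
      exact mul_le_mul_of_nonneg_right (pow_le_pow_right₀ hK1 (by omega)) hs.le
    rw [dist_comm (p i) z]
    calc dist z (p i) = c * ((K - 1) * dist z (p i)) := by rw [← mul_assoc, hcK, one_mul]
      _ ≤ _ := mul_le_mul_of_nonneg_left (by linarith) hc.le
  obtain ⟨i, j, hij, hj, hlt⟩ := hN (fun i => (dist (G z) (G b))⁻¹ • (G (p i) - G z))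
    (fun i hi => by
      rw [norm_smul, norm_inv, Real.norm_of_nonneg hD.le, ← dist_eq_norm, dist_comm (G (p i)),
        inv_mul_le_iff₀ hD]
      calc _ ≤ _ := hle i hi
        _ ≤ H * (T * dist (G z) (G b)) := mul_le_mul_of_nonneg_left h hH.le
        _ = _ := by ring)
  rw [dist_smul₀, dist_sub_right, norm_inv, Real.norm_of_nonneg hD.le, inv_mul_lt_iff₀ hD,
    mul_one_div, lt_div_iff₀ (by positivity)] at hlt
  have h1 := hge i (hij.le.trans hj)
  have h2 := mul_le_mul_of_nonneg_left (hsep i j hij hj) hH.le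
  nlinarith

/-- The inverse of a weakly quasisymmetric homeomorphism from a geodesic space onto a planar
set is quasisymmetric. -/
lemma isQuasisymmetric_symm {S : Set E2} {G : X ≃ₜ S} (hgeo : IsGeodesicSpace X)
    (hG : WeakQS c H G) (hc : 0 < c) (hH : 0 < H) : IsQuasisymmetric G.symm := by
  have hinj : Function.Injective fun x => (G x : E2) := Subtype.val_injective.comp G.injective
  obtain ⟨η, hη⟩ := exists_homeomorph_of_ratio (P := fun t q => ∃ z a b : X, z ≠ b ∧
      dist (G z) (G a) ≤ t * dist (G z) (G b) ∧ q = dist z a / dist z b) (fun s hs => by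
    obtain ⟨k, hk⟩ := pow_unbounded_of_one_lt (1 / (c * s)) (show 1 < 1 + c by linarith)
    have hk' : 1 ≤ c * (1 + c) ^ k * s := by
      rw [div_lt_iff₀ (by positivity)] at hk
      linarith
    refine ⟨1 / (2 * (H * (1 + H) ^ k)), by positivity, ?_⟩
    rintro t q ht ⟨z, a, b, hzb, h, rfl⟩
    have hs' : 0 < dist z b := dist_pos.2 hzb
    have hD : 0 < dist (G z) (G b) := dist_pos.2 (G.injective.ne hzb)
    by_contra! hlt
    rw [lt_div_iff₀ hs'] at hlt
    have h1 : dist z b ≤ c * (1 + c) ^ k * dist z a := by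
      calc dist z b ≤ c * (1 + c) ^ k * s * dist z b := le_mul_of_one_le_left hs'.le hk'
        _ = c * (1 + c) ^ k * (s * dist z b) := by ring
        _ ≤ _ := mul_le_mul_of_nonneg_left hlt.le (by positivity)
    have h2 := hG.dist_le_of_dist_le hgeo hc hH k z a b h1
    have h3 : H * (1 + H) ^ k * dist (G z) (G a) ≤ 1 / 2 * dist (G z) (G b) := by
      calc _ ≤ H * (1 + H) ^ k * (1 / (2 * (H * (1 + H) ^ k)) * dist (G z) (G b)) :=
            mul_le_mul_of_nonneg_left (h.trans (mul_le_mul_of_nonneg_right ht hD.le))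
              (by positivity)
        _ = _ := by field_simp
    linarith) (fun T => by
    obtain ⟨Q, hQ⟩ := exists_ratio_bound (G := fun x => (G x : E2)) hgeo hG hinj hc hH T
    refine ⟨Q, ?_⟩
    rintro t q ht ⟨z, a, b, hzb, h, rfl⟩
    exact hQ z a b hzb (h.trans (mul_le_mul_of_nonneg_right ht dist_nonneg)))
  refine ⟨η, fun z a b t h => ?_⟩
  rcases eq_or_ne z b with rfl | hzb
  · rw [dist_self, mul_zero] at h
    rw [dist_le_zero.1 h, dist_self, mul_zero]
  · have h1 := hη t _ ⟨G.symm z, G.symm a, G.symm b, G.symm.injective.ne hzb, by simpa using h, rfl⟩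
    rwa [div_le_iff₀ (dist_pos.2 (G.symm.injective.ne hzb))] at h1

end WeakQS

end DiscUniformization

/-- Corollary 6.3, Bonk–Kleiner for discs: quasisymmetric uniformization of
linearly locally connected geodesic discs with quadratic mass upper bound. -/
theorem bonk_kleiner_disc
    {X : Type*} [MetricSpace X] [MeasurableSpace X] [BorelSpace X]
    (hgeo : IsGeodesicSpace X) (φ : ↥unitClosedDisc ≃ₜ X)
    (hlen : HasFiniteLength (discBoundary φ))
    (L : ℝ) (hL : 0 < L)
    (hmass : ∀ (x : X) (r : ℝ), 0 < r → μH[2] (Metric.ball x r) ≤ ENNReal.ofReal (L * r ^ 2))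
    (hllc : LinearlyLocallyConnected X) :
    ∃ u : ↥unitClosedDisc ≃ₜ X, IsQuasisymmetric (⇑u) := by
  open DiscUniformization in
  have : CompactSpace ↥unitClosedDisc := isCompact_iff_compactSpace.1 (isCompact_closedBall 0 1)
  have : CompactSpace X := φ.compactSpace
  have : SimplyConnectedSpace X := simplyConnectedSpace_of_homeomorph φ
  have : LocallyPathConnectedSpace X := locallyPathConnectedSpace hgeo
  have : Nontrivial ↥unitClosedDisc := by
    obtain ⟨v, hv⟩ := exists_norm_eq E2 zero_le_one
    refine ⟨⟨0, mem_closedBall_self zero_le_one⟩, ⟨v, mem_closedBall_zero_iff.2 hv.le⟩, fun h => ?_⟩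
    have h1 : (0 : E2) = v := congrArg Subtype.val h
    rw [← h1, norm_zero] at hv
    exact zero_ne_one hv
  have : Nontrivial X := φ.symm.toEquiv.nontrivial
  obtain ⟨lam, hlam, hllc⟩ := hllc
  have hllc₂ : LLC₂ X lam := fun x r hr y hy z hz => by
    obtain ⟨C, -, hC, h⟩ := (hllc x r hr).2 y hy z hz
    exact ⟨C, hC.isPreconnected, h⟩
  obtain ⟨N₀, hN₀, ε₀, hε₀, hcard⟩ := exists_card_le hlam hllc₂ hL hmass
  obtain ⟨χ⟩ := nonempty_squareChart φ
  obtain ⟨F, B, H, hH, hF⟩ := exists_isTilingLimit hgeo hcard hN₀ hε₀ χ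
  obtain ⟨c, hc, H', hH', hW⟩ := hF.exists_weakQS hH hlam hllc₂
  have hinj := hF.injective hc hW
  let F' : X → Icc (0 : ℝ × ℝ) (1, B) := fun p => ⟨F p, hF.range_eq ▸ mem_range_self p⟩
  have hF' : Function.Bijective F' := by
    refine ⟨fun p q h => hinj (congrArg Subtype.val h), fun q => ?_⟩
    obtain ⟨p, hp⟩ : (q : ℝ × ℝ) ∈ range F := by
      rw [hF.range_eq]
      exact q.2
    exact ⟨p, Subtype.ext hp⟩
  let e : X ≃ₜ Icc (0 : ℝ × ℝ) (1, B) := Continuous.homeoOfEquivCompactToT2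
    (f := Equiv.ofBijective F' hF') (hF.cont.subtype_mk _)
  obtain ⟨h, M, hM, hbi⟩ := exists_rectangle_homeomorph hF.pos
  have hG : WeakQS c (M * H' * M) (e.trans h) := fun z a b hab => by
    change dist (h (e z)) (h (e a)) ≤ M * H' * M * dist (h (e z)) (h (e b))
    calc dist (h (e z)) (h (e a)) ≤ M * dist (e z) (e a) := (hbi _ _).1
      _ ≤ M * (H' * dist (e z) (e b)) := mul_le_mul_of_nonneg_left (hW z a b hab) hM.le
      _ ≤ M * (H' * (M * dist (h (e z)) (h (e b)))) :=
        mul_le_mul_of_nonneg_left (mul_le_mul_of_nonneg_left (hbi _ _).2 hH'.le) hM.le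
      _ = _ := by ring
  exact ⟨(e.trans h).symm, hG.isQuasisymmetric_symm hgeo hc (by positivity)⟩

end
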